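/- arXiv:1011.5443 — 3 statements merged into one kernel-verified Lean document; each statement's English description precedes it below -/
import Mathlib

section
/- Let ε, δ, p be positive reals with ε < 1/2, and let (V₁, V₂, V₃) be a triple of pairwise disjoint vertex sets such that for all i and j the density of (Vᵢ, Vⱼ) is d_{ij}p with d_{ij} ≥ δ. Then for every ε-typical vertex v ∈ V₁ there exist sets N''ⱼ ⊆ N(v) ∩ Vⱼ for j ∈ {2,3} such that: (i) the bipartite graph (N''₂, N''₃) contains at least (1 − 6ε − 2ε/δ)·d_{12}d_{13}d_{23}p³|V₂||V₃| edges, and if v is ε-good then it contains at least that many ε-good edges; and (ii) for {j,k} = {2,3}, no vertex of N''ⱼ has more than (1 + 2ε/δ)(1 + ε)²·d_{1k}d_{23}p²|V_k| neighbours in N''_k. -/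
open Finset

open scoped Classical

noncomputable section

namespace RandomTriangle

/-- Number of ordered adjacent pairs between `X` and `Y`. -/
def eBtw {V : Type*} (G : SimpleGraph V) (X Y : Finset V) : ℕ :=
  ((X ×ˢ Y).filter fun a => G.Adj a.1 a.2).card

/-- Edge density between `X` and `Y`. -/
def dens {V : Type*} (G : SimpleGraph V) (X Y : Finset V) : ℝ :=
  (eBtw G X Y : ℝ) / ((X.card : ℝ) * (Y.card : ℝ))

/-- Number of neighbours of `v` in `X`. -/
def degIn {V : Type*} (G : SimpleGraph V) (v : V) (X : Finset V) : ℕ :=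
  (X.filter fun w => G.Adj v w).card

/-- Neighbourhood of `v` inside `X`. -/
def nbhdIn {V : Type*} (G : SimpleGraph V) (v : V) (X : Finset V) : Finset V :=
  X.filter fun w => G.Adj v w

/-- Number of common neighbours of `u` and `w` inside `X`. -/
def codegIn {V : Type*} (G : SimpleGraph V) (u w : V) (X : Finset V) : ℕ :=
  (X.filter fun x => G.Adj u x ∧ G.Adj w x).card

/-- `(ε, p)`-regular pair `(X, Y)`. -/
def RegularPair {V : Type*} (G : SimpleGraph V) (ε p : ℝ) (X Y : Finset V) : Prop :=
  ∀ X' ⊆ X, ∀ Y' ⊆ Y, ε * X.card ≤ (X'.card : ℝ) → ε * Y.card ≤ (Y'.card : ℝ) →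
    |dens G X Y - dens G X' Y'| ≤ ε * p

/-- `(ε, p)`-regular triple. -/
def RegularTriple {V : Type*} (G : SimpleGraph V) (ε p : ℝ) (V₁ V₂ V₃ : Finset V) : Prop :=
  RegularPair G ε p V₁ V₂ ∧ RegularPair G ε p V₁ V₃ ∧ RegularPair G ε p V₂ V₃

/-- `v ∈ V₁` is an `ε`-typical vertex of the triple `(V₁, V₂, V₃)`:
its neighbourhoods in `V₂`, `V₃` have the expected size `(1 ± ε)·d₁ᵢp|Vᵢ|`
(note `d₁ᵢ p = dens G V₁ Vᵢ`), and they contain large subsets forming an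
`(ε, p)`-regular pair of density `(1 ± ε)·d₂₃p`. -/
def TypicalVertex {V : Type*} (G : SimpleGraph V) (ε p : ℝ) (V₁ V₂ V₃ : Finset V) (v : V) :
    Prop :=
  ((1 - ε) * (dens G V₁ V₂ * V₂.card) ≤ ((nbhdIn G v V₂).card : ℝ) ∧
    ((nbhdIn G v V₂).card : ℝ) ≤ (1 + ε) * (dens G V₁ V₂ * V₂.card)) ∧
  ((1 - ε) * (dens G V₁ V₃ * V₃.card) ≤ ((nbhdIn G v V₃).card : ℝ) ∧
    ((nbhdIn G v V₃).card : ℝ) ≤ (1 + ε) * (dens G V₁ V₃ * V₃.card)) ∧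
  ∃ N₂' ⊆ nbhdIn G v V₂, ∃ N₃' ⊆ nbhdIn G v V₃,
    (1 - ε) * ((nbhdIn G v V₂).card : ℝ) ≤ (N₂'.card : ℝ) ∧
    (1 - ε) * ((nbhdIn G v V₃).card : ℝ) ≤ (N₃'.card : ℝ) ∧
    RegularPair G ε p N₂' N₃' ∧
    (1 - ε) * dens G V₂ V₃ ≤ dens G N₂' N₃' ∧
    dens G N₂' N₃' ≤ (1 + ε) * dens G V₂ V₃

/-- An `ε`-typical triple: `(ε,p)`-regular and in each part all but at most an
`ε`-fraction of the vertices are `ε`-typical. -/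
def TypicalTriple {V : Type*} (G : SimpleGraph V) (ε p : ℝ) (V₁ V₂ V₃ : Finset V) : Prop :=
  RegularTriple G ε p V₁ V₂ V₃ ∧
  ((V₁.filter fun v => ¬ TypicalVertex G ε p V₁ V₂ V₃ v).card : ℝ) ≤ ε * V₁.card ∧
  ((V₂.filter fun v => ¬ TypicalVertex G ε p V₂ V₁ V₃ v).card : ℝ) ≤ ε * V₂.card ∧
  ((V₃.filter fun v => ¬ TypicalVertex G ε p V₃ V₁ V₂ v).card : ℝ) ≤ ε * V₃.card

/-- A `(δ, ε, p)`-super-regular triple. -/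
def SuperRegularTriple {V : Type*} (G : SimpleGraph V) (δ ε p : ℝ) (V₁ V₂ V₃ : Finset V) :
    Prop :=
  RegularTriple G ε p V₁ V₂ V₃ ∧
  δ * p ≤ dens G V₁ V₂ ∧ δ * p ≤ dens G V₁ V₃ ∧ δ * p ≤ dens G V₂ V₃ ∧
  (∀ v ∈ V₁, TypicalVertex G ε p V₁ V₂ V₃ v) ∧
  (∀ v ∈ V₂, TypicalVertex G ε p V₂ V₁ V₃ v) ∧
  (∀ v ∈ V₃, TypicalVertex G ε p V₃ V₁ V₂ v)

/-- An edge `(u, w)` with `u ∈ V₂`, `w ∈ V₃` is `ε`-good (w.r.t. `V₁`) if its endpoints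
have at least `(1 - ε)·d₁₂d₁₃p²|V₁|` common neighbours in `V₁`
(note `d₁₂d₁₃p² = dens G V₁ V₂ * dens G V₁ V₃`). -/
def GoodEdge {V : Type*} (G : SimpleGraph V) (ε : ℝ) (V₁ V₂ V₃ : Finset V) (u w : V) : Prop :=
  (1 - ε) * (dens G V₁ V₂ * dens G V₁ V₃ * V₁.card) ≤ (codegIn G u w V₁ : ℝ)

/-- An `ε`-typical vertex `v ∈ V₁` is `ε`-good if the pair of its neighbourhoods in
`V₂`, `V₃` spans at most `ε·d₁₂d₁₃d₂₃p³|V₂||V₃|` edges that are not `ε`-good. -/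
def GoodVertex {V : Type*} (G : SimpleGraph V) (ε p : ℝ) (V₁ V₂ V₃ : Finset V) (v : V) :
    Prop :=
  TypicalVertex G ε p V₁ V₂ V₃ v ∧
  ((((nbhdIn G v V₂) ×ˢ (nbhdIn G v V₃)).filter fun uw =>
      G.Adj uw.1 uw.2 ∧ ¬ GoodEdge G ε V₁ V₂ V₃ uw.1 uw.2).card : ℝ) ≤
    ε * (dens G V₁ V₂ * dens G V₁ V₃ * dens G V₂ V₃ * V₂.card * V₃.card)

/-- A `(δ, ε, p)`-strong-super-regular triple. -/
def StrongSuperRegularTriple {V : Type*} (G : SimpleGraph V) (δ ε p : ℝ)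
    (V₁ V₂ V₃ : Finset V) : Prop :=
  SuperRegularTriple G δ ε p V₁ V₂ V₃ ∧
  (∀ v ∈ V₁, GoodVertex G ε p V₁ V₂ V₃ v) ∧
  (∀ v ∈ V₂, GoodVertex G ε p V₂ V₁ V₃ v) ∧
  (∀ v ∈ V₃, GoodVertex G ε p V₃ V₁ V₂ v)

/-- A triangle packing: a collection of pairwise vertex-disjoint triangles of `G`. -/
def IsTrianglePacking {V : Type*} [DecidableEq V] (G : SimpleGraph V)
    (T : Finset (Finset V)) : Prop :=
  (∀ t ∈ T, t.card = 3 ∧ ∀ x ∈ t, ∀ y ∈ t, x ≠ y → G.Adj x y) ∧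
  (∀ s ∈ T, ∀ t ∈ T, s ≠ t → Disjoint s t)

def idx0 {k : ℕ} (t : Fin k) : Fin (3 * k) := ⟨3 * t.1, by have := t.2; omega⟩
def idx1 {k : ℕ} (t : Fin k) : Fin (3 * k) := ⟨3 * t.1 + 1, by have := t.2; omega⟩
def idx2 {k : ℕ} (t : Fin k) : Fin (3 * k) := ⟨3 * t.1 + 2, by have := t.2; omega⟩

/-- The endpoints of every edge between `A` and `B` have at most `4|C|p²` common
neighbours in `C`. -/
def CodegBound {V : Type*} (G : SimpleGraph V) (p : ℝ) (A B C : Finset V) : Prop :=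
  ∀ u ∈ A, ∀ w ∈ B, G.Adj u w → (codegIn G u w C : ℝ) ≤ 4 * C.card * p ^ 2

/-- The probability, in the Erdős–Rényi random graph `G(n, p)`, of the event `A`. -/
def gnpProb (n : ℕ) (p : ℝ) (A : Set (SimpleGraph (Fin n))) : ℝ :=
  ∑ G ∈ Finset.univ.filter (fun G => G ∈ A),
    p ^ ((Finset.univ.filter fun e : Sym2 (Fin n) => e ∈ G.edgeSet).card) *
      (1 - p) ^ (n.choose 2 - (Finset.univ.filter fun e : Sym2 (Fin n) => e ∈ G.edgeSet).card)

/-- A sequence of graph properties holds asymptotically almost surely in `G(n, p n)`. -/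
def AAS (p : ℕ → ℝ) (P : ∀ n : ℕ, SimpleGraph (Fin n) → Prop) : Prop :=
  Filter.Tendsto (fun n => gnpProb n (p n) {G | P n G}) Filter.atTop (nhds 1)

end RandomTriangle

open RandomTriangle

theorem aux_avg {V : Type*} (f : V → ℝ) (n : ℕ) : ∀ (S : Finset V), S.card = n → ∀ r ≤ n,
    ∃ Z ⊆ S, Z.card = r ∧ (r : ℝ) * ∑ w ∈ S, f w ≤ n * ∑ w ∈ Z, f w := by
  induction n with
  | zero =>
    intro S hS r hr
    refine ⟨S, Subset.rfl, by omega, ?_⟩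
    have : r = 0 := by omega
    subst this
    simp
  | succ n ih =>
    intro S hS r hr
    rcases Nat.lt_or_ge n r with h | h
    · have : r = n + 1 := by omega
      subst this
      exact ⟨S, Subset.rfl, hS, le_rfl⟩
    · have hne : S.Nonempty := by
        rw [← Finset.card_pos]; omega
      obtain ⟨m, hm, hmin⟩ := Finset.exists_min_image S f hne
      have hc : (S.erase m).card = n := by
        rw [Finset.card_erase_of_mem hm]; omega
      obtain ⟨Z, hZ, hZc, hZs⟩ := ih (S.erase m) hc r h
      refine ⟨Z, hZ.trans (Finset.erase_subset _ _), hZc, ?_⟩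
      have h1 : ∑ w ∈ S, f w = f m + ∑ w ∈ S.erase m, f w :=
        (Finset.add_sum_erase S f hm).symm
      have h2 : (r : ℝ) * f m ≤ ∑ w ∈ Z, f w := by
        have := Finset.card_nsmul_le_sum Z f (f m)
          (fun w hw => hmin w (Finset.mem_of_mem_erase (hZ hw)))
        rw [hZc, nsmul_eq_mul] at this
        exact this
      rw [h1]
      push_cast
      linarith

theorem aux_side {V : Type*} (S : Finset V) (f : V → ℝ) (ε μ ρ T : ℝ)
    (hε : 0 < ε) (hε2 : ε < 1 / 2) (hS : 0 < S.card) (hρ : 0 ≤ ρ)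
    (hsum : ∑ w ∈ S, f w = S.card * μ)
    (hreg : ∀ A ⊆ S, ε * S.card ≤ (A.card : ℝ) → ∑ w ∈ A, f w ≤ A.card * (μ + ρ))
    (hT : μ + ρ ≤ T) :
    ((S.filter fun w => T < f w).card : ℝ) ≤ ε * S.card ∧
    ((S.filter fun w => T < f w).card : ℝ) * ((1 - 2 * ε) * (T - μ)) ≤ 2 * ε * S.card * ρ := by
  set X := S.filter fun w => T < f w with hX
  have hn : (0 : ℝ) < S.card := by exact_mod_cast hS
  have hXS : X ⊆ S := Finset.filter_subset _ _
  have hXT : (X.card : ℝ) * T ≤ ∑ w ∈ X, f w := by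
    have := Finset.card_nsmul_le_sum X f T (fun w hw => (Finset.mem_filter.mp hw).2.le)
    rwa [nsmul_eq_mul] at this
  have hlt : (X.card : ℝ) < ε * S.card := by
    by_contra hcon
    push Not at hcon
    have h1 := hreg X hXS hcon
    have hXne : X.Nonempty := by
      rw [← Finset.card_pos]
      have : (0 : ℝ) < X.card := lt_of_lt_of_le (by positivity) hcon
      exact_mod_cast this
    have h2 : ∑ w ∈ X, T < ∑ w ∈ X, f w :=
      Finset.sum_lt_sum_of_nonempty hXne (fun w hw => (Finset.mem_filter.mp hw).2)
    rw [Finset.sum_const, nsmul_eq_mul] at h2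
    have : (X.card : ℝ) * (μ + ρ) ≤ X.card * T := by gcongr
    linarith
  refine ⟨hlt.le, ?_⟩
  rcases Nat.eq_zero_or_pos X.card with h0 | hpos
  · rw [h0]; push_cast; rw [zero_mul]; positivity
  have hj : (1 : ℝ) ≤ X.card := by exact_mod_cast hpos
  set k := ⌈ε * (S.card : ℝ)⌉₊ with hk
  have hk1 : ε * (S.card : ℝ) ≤ k := Nat.le_ceil _
  have hk2 : (k : ℝ) < ε * S.card + 1 := Nat.ceil_lt_add_one (by positivity)
  have hk3 : (k : ℝ) ≤ 2 * ε * S.card := by linarith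
  have hjk : X.card < k := by
    have : (X.card : ℝ) < k := by linarith
    exact_mod_cast this
  have hkn : k ≤ S.card := by
    have : (k : ℝ) ≤ S.card := by nlinarith
    exact_mod_cast this
  have hcs : (S \ X).card = S.card - X.card := Finset.card_sdiff_of_subset hXS
  obtain ⟨Z, hZ, hZc, hZs⟩ := aux_avg f _ (S \ X) hcs (k - X.card) (by omega)
  have hdis : Disjoint X Z := (Finset.disjoint_sdiff).mono_right hZ
  have hXZ : (X ∪ Z).card = k := by
    rw [Finset.card_union_of_disjoint hdis, hZc]; omega
  have h1 := hreg (X ∪ Z) (Finset.union_subset hXS (hZ.trans Finset.sdiff_subset))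
    (by rw [hXZ]; exact hk1)
  rw [hXZ, Finset.sum_union hdis] at h1
  have h2 : ∑ w ∈ S \ X, f w + ∑ w ∈ X, f w = ∑ w ∈ S, f w := Finset.sum_sdiff hXS
  rw [Nat.cast_sub hjk.le, Nat.cast_sub (by omega)] at hZs
  have hkn' : (k : ℝ) ≤ S.card := by exact_mod_cast hkn
  have hjk' : (X.card : ℝ) < k := by exact_mod_cast hjk
  generalize (X.card : ℝ) = j at *
  generalize (S.card : ℝ) = n at *
  generalize (k : ℝ) = k at *
  generalize ∑ w ∈ X, f w = eX at *
  generalize ∑ w ∈ Z, f w = eZ at *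
  have h3 : ∑ w ∈ S \ X, f w = n * μ - eX := by linarith
  rw [h3] at hZs
  have h4 : (n - j) * (eX + eZ) ≤ (n - j) * (k * (μ + ρ)) := by
    apply mul_le_mul_of_nonneg_left h1; linarith
  have h5 : (n - k) * (j * T) ≤ (n - k) * eX := by
    apply mul_le_mul_of_nonneg_left hXT; linarith
  have h6 : j * (n - k) * (T - μ) ≤ k * (n - j) * ρ := by nlinarith
  have h7 : k * (n - j) * ρ ≤ (2 * ε * n) * n * ρ := by
    apply mul_le_mul_of_nonneg_right _ hρ
    apply mul_le_mul hk3 (by linarith) (by linarith) (by positivity)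
  have h8 : j * ((1 - 2 * ε) * n) * (T - μ) ≤ j * (n - k) * (T - μ) := by
    apply mul_le_mul_of_nonneg_right _ (by linarith)
    apply mul_le_mul_of_nonneg_left _ (by linarith)
    linarith
  have h9 : n * (j * ((1 - 2 * ε) * (T - μ))) ≤ n * (2 * ε * n * ρ) := by
    calc _ = j * ((1 - 2 * ε) * n) * (T - μ) := by ring
      _ ≤ _ := h8.trans (h6.trans h7)
      _ = _ := by ring
  exact le_of_mul_le_mul_left h9 hn

theorem aux_bound (ε η a b c x P K t : ℝ) (hε : 0 < ε) (hε2 : ε < 1 / 3) (hη : 0 < η)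
    (hx0 : 0 ≤ x) (hb : (1 - ε) ^ 2 ≤ b) (hc : 0 < c) (hc2 : c ≤ 1 + ε)
    (hP : P = a * b * c) (hP0 : 0 < P)
    (hPK : P ≤ K * (1 - ε) ^ 2) (hK : K + t * ε ≤ 1 + 2 * ε) (hP3 : P ≤ 1 - 3 * ε)
    (hx : x * ((1 - 2 * ε) * ((1 + 2 * η) * (1 + ε) ^ 2 - a * c)) ≤ 2 * ε * η * c) :
    t * (P * x) ≤ 2 * η := by
  have hb0 : 0 < b := lt_of_lt_of_le (by nlinarith) hb
  have hu : a * c ≤ K := by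
    have h1 : b * (a * c) ≤ b * K := by
      have hK0 : 0 ≤ K := by
        by_contra h
        push Not at h
        nlinarith [sq_nonneg (1 - ε)]
      nlinarith
    exact le_of_mul_le_mul_left h1 hb0
  have h1 : t * ε ≤ (1 + 2 * η) * (1 + ε) ^ 2 - a * c := by nlinarith [mul_pos hη hε]
  have h2 : x * ((1 - 2 * ε) * (t * ε)) ≤ 2 * ε * η * c := by
    refine le_trans ?_ hx
    apply mul_le_mul_of_nonneg_left _ hx0
    apply mul_le_mul_of_nonneg_left h1 (by linarith)
  have h3 : (1 - 2 * ε) * (t * x) ≤ 2 * η * c := by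
    have : ε * ((1 - 2 * ε) * (t * x)) ≤ ε * (2 * η * c) := by nlinarith
    exact le_of_mul_le_mul_left this hε
  have h4 : P * c ≤ 1 - 2 * ε := by
    calc P * c ≤ (1 - 3 * ε) * (1 + ε) := by gcongr; linarith
      _ ≤ _ := by nlinarith
  have h5 : (1 - 2 * ε) * (t * (P * x)) ≤ (1 - 2 * ε) * (2 * η) := by
    calc _ = P * ((1 - 2 * ε) * (t * x)) := by ring
      _ ≤ P * (2 * η * c) := by gcongr
      _ = 2 * η * (P * c) := by ring
      _ ≤ 2 * η * (1 - 2 * ε) := by gcongr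
      _ = _ := by ring
  exact le_of_mul_le_mul_left h5 (by linarith)

theorem aux_p1 (ε : ℝ) (hε : 0 < ε) (hε2 : ε < 1 / 3) :
    1 - 3 * ε ≤ (1 - ε) * (1 - ε) ^ 2 := by
  have : 0 ≤ ε ^ 2 * (3 - ε) := mul_nonneg (by positivity) (by linarith)
  linarith

theorem aux_p2 (ε : ℝ) (hε : 0 < ε) (hε2 : ε < 1 / 3) :
    1 - 4 * ε ≤ (1 - 2 * ε) * (1 - ε) ^ 2 := by
  have : 0 ≤ ε ^ 2 * (5 - 2 * ε) := mul_nonneg (by positivity) (by linarith)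
  linarith

theorem aux_p3 (ε : ℝ) (hε : 0 < ε) (hε2 : ε < 1 / 3) :
    1 - 5 * ε ≤ (1 - ε) * (1 - ε) * (1 - 3 * ε) := by
  have : 0 ≤ ε ^ 2 * (7 - 3 * ε) := mul_nonneg (by positivity) (by linarith)
  linarith

theorem aux_final (ε η a b c x y : ℝ) (hε : 0 < ε) (hη : 0 < η)
    (hnt : 0 < 1 - 6 * ε - 2 * η)
    (ha : 1 - ε ≤ a) (ha2 : a ≤ 1 + ε)
    (hb : (1 - ε) ^ 2 ≤ b) (hb2 : b ≤ 1 + ε)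
    (hc : (1 - ε) ^ 2 ≤ c) (hc2 : c ≤ 1 + ε)
    (hx0 : 0 ≤ x) (hx1 : x ≤ ε) (hy0 : 0 ≤ y) (hy1 : y ≤ ε)
    (hx : x * ((1 - 2 * ε) * ((1 + 2 * η) * (1 + ε) ^ 2 - a * c)) ≤ 2 * ε * η * c)
    (hy : y * ((1 - 2 * ε) * ((1 + 2 * η) * (1 + ε) ^ 2 - a * b)) ≤ 2 * ε * η * b) :
    1 - 5 * ε - 2 * η ≤ (1 - x) * (1 - y) * ((a - η) * b * c) := by
  have hε3 : ε < 1 / 3 := by linarith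
  have hq : 0 < (1 - ε) ^ 2 := by
    have : 0 < 1 - ε := by linarith
    positivity
  have ha0 : 0 < a := by linarith
  have hb0 : 0 < b := by linarith
  have hc0 : 0 < c := by linarith
  obtain ⟨P, hP⟩ : ∃ P, P = a * b * c := ⟨_, rfl⟩
  have hP0 : 0 < P := by rw [hP]; positivity
  have hPl : 1 - 5 * ε ≤ P := by
    have h1 : (1 - ε) * (1 - ε) ^ 2 * (1 - ε) ^ 2 ≤ P := by
      rw [hP]; gcongr
    have h2 : 1 + (5 : ℕ) * (-ε) ≤ (1 + (-ε)) ^ 5 := one_add_mul_le_pow (by linarith) 5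
    push_cast at h2
    nlinarith
  have hQ : (a - η) * b * c = P - η * (b * c) := by rw [hP]; ring
  have hQ0 : 0 < (a - η) * b * c := by
    have : 0 < a - η := by linarith
    positivity
  rcases le_or_gt (1 - 3 * ε) P with h | h
  · have h1 : (1 - ε) * (1 - ε) * ((a - η) * b * c) ≤ (1 - x) * (1 - y) * ((a - η) * b * c) := by
      gcongr <;> linarith
    refine le_trans ?_ h1
    rw [hQ]
    have h2 : b * c ≤ (1 + ε) * (1 + ε) := by gcongr
    have h3 : (1 - ε) * (1 - ε) * (b * c) ≤ 1 := by
      calc _ ≤ (1 - ε) * (1 - ε) * ((1 + ε) * (1 + ε)) := by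
            gcongr; nlinarith
        _ = (1 - ε ^ 2) ^ 2 := by ring
        _ ≤ 1 := by
          apply pow_le_one₀ <;> nlinarith
    have h4 : (1 - ε) * (1 - ε) * (1 - 3 * ε) ≤ (1 - ε) * (1 - ε) * P := by
      gcongr; nlinarith
    have h5 : η * ((1 - ε) * (1 - ε) * (b * c)) ≤ η * 1 := by gcongr
    have h6 := aux_p3 ε hε hε3
    have h7 : (1 - ε) * (1 - ε) * (P - η * (b * c)) =
        (1 - ε) * (1 - ε) * P - η * ((1 - ε) * (1 - ε) * (b * c)) := by ring
    rw [h7]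
    linarith
  · have hbc : b * c ≤ 1 := by
      have : (1 - ε) * (b * c) ≤ (1 - ε) * 1 := by
        have : (1 - ε) * (b * c) ≤ a * (b * c) := by gcongr
        nlinarith
      exact le_of_mul_le_mul_left this (by linarith)
    have hmain : P * x + P * y ≤ P - (1 - 5 * ε) + η → 
        1 - 5 * ε - 2 * η ≤ (1 - x) * (1 - y) * ((a - η) * b * c) := by
      intro hm
      have h1 : (1 - x - y) * ((a - η) * b * c) ≤ (1 - x) * (1 - y) * ((a - η) * b * c) := by
        apply mul_le_mul_of_nonneg_right _ hQ0.le
        nlinarith [mul_nonneg hx0 hy0]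
      refine le_trans ?_ h1
      rw [hQ]
      have h2 : η * (b * c) ≤ η * 1 := by gcongr
      have h3 : 0 ≤ (x + y) * (η * (b * c)) := by positivity
      have h4 : (1 - x - y) * (P - η * (b * c)) =
          P - (P * x + P * y) - η * (b * c) + (x + y) * (η * (b * c)) := by ring
      rw [h4]
      linarith
    apply hmain
    have hP' : P = a * c * b := by rw [hP]; ring
    rcases le_or_gt (1 - 4 * ε) P with h4 | h4
    · have h5 := aux_bound ε η a b c x P (1 - ε) 3 hε hε3 hη hx0 hb hc0 hc2 hP hP0
        (h.le.trans (aux_p1 ε hε hε3))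
        (by linarith) h.le hx
      have h6 : P * y ≤ 1 * ε := by gcongr; linarith
      linarith
    · have h5 := aux_bound ε η a b c x P (1 - 2 * ε) 4 hε hε3 hη hx0 hb hc0 hc2 hP hP0
        (h4.le.trans (aux_p2 ε hε hε3))
        (by linarith) h.le hx
      have h6 := aux_bound ε η a c b y P (1 - 2 * ε) 4 hε hε3 hη hy0 hc hb0 hb2 hP' hP0
        (h4.le.trans (aux_p2 ε hε hε3))
        (by linarith) h.le hy
      linarith

theorem eBtw_eq_left {V : Type*} (G : SimpleGraph V) (X Y : Finset V) :
    (eBtw G X Y : ℝ) = ∑ w ∈ X, (degIn G w Y : ℝ) := by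
  unfold eBtw degIn
  simp only [Finset.card_filter]
  rw [Finset.sum_product]
  push_cast
  rfl

theorem eBtw_eq_right {V : Type*} (G : SimpleGraph V) (X Y : Finset V) :
    (eBtw G X Y : ℝ) = ∑ w ∈ Y, (degIn G w X : ℝ) := by
  unfold eBtw degIn
  simp only [Finset.card_filter]
  rw [Finset.sum_product_right]
  push_cast
  simp only [G.adj_comm]

theorem eBtw_eq_dens {V : Type*} (G : SimpleGraph V) (X Y : Finset V) :
    (eBtw G X Y : ℝ) = dens G X Y * ((X.card : ℝ) * Y.card) := by
  unfold RandomTriangle.dens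
  by_cases h : (X.card : ℝ) * Y.card = 0
  · rw [h, mul_zero]
    rcases mul_eq_zero.mp h with h | h
    · have : X = ∅ := by
        rw [← Finset.card_eq_zero]; exact_mod_cast h
      subst this; simp [eBtw]
    · have : Y = ∅ := by
        rw [← Finset.card_eq_zero]; exact_mod_cast h
      subst this; simp [eBtw]
  · rw [div_mul_cancel₀ _ h]

theorem degIn_mono {V : Type*} (G : SimpleGraph V) (w : V) {X Y : Finset V} (h : X ⊆ Y) :
    (degIn G w X : ℝ) ≤ degIn G w Y := by
  unfold degIn
  exact_mod_cast Finset.card_le_card (Finset.filter_subset_filter _ h)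

set_option maxHeartbeats 1000000 in
theorem aux_pair {V : Type*} (G : SimpleGraph V) (ε η p D M₂ M₃ : ℝ) (N₂ N₃ : Finset V)
    (hε : 0 < ε) (hη : 0 < η) (hp : 0 < p) (hD : 0 < D) (hM₂ : 0 < M₂) (hM₃ : 0 < M₃)
    (hnt : 0 < 1 - 6 * ε - 2 * η) (hηD : ε * p ≤ η * D)
    (h2l : (1 - ε) ^ 2 * M₂ ≤ N₂.card) (h2u : (N₂.card : ℝ) ≤ (1 + ε) * M₂)
    (h3l : (1 - ε) ^ 2 * M₃ ≤ N₃.card) (h3u : (N₃.card : ℝ) ≤ (1 + ε) * M₃)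
    (hreg : RegularPair G ε p N₂ N₃)
    (hdl : (1 - ε) * D ≤ dens G N₂ N₃) (hdu : dens G N₂ N₃ ≤ (1 + ε) * D) :
    ∃ A ⊆ N₂, ∃ B ⊆ N₃, (1 - 5 * ε - 2 * η) * (M₂ * M₃ * D) ≤ eBtw G A B ∧
      (∀ w ∈ A, (degIn G w B : ℝ) ≤ (1 + 2 * η) * (1 + ε) ^ 2 * (M₃ * D)) ∧
      (∀ w ∈ B, (degIn G w A : ℝ) ≤ (1 + 2 * η) * (1 + ε) ^ 2 * (M₂ * D)) := by
  have hq : 0 < (1 - ε) ^ 2 := by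
    have : 0 < 1 - ε := by linarith
    positivity
  have hn2 : (0 : ℝ) < N₂.card := lt_of_lt_of_le (by positivity) h2l
  have hn3 : (0 : ℝ) < N₃.card := lt_of_lt_of_le (by positivity) h3l
  obtain ⟨a, ha⟩ : ∃ a, a = dens G N₂ N₃ / D := ⟨_, rfl⟩
  obtain ⟨b, hb⟩ : ∃ b, b = (N₂.card : ℝ) / M₂ := ⟨_, rfl⟩
  obtain ⟨c, hc⟩ : ∃ c, c = (N₃.card : ℝ) / M₃ := ⟨_, rfl⟩
  have ha' : dens G N₂ N₃ = a * D := by rw [ha, div_mul_cancel₀ _ hD.ne']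
  have hb' : (N₂.card : ℝ) = b * M₂ := by rw [hb, div_mul_cancel₀ _ hM₂.ne']
  have hc' : (N₃.card : ℝ) = c * M₃ := by rw [hc, div_mul_cancel₀ _ hM₃.ne']
  have ha1 : 1 - ε ≤ a := by rw [ha, le_div_iff₀ hD]; exact hdl
  have ha2 : a ≤ 1 + ε := by rw [ha, div_le_iff₀ hD]; exact hdu
  have hb1 : (1 - ε) ^ 2 ≤ b := by rw [hb, le_div_iff₀ hM₂]; exact h2l
  have hb2 : b ≤ 1 + ε := by rw [hb, div_le_iff₀ hM₂]; exact h2u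
  have hc1 : (1 - ε) ^ 2 ≤ c := by rw [hc, le_div_iff₀ hM₃]; exact h3l
  have hc2 : c ≤ 1 + ε := by rw [hc, div_le_iff₀ hM₃]; exact h3u
  clear ha hb hc
  have hb0 : 0 < b := by linarith
  have hc0 : 0 < c := by linarith
  have ha0 : 0 < a := by linarith
  have hreg' : ∀ X' ⊆ N₂, ∀ Y' ⊆ N₃, ε * N₂.card ≤ (X'.card : ℝ) → ε * N₃.card ≤ (Y'.card : ℝ) →
      (a - η) * D ≤ dens G X' Y' ∧ dens G X' Y' ≤ (a + η) * D := by
    intro X' hX Y' hY h1 h2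
    have := abs_le.mp (hreg X' hX Y' hY h1 h2)
    rw [ha'] at this
    constructor <;> nlinarith [this.1, this.2]
  have hθ : ∀ z, 0 < z → z ≤ 1 + ε → z * (a + η) ≤ (1 + 2 * η) * (1 + ε) ^ 2 := by
    intro z hz0 hz
    calc z * (a + η) ≤ (1 + ε) * (1 + ε + η) := by gcongr
      _ ≤ _ := by nlinarith [mul_pos hε hη, mul_pos (mul_pos hε hε) hη]
  obtain ⟨T₂, hT₂⟩ : ∃ T, T = (1 + 2 * η) * (1 + ε) ^ 2 * (M₃ * D) := ⟨_, rfl⟩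
  obtain ⟨T₃, hT₃⟩ : ∃ T, T = (1 + 2 * η) * (1 + ε) ^ 2 * (M₂ * D) := ⟨_, rfl⟩
  have hS2 := aux_side N₂ (fun w => (degIn G w N₃ : ℝ)) ε (c * M₃ * (a * D)) (c * M₃ * (η * D)) T₂
    hε (by linarith) (by exact_mod_cast hn2) (by positivity)
    (by rw [← eBtw_eq_left, eBtw_eq_dens, ha', hc']; ring)
    (by
      intro A hA hAc
      rw [← eBtw_eq_left, eBtw_eq_dens, hc']
      have h1 := (hreg' A hA N₃ Subset.rfl hAc (by nlinarith)).2
      calc _ ≤ (a + η) * D * ((A.card : ℝ) * (c * M₃)) := by gcongr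
        _ = _ := by ring)
    (by
      rw [hT₂]
      calc _ = c * (a + η) * (M₃ * D) := by ring
        _ ≤ _ := mul_le_mul_of_nonneg_right (hθ c hc0 hc2) (by positivity))
  have hS3 := aux_side N₃ (fun w => (degIn G w N₂ : ℝ)) ε (b * M₂ * (a * D)) (b * M₂ * (η * D)) T₃
    hε (by linarith) (by exact_mod_cast hn3) (by positivity)
    (by rw [← eBtw_eq_right, eBtw_eq_dens, ha', hb']; ring)
    (by
      intro A hA hAc
      rw [← eBtw_eq_right, eBtw_eq_dens, hb']
      have h1 := (hreg' N₂ Subset.rfl A hA (by nlinarith) hAc).2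
      calc _ ≤ (a + η) * D * ((b * M₂) * (A.card : ℝ)) := by gcongr
        _ = _ := by ring)
    (by
      rw [hT₃]
      calc _ = b * (a + η) * (M₂ * D) := by ring
        _ ≤ _ := mul_le_mul_of_nonneg_right (hθ b hb0 hb2) (by positivity))
  have hsp2 := Finset.card_filter_add_card_filter_not (s := N₂) (fun w => T₂ < (degIn G w N₃ : ℝ))
  have hsp3 := Finset.card_filter_add_card_filter_not (s := N₃) (fun w => T₃ < (degIn G w N₂ : ℝ))
  have hsp2' : ((N₂.filter fun w => T₂ < (degIn G w N₃ : ℝ)).card : ℝ) +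
      ((N₂.filter fun w => ¬ T₂ < (degIn G w N₃ : ℝ)).card : ℝ) = N₂.card := by exact_mod_cast hsp2
  have hsp3' : ((N₃.filter fun w => T₃ < (degIn G w N₂ : ℝ)).card : ℝ) +
      ((N₃.filter fun w => ¬ T₃ < (degIn G w N₂ : ℝ)).card : ℝ) = N₃.card := by exact_mod_cast hsp3
  refine ⟨N₂.filter fun w => ¬ T₂ < (degIn G w N₃ : ℝ), Finset.filter_subset _ _,
    N₃.filter fun w => ¬ T₃ < (degIn G w N₂ : ℝ), Finset.filter_subset _ _, ?_, ?_, ?_⟩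
  · obtain ⟨x, hx⟩ : ∃ x, x = ((N₂.filter fun w => T₂ < (degIn G w N₃ : ℝ)).card : ℝ) / N₂.card :=
      ⟨_, rfl⟩
    obtain ⟨y, hy⟩ : ∃ y, y = ((N₃.filter fun w => T₃ < (degIn G w N₂ : ℝ)).card : ℝ) / N₃.card :=
      ⟨_, rfl⟩
    have hx0 : 0 ≤ x := by rw [hx]; exact div_nonneg (Nat.cast_nonneg _) hn2.le
    have hy0 : 0 ≤ y := by rw [hy]; exact div_nonneg (Nat.cast_nonneg _) hn3.le
    have hx' : ((N₂.filter fun w => T₂ < (degIn G w N₃ : ℝ)).card : ℝ) = x * N₂.card := by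
      rw [hx, div_mul_cancel₀ _ hn2.ne']
    have hy' : ((N₃.filter fun w => T₃ < (degIn G w N₂ : ℝ)).card : ℝ) = y * N₃.card := by
      rw [hy, div_mul_cancel₀ _ hn3.ne']
    have hx1 : x ≤ ε := by rw [hx, div_le_iff₀ hn2]; exact hS2.1
    have hy1 : y ≤ ε := by rw [hy, div_le_iff₀ hn3]; exact hS3.1
    clear hx hy
    have hx2 : x * ((1 - 2 * ε) * ((1 + 2 * η) * (1 + ε) ^ 2 - a * c)) ≤ 2 * ε * η * c := by
      have h := hS2.2
      rw [hx', hT₂] at h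
      have h' : (N₂.card * (M₃ * D)) * (x * ((1 - 2 * ε) * ((1 + 2 * η) * (1 + ε) ^ 2 - a * c)))
          ≤ (N₂.card * (M₃ * D)) * (2 * ε * η * c) := by
        calc _ = _ := by ring
          _ ≤ _ := h
          _ = _ := by ring
      exact le_of_mul_le_mul_left h' (by positivity)
    have hy2 : y * ((1 - 2 * ε) * ((1 + 2 * η) * (1 + ε) ^ 2 - a * b)) ≤ 2 * ε * η * b := by
      have h := hS3.2
      rw [hy', hT₃] at h
      have h' : (N₃.card * (M₂ * D)) * (y * ((1 - 2 * ε) * ((1 + 2 * η) * (1 + ε) ^ 2 - a * b)))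
          ≤ (N₃.card * (M₂ * D)) * (2 * ε * η * b) := by
        calc _ = _ := by ring
          _ ≤ _ := h
          _ = _ := by ring
      exact le_of_mul_le_mul_left h' (by positivity)
    have hfin := aux_final ε η a b c x y hε hη hnt ha1 ha2 hb1 hb2 hc1 hc2 hx0 hx1 hy0 hy1 hx2 hy2
    have hA : ((N₂.filter fun w => ¬ T₂ < (degIn G w N₃ : ℝ)).card : ℝ) = (1 - x) * N₂.card := by
      linarith
    have hB : ((N₃.filter fun w => ¬ T₃ < (degIn G w N₂ : ℝ)).card : ℝ) = (1 - y) * N₃.card := by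
      linarith
    have hden := (hreg' (N₂.filter fun w => ¬ T₂ < (degIn G w N₃ : ℝ)) (Finset.filter_subset _ _)
      (N₃.filter fun w => ¬ T₃ < (degIn G w N₂ : ℝ)) (Finset.filter_subset _ _)
      (by rw [hA]; gcongr; linarith) (by rw [hB]; gcongr; linarith)).1
    rw [eBtw_eq_dens, hA, hB, hb', hc']
    have hx3 : 0 ≤ 1 - x := by linarith
    have hy3 : 0 ≤ 1 - y := by linarith
    calc (1 - 5 * ε - 2 * η) * (M₂ * M₃ * D)
        ≤ (1 - x) * (1 - y) * ((a - η) * b * c) * (M₂ * M₃ * D) := by gcongr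
      _ = (a - η) * D * ((1 - x) * (b * M₂) * ((1 - y) * (c * M₃))) := by ring
      _ ≤ _ := by gcongr
  · intro w hw
    rw [← hT₂]
    exact (degIn_mono G w (Finset.filter_subset _ _)).trans (not_lt.mp (Finset.mem_filter.mp hw).2)
  · intro w hw
    rw [← hT₃]
    exact (degIn_mono G w (Finset.filter_subset _ _)).trans (not_lt.mp (Finset.mem_filter.mp hw).2)

/-- **Proposition (bounded-degree subpair of a neighbourhood).** For every `ε`-typical vertex
`v ∈ V₁` of a triple with densities `d_{ij}p`, `d_{ij} ≥ δ`, there are `N₂'' ⊆ N(v) ∩ V₂`,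
`N₃'' ⊆ N(v) ∩ V₃` spanning many edges (many good edges if `v` is `ε`-good), in which every
vertex has bounded degree to the other side. -/
theorem stmt_8 {V : Type*} [Fintype V] [DecidableEq V] (G : SimpleGraph V)
    (ε δ p : ℝ) (hε : 0 < ε) (hδ : 0 < δ) (hp : 0 < p) (hεhalf : ε < 1 / 2)
    (V₁ V₂ V₃ : Finset V) (d₁₂ d₁₃ d₂₃ : ℝ)
    (h12 : Disjoint V₁ V₂) (h13 : Disjoint V₁ V₃) (h23 : Disjoint V₂ V₃)
    (hd12 : dens G V₁ V₂ = d₁₂ * p) (hd13 : dens G V₁ V₃ = d₁₃ * p)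
    (hd23 : dens G V₂ V₃ = d₂₃ * p)
    (hδ12 : δ ≤ d₁₂) (hδ13 : δ ≤ d₁₃) (hδ23 : δ ≤ d₂₃)
    (v : V) (hv : v ∈ V₁) (htyp : TypicalVertex G ε p V₁ V₂ V₃ v) :
    ∃ N₂'' ⊆ nbhdIn G v V₂, ∃ N₃'' ⊆ nbhdIn G v V₃,
      ((1 - 6 * ε - 2 * ε / δ) * (d₁₂ * d₁₃ * d₂₃ * p ^ 3 * V₂.card * V₃.card) ≤
        (eBtw G N₂'' N₃'' : ℝ)) ∧
      (GoodVertex G ε p V₁ V₂ V₃ v →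
        (1 - 6 * ε - 2 * ε / δ) * (d₁₂ * d₁₃ * d₂₃ * p ^ 3 * V₂.card * V₃.card) ≤
          (((N₂'' ×ˢ N₃'').filter fun uw =>
              G.Adj uw.1 uw.2 ∧ GoodEdge G ε V₁ V₂ V₃ uw.1 uw.2).card : ℝ)) ∧
      (∀ w ∈ N₂'', (degIn G w N₃'' : ℝ) ≤
        (1 + 2 * ε / δ) * (1 + ε) ^ 2 * (d₁₃ * d₂₃ * p ^ 2 * V₃.card)) ∧
      (∀ w ∈ N₃'', (degIn G w N₂'' : ℝ) ≤
        (1 + 2 * ε / δ) * (1 + ε) ^ 2 * (d₁₂ * d₂₃ * p ^ 2 * V₂.card)) := by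
  obtain ⟨η, hηdef⟩ : ∃ η, η = ε / δ := ⟨_, rfl⟩
  have hη : 0 < η := by rw [hηdef]; positivity
  have h2η : 2 * ε / δ = 2 * η := by rw [hηdef]; ring
  rw [h2η]
  have hd12p : 0 < d₁₂ := by linarith
  have hd13p : 0 < d₁₃ := by linarith
  have hd23p : 0 < d₂₃ := by linarith
  rcases le_or_gt (1 - 6 * ε - 2 * η) 0 with hnt | hnt
  · have hle : (1 - 6 * ε - 2 * η) * (d₁₂ * d₁₃ * d₂₃ * p ^ 3 * V₂.card * V₃.card) ≤ 0 :=
      mul_nonpos_of_nonpos_of_nonneg hnt (by positivity)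
    refine ⟨∅, Finset.empty_subset _, ∅, Finset.empty_subset _, ?_, ?_, ?_, ?_⟩
    · exact hle.trans (by positivity)
    · intro _
      exact hle.trans (by positivity)
    · intro w hw
      simp at hw
    · intro w hw
      simp at hw
  have hV2 : (0 : ℝ) < V₂.card := by
    rcases Nat.eq_zero_or_pos V₂.card with h | h
    · have : dens G V₁ V₂ = 0 := by unfold RandomTriangle.dens; rw [h]; simp
      rw [this] at hd12
      have : 0 < d₁₂ * p := by positivity
      linarith
    · exact_mod_cast h
  have hV3 : (0 : ℝ) < V₃.card := by
    rcases Nat.eq_zero_or_pos V₃.card with h | h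
    · have : dens G V₁ V₃ = 0 := by unfold RandomTriangle.dens; rw [h]; simp
      rw [this] at hd13
      have : 0 < d₁₃ * p := by positivity
      linarith
    · exact_mod_cast h
  have htyp' := htyp
  unfold TypicalVertex at htyp'
  rw [hd12, hd13, hd23] at htyp'
  obtain ⟨⟨h2l, h2u⟩, ⟨h3l, h3u⟩, N₂, hN₂, N₃, hN₃, hc2, hc3, hreg, hdl, hdu⟩ := htyp'
  have h1ε : 0 < 1 - ε := by linarith
  have hs2 : (N₂.card : ℝ) ≤ (nbhdIn G v V₂).card := by exact_mod_cast Finset.card_le_card hN₂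
  have hs3 : (N₃.card : ℝ) ≤ (nbhdIn G v V₃).card := by exact_mod_cast Finset.card_le_card hN₃
  obtain ⟨A, hA, B, hB, he, hdA, hdB⟩ := aux_pair G ε η p (d₂₃ * p) (d₁₂ * p * V₂.card)
    (d₁₃ * p * V₃.card) N₂ N₃ hε hη hp (by positivity) (by positivity) (by positivity) hnt
    (by
      have h1 : ε = η * δ := by rw [hηdef]; field_simp
      calc ε * p = η * (δ * p) := by rw [h1]; ring
        _ ≤ _ := by gcongr)
    (by
      refine le_trans ?_ hc2
      rw [pow_two, mul_assoc]
      gcongr)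
    (hs2.trans h2u)
    (by
      refine le_trans ?_ hc3
      rw [pow_two, mul_assoc]
      gcongr)
    (hs3.trans h3u) hreg hdl hdu
  have hM : d₁₂ * p * V₂.card * (d₁₃ * p * V₃.card) * (d₂₃ * p) =
      d₁₂ * d₁₃ * d₂₃ * p ^ 3 * V₂.card * V₃.card := by ring
  rw [hM] at he
  have hM0 : 0 ≤ d₁₂ * d₁₃ * d₂₃ * p ^ 3 * V₂.card * V₃.card := by positivity
  refine ⟨A, hA.trans hN₂, B, hB.trans hN₃, ?_, ?_, ?_, ?_⟩
  · nlinarith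
  · intro hgood
    have hbad := hgood.2
    rw [hd12, hd13, hd23] at hbad
    have hsplit : eBtw G A B ≤ ((A ×ˢ B).filter fun uw =>
          G.Adj uw.1 uw.2 ∧ GoodEdge G ε V₁ V₂ V₃ uw.1 uw.2).card +
        (((nbhdIn G v V₂) ×ˢ (nbhdIn G v V₃)).filter fun uw =>
          G.Adj uw.1 uw.2 ∧ ¬ GoodEdge G ε V₁ V₂ V₃ uw.1 uw.2).card := by
      unfold eBtw
      refine le_trans (Finset.card_le_card ?_) (Finset.card_union_le _ _)
      intro uw huw
      rw [Finset.mem_filter, Finset.mem_product] at huw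
      rw [Finset.mem_union, Finset.mem_filter, Finset.mem_filter, Finset.mem_product,
        Finset.mem_product]
      by_cases hg : GoodEdge G ε V₁ V₂ V₃ uw.1 uw.2
      · exact Or.inl ⟨huw.1, huw.2, hg⟩
      · exact Or.inr ⟨⟨hN₂ (hA huw.1.1), hN₃ (hB huw.1.2)⟩, huw.2, hg⟩
    have hsplit' : (eBtw G A B : ℝ) ≤ (((A ×ˢ B).filter fun uw =>
          G.Adj uw.1 uw.2 ∧ GoodEdge G ε V₁ V₂ V₃ uw.1 uw.2).card : ℝ) +
        ((((nbhdIn G v V₂) ×ˢ (nbhdIn G v V₃)).filter fun uw =>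
          G.Adj uw.1 uw.2 ∧ ¬ GoodEdge G ε V₁ V₂ V₃ uw.1 uw.2).card : ℝ) := by
      exact_mod_cast hsplit
    have hM2 : d₁₂ * p * (d₁₃ * p) * (d₂₃ * p) * V₂.card * V₃.card =
      d₁₂ * d₁₃ * d₂₃ * p ^ 3 * V₂.card * V₃.card := by ring
    rw [hM2] at hbad
    linarith
  · intro w hw
    refine (hdA w hw).trans (le_of_eq ?_)
    ring
  · intro w hw
    refine (hdB w hw).trans (le_of_eq ?_)
    ring
end
end

section
/- There exist absolute constants C, D, and ε > 0 such that if p ≥ C(log n / n)^{1/2}, then asymptotically almost surely G(n,p) has the following property: for every spanning subgraph G' ⊆ G(n,p) with minimum degree δ(G') ≥ (2/3)np and every vertex set T with |T| ≤ εn, all but at most D·p^{-2} of the vertices in V \ T are contained in a triangle of G' that has no vertex in T. -/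
open Finset

open scoped Classical

noncomputable section

open RandomTriangle

section Prob

variable {I : Type*} [Fintype I] [DecidableEq I]

/-- Weight of a 0/1 vector. -/
def bW (p : ℝ) (ω : I → Bool) : ℝ := ∏ i, (if ω i = true then p else 1 - p)

/-- Expectation under independent Bernoulli coordinates. -/
def Ex (p : ℝ) (Φ : (I → Bool) → ℝ) : ℝ := ∑ ω, bW p ω * Φ ω

/-- Probability under independent Bernoulli coordinates. -/
def Pr (p : ℝ) (A : (I → Bool) → Prop) : ℝ := Ex p (fun ω => if A ω then 1 else 0)

theorem Ex_prod (p : ℝ) (F : I → Bool → ℝ) :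
    Ex p (fun ω => ∏ i, F i (ω i)) = ∏ i, (p * F i true + (1 - p) * F i false) := by
  have h := Finset.prod_univ_sum (R := ℝ) (fun _ : I => (Finset.univ : Finset Bool))
    (fun i b => (if b = true then p else 1 - p) * F i b)
  rw [Fintype.piFinset_univ] at h
  unfold Ex bW
  simp only [← Finset.prod_mul_distrib]
  rw [← h]
  simp

theorem bW_nonneg {p : ℝ} (h0 : 0 ≤ p) (h1 : p ≤ 1) (ω : I → Bool) : 0 ≤ bW p ω := by
  unfold bW
  apply Finset.prod_nonneg
  intro i _
  split_ifs <;> linarith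

theorem Ex_mono {p : ℝ} (h0 : 0 ≤ p) (h1 : p ≤ 1) {Φ Ψ : (I → Bool) → ℝ}
    (h : ∀ ω, Φ ω ≤ Ψ ω) : Ex p Φ ≤ Ex p Ψ := by
  unfold Ex
  exact Finset.sum_le_sum fun ω _ => mul_le_mul_of_nonneg_left (h ω) (bW_nonneg h0 h1 ω)

theorem Ex_const (p c : ℝ) : Ex p (fun _ : I → Bool => c) = c := by
  have h := Ex_prod (I := I) p (fun _ _ => 1)
  simp only [Finset.prod_const_one, mul_one] at h
  have h2 : Ex p (fun _ : I → Bool => c) = Ex p (fun _ : I → Bool => (1 : ℝ)) * c := by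
    unfold Ex
    rw [Finset.sum_mul]
    simp
  rw [h2, h]
  simp

theorem Ex_add (p : ℝ) (Φ Ψ : (I → Bool) → ℝ) :
    Ex p (fun ω => Φ ω + Ψ ω) = Ex p Φ + Ex p Ψ := by
  unfold Ex
  rw [← Finset.sum_add_distrib]
  simp [mul_add]

theorem Ex_smul (p c : ℝ) (Φ : (I → Bool) → ℝ) :
    Ex p (fun ω => c * Φ ω) = c * Ex p Φ := by
  unfold Ex
  rw [Finset.mul_sum]
  exact Finset.sum_congr rfl fun _ _ => by ring

theorem Ex_sum {J : Type*} (p : ℝ) (s : Finset J) (Φ : J → (I → Bool) → ℝ) :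
    Ex p (fun ω => ∑ j ∈ s, Φ j ω) = ∑ j ∈ s, Ex p (Φ j) := by
  unfold Ex
  rw [Finset.sum_comm]
  simp [Finset.mul_sum]

theorem Ex_merge (p : ℝ) (S : Finset I) (Φ : (I → Bool) → ℝ) :
    Ex p (fun ω => Ex p (fun ω' => Φ (fun i => if i ∈ S then ω i else ω' i))) = Ex p Φ := by
  have key : ∀ ω : I → Bool, Φ ω = ∑ x, Φ x * ∏ i, (if ω i = x i then (1 : ℝ) else 0) := by
    intro ω
    rw [Finset.sum_eq_single ω]
    · simp
    · intro x _ hx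
      obtain ⟨i, hi⟩ := Function.ne_iff.mp hx
      rw [Finset.prod_eq_zero (Finset.mem_univ i), mul_zero]
      rw [if_neg (fun h => hi h.symm)]
    · simp
  have e1 : Ex p Φ = ∑ x, Φ x * ∏ i, (p * (if true = x i then (1 : ℝ) else 0)
      + (1 - p) * (if false = x i then (1 : ℝ) else 0)) := by
    have : Ex p Φ = Ex p (fun ω => ∑ x, Φ x * ∏ i, (if ω i = x i then (1 : ℝ) else 0)) := by
      congr 1; funext ω; exact key ω
    rw [this, Ex_sum]
    refine Finset.sum_congr rfl fun x _ => ?_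
    rw [Ex_smul, ← Ex_prod p (fun i b => if b = x i then (1 : ℝ) else 0)]
  rw [e1]
  have e2 : ∀ ω : I → Bool, Ex p (fun ω' => Φ (fun i => if i ∈ S then ω i else ω' i)) =
      ∑ x, Φ x * ∏ i, (if i ∈ S then (if ω i = x i then (1 : ℝ) else 0) else
        (p * (if true = x i then (1 : ℝ) else 0)
      + (1 - p) * (if false = x i then (1 : ℝ) else 0))) := by
    intro ω
    have : (fun ω' : I → Bool => Φ (fun i => if i ∈ S then ω i else ω' i)) =
      (fun ω' => ∑ x, Φ x * ∏ i, (fun i b => if i ∈ S then (if ω i = x i then (1 : ℝ) else 0)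
        else (if b = x i then (1 : ℝ) else 0)) i (ω' i)) := by
      funext ω'
      rw [key]
      refine Finset.sum_congr rfl fun x _ => ?_
      congr 1
      refine Finset.prod_congr rfl fun i _ => ?_
      by_cases hi : i ∈ S <;> simp [hi]
    rw [this, Ex_sum]
    refine Finset.sum_congr rfl fun x _ => ?_
    rw [Ex_smul, Ex_prod p (fun i b => if i ∈ S then (if ω i = x i then (1 : ℝ) else 0)
        else (if b = x i then (1 : ℝ) else 0))]
    congr 1
    refine Finset.prod_congr rfl fun i _ => ?_
    by_cases hi : i ∈ S
    · simp only [hi, if_true]; ring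
    · simp only [hi, if_false]
  simp only [e2]
  rw [Ex_sum]
  refine Finset.sum_congr rfl fun x _ => ?_
  rw [Ex_smul, Ex_prod p (fun i b => if i ∈ S then (if b = x i then (1 : ℝ) else 0) else
        (p * (if true = x i then (1 : ℝ) else 0)
      + (1 - p) * (if false = x i then (1 : ℝ) else 0)))]
  congr 1
  refine Finset.prod_congr rfl fun i _ => ?_
  by_cases hi : i ∈ S
  · simp only [hi, if_true]
  · simp only [hi, if_false]; ring

/-- `Φ` depends only on the coordinates in `S`. -/
def DepOn (S : Finset I) (Φ : (I → Bool) → ℝ) : Prop :=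
  ∀ ω ω' : I → Bool, (∀ i ∈ S, ω i = ω' i) → Φ ω = Φ ω'

theorem Ex_indep (p : ℝ) (S S' : Finset I) (hd : Disjoint S S') (Φ Ψ : (I → Bool) → ℝ)
    (hΦ : DepOn S Φ) (hΨ : DepOn S' Ψ) :
    Ex p (fun ω => Φ ω * Ψ ω) = Ex p Φ * Ex p Ψ := by
  rw [← Ex_merge p S (fun ω => Φ ω * Ψ ω)]
  have : ∀ ω ω' : I → Bool, Φ (fun i => if i ∈ S then ω i else ω' i) *
      Ψ (fun i => if i ∈ S then ω i else ω' i) = Φ ω * Ψ ω' := by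
    intro ω ω'
    rw [hΦ _ ω (fun i hi => by simp [hi]),
      hΨ _ ω' (fun i hi => by simp [Finset.disjoint_right.mp hd hi])]
  simp only [this]
  simp only [Ex_smul]
  rw [mul_comm, ← Ex_smul]
  congr 1; funext ω; ring

theorem DepOn.prod {J : Type*} [DecidableEq J] (s : Finset J) (S : J → Finset I)
    (Φ : J → (I → Bool) → ℝ) (h : ∀ j ∈ s, DepOn (S j) (Φ j)) :
    DepOn (s.biUnion S) (fun ω => ∏ j ∈ s, Φ j ω) := by
  intro ω ω' hw
  refine Finset.prod_congr rfl fun j hj => h j hj ω ω' fun i hi => hw i ?_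
  exact Finset.mem_biUnion.mpr ⟨j, hj, hi⟩

theorem Ex_prod_indep {J : Type*} (p : ℝ) (s : Finset J) (S : J → Finset I)
    (Φ : J → (I → Bool) → ℝ) (h : ∀ j ∈ s, DepOn (S j) (Φ j))
    (hd : ∀ j ∈ s, ∀ j' ∈ s, j ≠ j' → Disjoint (S j) (S j')) :
    Ex p (fun ω => ∏ j ∈ s, Φ j ω) = ∏ j ∈ s, Ex p (Φ j) := by
  induction s using Finset.induction_on with
  | empty => simp [Ex_const]
  | insert a s ha ih =>
    simp only [Finset.prod_insert ha]
    rw [Ex_indep p (S a) (s.biUnion S) _ (Φ a) (fun ω => ∏ j ∈ s, Φ j ω)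
      (h a (Finset.mem_insert_self _ _))
      (DepOn.prod s S Φ fun j hj => h j (Finset.mem_insert_of_mem hj))]
    · rw [ih (fun j hj => h j (Finset.mem_insert_of_mem hj))
        (fun j hj j' hj' => hd j (Finset.mem_insert_of_mem hj) j' (Finset.mem_insert_of_mem hj'))]
    · rw [Finset.disjoint_biUnion_right]
      intro j hj
      exact hd a (Finset.mem_insert_self _ _) j (Finset.mem_insert_of_mem hj)
        (fun e => ha (e ▸ hj))

theorem Ex_coord (p : ℝ) (i : I) (h : Bool → ℝ) :
    Ex p (fun ω => h (ω i)) = p * h true + (1 - p) * h false := by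
  have e := Ex_prod p (fun j b => if j = i then h b else 1)
  have e1 : (fun ω : I → Bool => ∏ j, (fun j b => if j = i then h b else 1) j (ω j)) =
      fun ω => h (ω i) := by
    funext ω
    simp [Finset.prod_ite_eq']
  rw [e1] at e
  rw [e, Finset.prod_eq_single i]
  · simp
  · intro b _ hb
    simp [hb]
  · simp

theorem Pr_mono {p : ℝ} (h0 : 0 ≤ p) (h1 : p ≤ 1) {A B : (I → Bool) → Prop}
    (h : ∀ ω, A ω → B ω) : Pr p A ≤ Pr p B := by
  apply Ex_mono h0 h1
  intro ω
  by_cases hA : A ω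
  · simp [hA, h ω hA]
  · simp only [hA, if_false]; split_ifs <;> norm_num

theorem Pr_union {J : Type*} {p : ℝ} (h0 : 0 ≤ p) (h1 : p ≤ 1) (s : Finset J)
    (A : J → (I → Bool) → Prop) :
    Pr p (fun ω => ∃ j ∈ s, A j ω) ≤ ∑ j ∈ s, Pr p (A j) := by
  unfold Pr
  rw [← Ex_sum]
  apply Ex_mono h0 h1
  intro ω
  have hn : ∀ j ∈ s, (0 : ℝ) ≤ if A j ω then 1 else 0 := by
    intro j _; split_ifs <;> norm_num
  by_cases h : ∃ j ∈ s, A j ω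
  · rw [if_pos h]
    obtain ⟨j, hj, hA⟩ := h
    calc (1 : ℝ) = if A j ω then 1 else 0 := by simp [hA]
      _ ≤ _ := Finset.single_le_sum hn hj
  · rw [if_neg h]
    exact Finset.sum_nonneg hn

theorem Pr_or {p : ℝ} (h0 : 0 ≤ p) (h1 : p ≤ 1) (A B : (I → Bool) → Prop) :
    Pr p (fun ω => A ω ∨ B ω) ≤ Pr p A + Pr p B := by
  unfold Pr
  rw [← Ex_add]
  apply Ex_mono h0 h1
  intro ω
  by_cases hA : A ω <;> by_cases hB : B ω <;> simp [hA, hB]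

theorem Pr_exp {p : ℝ} (h0 : 0 ≤ p) (h1 : p ≤ 1) (X : (I → Bool) → ℝ) (a M : ℝ)
    (hM : Ex p (fun ω => Real.exp (X ω)) ≤ M) :
    Pr p (fun ω => a ≤ X ω) ≤ M * Real.exp (-a) := by
  have : Pr p (fun ω => a ≤ X ω) ≤ Ex p (fun ω => Real.exp (-a) * Real.exp (X ω)) := by
    apply Ex_mono h0 h1
    intro ω
    rw [← Real.exp_add]
    by_cases h : a ≤ X ω
    · simp only [h, if_true]
      apply Real.one_le_exp; linarith
    · simp only [h, if_false]; positivity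
  rw [Ex_smul] at this
  nlinarith [Real.exp_pos (-a)]

theorem chernoff {J : Type*} {p : ℝ} (h0 : 0 ≤ p) (h1 : p ≤ 1) (s : Finset J) (φ : J → I)
    (hφ : Set.InjOn φ s) (g : J → ℝ) (a : ℝ) :
    Pr p (fun ω => a ≤ ∑ j ∈ s, if ω (φ j) = true then g j else 0) ≤
      Real.exp (p * ∑ j ∈ s, (Real.exp (g j) - 1) - a) := by
  rw [sub_eq_add_neg, Real.exp_add]
  apply Pr_exp h0 h1
  simp only [Real.exp_sum]
  rw [Ex_prod_indep p s (fun j => {φ j})]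
  · rw [Finset.mul_sum, Real.exp_sum]
    apply Finset.prod_le_prod
    · intro j _
      rw [← Ex_const (I := I) p 0]
      exact Ex_mono h0 h1 fun ω => (Real.exp_pos _).le
    · intro j _
      rw [Ex_coord p (φ j) (fun b => Real.exp (if b = true then g j else 0))]
      have := Real.add_one_le_exp (p * (Real.exp (g j) - 1))
      simp
      linarith
  · intro j _ ω ω' h
    simp only [h (φ j) (Finset.mem_singleton_self _)]
  · intro j hj j' hj' hne
    simp only [Finset.disjoint_singleton]
    exact fun h => hne (hφ hj hj' h)

end Prob

/-- The graph of a 0/1 vector indexed by unordered pairs. -/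
def gr {n : ℕ} (ω : Sym2 (Fin n) → Bool) : SimpleGraph (Fin n) where
  Adj u w := u ≠ w ∧ ω s(u, w) = true
  symm := ⟨by
    intro u w h
    exact ⟨h.1.symm, by rw [Sym2.eq_swap]; exact h.2⟩⟩
  loopless := ⟨by
    intro u h
    exact h.1 rfl⟩

theorem gr_adj {n : ℕ} (ω : Sym2 (Fin n) → Bool) (u w : Fin n) :
    (gr ω).Adj u w ↔ u ≠ w ∧ ω s(u, w) = true := Iff.rfl

theorem gnpProb_eq (n : ℕ) (p : ℝ) (A : Set (SimpleGraph (Fin n))) :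
    gnpProb n p A = Pr p (fun ω : Sym2 (Fin n) → Bool => gr ω ∈ A) := by
  have hG : ∀ G : SimpleGraph (Fin n),
      p ^ ((Finset.univ.filter fun e : Sym2 (Fin n) => e ∈ G.edgeSet).card) *
      (1 - p) ^ (n.choose 2 - (Finset.univ.filter fun e : Sym2 (Fin n) => e ∈ G.edgeSet).card)
      = Ex p (fun ω : Sym2 (Fin n) → Bool => if gr ω = G then 1 else 0) := by
    intro G
    have h1 : (fun ω : Sym2 (Fin n) → Bool => if gr ω = G then (1 : ℝ) else 0) =
        fun ω => ∏ e, (fun e b => if e.IsDiag then (1 : ℝ) else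
          if (b = true ↔ e ∈ G.edgeSet) then 1 else 0) e (ω e) := by
      funext ω
      by_cases h : gr ω = G
      · rw [if_pos h]
        symm
        apply Finset.prod_eq_one
        intro e _
        induction e using Sym2.ind with
        | _ u w =>
          subst h
          by_cases huw : u = w
          · simp [huw]
          · simp [huw, gr_adj]
      · rw [if_neg h]
        symm
        by_contra hne
        apply h
        rw [← ne_eq, Finset.prod_ne_zero_iff] at hne
        ext u w
        have := hne s(u, w) (Finset.mem_univ _)
        rw [gr_adj]
        by_cases huw : u = w
        · simp [huw]
        · simp [huw] at this
          simp [huw, this]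
    rw [h1, Ex_prod p (fun (e : Sym2 (Fin n)) (b : Bool) => if e.IsDiag then (1 : ℝ) else
          if (b = true ↔ e ∈ G.edgeSet) then 1 else 0)]
    have h2 : ∀ e : Sym2 (Fin n), (p * (if e.IsDiag then (1 : ℝ) else
          if (true = true ↔ e ∈ G.edgeSet) then 1 else 0) + (1 - p) * (if e.IsDiag then (1 : ℝ) else
          if (false = true ↔ e ∈ G.edgeSet) then 1 else 0)) =
        (if e ∈ G.edgeSet then p else 1) *
          (if e ∈ (Finset.univ.filter fun e : Sym2 (Fin n) => ¬ e.IsDiag) \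
            (Finset.univ.filter fun e : Sym2 (Fin n) => e ∈ G.edgeSet) then (1 - p) else 1) := by
      intro e
      by_cases hd : e.IsDiag
      · have : e ∉ G.edgeSet := fun h => G.not_isDiag_of_mem_edgeSet h hd
        simp [hd, this]
      · by_cases he : e ∈ G.edgeSet <;> simp [hd, he]
    rw [Finset.prod_congr rfl fun e _ => h2 e, Finset.prod_mul_distrib, Finset.prod_ite,
      Finset.prod_ite_mem]
    simp only [Finset.prod_const, Finset.prod_const_one, mul_one, one_pow, Finset.univ_inter]
    congr 2
    rw [Finset.card_sdiff_of_subset]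
    · congr 1
      have := Sym2.card_subtype_not_diag (α := Fin n)
      rw [Fintype.card_fin] at this
      rw [← this, Fintype.card_subtype]
    · intro e he
      simp only [Finset.mem_filter, Finset.mem_univ, true_and] at he ⊢
      exact G.not_isDiag_of_mem_edgeSet he
  unfold gnpProb Pr
  rw [Finset.sum_congr rfl fun G _ => hG G, ← Ex_sum]
  congr 1
  funext ω
  rw [Finset.sum_ite_eq]
  simp

/-- Codegree of `u, w` into `B`, as a real number. -/
def cod {n : ℕ} (ω : Sym2 (Fin n) → Bool) (B : Finset (Fin n)) (u w : Fin n) : ℝ :=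
  ∑ b ∈ B, if ω s(u, b) = true ∧ ω s(w, b) = true then 1 else 0

theorem cod_eq {n : ℕ} (ω : Sym2 (Fin n) → Bool) (B : Finset (Fin n)) (u w : Fin n)
    (hu : u ∉ B) (hw : w ∉ B) : (codegIn (gr ω) u w B : ℝ) = cod ω B u w := by
  unfold codegIn cod
  rw [Finset.sum_boole]
  congr 2
  apply Finset.filter_congr
  intro b hb
  have h1 : u ≠ b := fun h => hu (h ▸ hb)
  have h2 : w ≠ b := fun h => hw (h ▸ hb)
  simp [gr_adj, h1, h2]

theorem cod_nonneg {n : ℕ} (ω : Sym2 (Fin n) → Bool) (B : Finset (Fin n)) (u w : Fin n) :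
    0 ≤ cod ω B u w := by
  unfold cod
  apply Finset.sum_nonneg
  intro b _; split_ifs <;> norm_num

theorem cod_dep {n : ℕ} (ω ω' : Sym2 (Fin n) → Bool) (B : Finset (Fin n)) (u w : Fin n)
    (h : ∀ b ∈ B, ω s(u, b) = ω' s(u, b) ∧ ω s(w, b) = ω' s(w, b)) :
    cod ω B u w = cod ω' B u w := by
  unfold cod
  refine Finset.sum_congr rfl fun b hb => ?_
  rw [(h b hb).1, (h b hb).2]

theorem Ex_two {n : ℕ} {p : ℝ} (i j : Sym2 (Fin n)) (hij : i ≠ j) (c : ℝ) :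
    Ex p (fun ω : Sym2 (Fin n) → Bool =>
      Real.exp (c * if ω i = true ∧ ω j = true then 1 else 0)) = 1 + (Real.exp c - 1) * p ^ 2 := by
  have h : (fun ω : Sym2 (Fin n) → Bool =>
      Real.exp (c * if ω i = true ∧ ω j = true then 1 else 0)) =
      fun ω => 1 + (Real.exp c - 1) * ((if ω i = true then (1 : ℝ) else 0) *
        (if ω j = true then (1 : ℝ) else 0)) := by
    funext ω
    by_cases h1 : ω i = true <;> by_cases h2 : ω j = true <;> simp [h1, h2]
  rw [h, Ex_add, Ex_const, Ex_smul, Ex_indep p {i} {j}]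
  · rw [Ex_coord p i (fun b => if b = true then (1 : ℝ) else 0),
      Ex_coord p j (fun b => if b = true then (1 : ℝ) else 0)]
    simp only [if_true, Bool.false_eq_true, if_false]; ring
  · simpa using hij
  · intro ω ω' hw
    simp only [hw i (Finset.mem_singleton_self _)]
  · intro ω ω' hw
    simp only [hw j (Finset.mem_singleton_self _)]

theorem cod_mgf {n : ℕ} {p : ℝ} (B : Finset (Fin n)) (u w : Fin n)
    (hu : u ∉ B) (hw : w ∉ B) (huw : u ≠ w) (c : ℝ) (hc : 0 ≤ c) :
    Ex p (fun ω => Real.exp (c * cod ω B u w)) ≤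
      Real.exp (B.card * p ^ 2 * (Real.exp c - 1)) := by
  unfold cod
  simp only [Finset.mul_sum, Real.exp_sum]
  rw [Ex_prod_indep p B (fun b => {s(u, b), s(w, b)})]
  · have : ∀ b ∈ B, Ex p (fun ω : Sym2 (Fin n) → Bool =>
        Real.exp (c * if ω s(u, b) = true ∧ ω s(w, b) = true then 1 else 0))
        = 1 + (Real.exp c - 1) * p ^ 2 := by
      intro b hb
      apply Ex_two
      intro h
      rw [Sym2.eq_iff] at h
      rcases h with h | h
      · exact huw h.1
      · exact hw (h.2 ▸ hb)
    rw [Finset.prod_congr rfl this, Finset.prod_const]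
    have h3 : 1 + (Real.exp c - 1) * p ^ 2 ≤ Real.exp ((Real.exp c - 1) * p ^ 2) := by
      linarith [Real.add_one_le_exp ((Real.exp c - 1) * p ^ 2)]
    have h4 : 0 ≤ 1 + (Real.exp c - 1) * p ^ 2 := by
      have := Real.one_le_exp hc
      nlinarith [sq_nonneg p]
    calc _ ≤ (Real.exp ((Real.exp c - 1) * p ^ 2)) ^ B.card := pow_le_pow_left₀ h4 h3 _
      _ = _ := by rw [← Real.exp_nat_mul]; congr 1; ring
  · intro b hb ω ω' h
    simp only [h s(u, b) (by simp), h s(w, b) (by simp)]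
  · intro b hb b' hb' hne
    rw [Finset.disjoint_left]
    intro e he he'
    simp only [Finset.mem_insert, Finset.mem_singleton] at he he'
    have hub : u ≠ b := fun h => hu (h ▸ hb)
    have hwb : w ≠ b := fun h => hw (h ▸ hb)
    have hub' : u ≠ b' := fun h => hu (h ▸ hb')
    have hwb' : w ≠ b' := fun h => hw (h ▸ hb')
    rcases he with rfl | rfl <;> rcases he' with h | h <;> rw [Sym2.eq_iff] at h <;>
      rcases h with h | h <;> simp_all

/-- Increasing pairs inside `X`. -/
def prs {n : ℕ} (X : Finset (Fin n)) : Finset (Fin n × Fin n) :=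
  (X ×ˢ X).filter fun a => a.1 < a.2

theorem prs_card {n : ℕ} (X : Finset (Fin n)) :
    2 * ((prs X).card : ℝ) = (X.card : ℝ) * X.card - X.card := by
  have h1 : X.offDiag = prs X ∪ (X ×ˢ X).filter (fun a => a.2 < a.1) := by
    ext ⟨a, b⟩
    simp only [prs, Finset.mem_offDiag, Finset.mem_union, Finset.mem_filter, Finset.mem_product]
    constructor
    · rintro ⟨ha, hb, hne⟩
      rcases lt_or_gt_of_ne hne with h | h
      · exact Or.inl ⟨⟨ha, hb⟩, h⟩
      · exact Or.inr ⟨⟨ha, hb⟩, h⟩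
    · rintro (⟨⟨ha, hb⟩, h⟩ | ⟨⟨ha, hb⟩, h⟩)
      · exact ⟨ha, hb, h.ne⟩
      · exact ⟨ha, hb, h.ne'⟩
  have h2 : ((X ×ˢ X).filter (fun a => a.2 < a.1)).card = (prs X).card := by
    apply Finset.card_bij (fun a _ => (a.2, a.1))
    · rintro ⟨a, b⟩ h
      simp only [prs, Finset.mem_filter, Finset.mem_product] at h ⊢
      exact ⟨⟨h.1.2, h.1.1⟩, h.2⟩
    · rintro ⟨a, b⟩ _ ⟨c, d⟩ _ h
      simp only [Prod.mk.injEq] at h ⊢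
      exact ⟨h.2, h.1⟩
    · rintro ⟨a, b⟩ h
      simp only [prs, Finset.mem_filter, Finset.mem_product] at h ⊢
      exact ⟨(b, a), by simp [h.1.1, h.1.2, h.2], rfl⟩
  have h3 : X.offDiag.card = (prs X).card + (prs X).card := by
    rw [h1, Finset.card_union_of_disjoint, h2]
    rw [Finset.disjoint_left]
    intro a ha hb
    simp only [prs, Finset.mem_filter] at ha hb
    exact lt_asymm ha.2 hb.2
  have h4 := Finset.offDiag_card X
  have h5 : X.card * X.card = ((prs X).card + (prs X).card) + X.card := by
    have : X.card ≤ X.card * X.card := Nat.le_mul_self _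
    omega
  have h6 : (X.card : ℝ) * X.card = (((prs X).card : ℝ) + (prs X).card) + X.card := by
    exact_mod_cast h5
  linarith

theorem prs_inj {n : ℕ} (X : Finset (Fin n)) :
    Set.InjOn (fun a : Fin n × Fin n => s(a.1, a.2)) (prs X) := by
  rintro ⟨a, b⟩ h ⟨c, d⟩ h' he
  simp only [prs, Finset.coe_filter, Set.mem_ofPred_eq] at h h'
  simp only at he
  rw [Sym2.eq_iff] at he
  rcases he with he | he
  · simp [he.1, he.2]
  · exfalso
    have h1 := h.2
    rw [he.1, he.2] at h1
    exact lt_asymm h1 h'.2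

theorem prs_count {n : ℕ} (ω : Sym2 (Fin n) → Bool) (X : Finset (Fin n)) (c : ℝ) :
    (∑ a ∈ prs X, if ω s(a.1, a.2) = true then c else 0) =
      c * (((prs X).filter fun a => (gr ω).Adj a.1 a.2).card : ℝ) := by
  rw [← Finset.sum_filter, Finset.sum_const, nsmul_eq_mul, mul_comm]
  congr 3
  apply Finset.filter_congr
  intro a ha
  have : a.1 ≠ a.2 := by
    simp only [prs, Finset.mem_filter] at ha
    exact ha.2.ne
  simp [gr_adj, this]

theorem exp_le_quad {x : ℝ} (h : |x| ≤ 1) : Real.exp x ≤ 1 + x + x ^ 2 := by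
  have := Real.abs_exp_sub_one_sub_id_le h
  have := (abs_le.mp this).2
  linarith

def E1 {n : ℕ} (G : SimpleGraph (Fin n)) (p : ℝ) : Prop :=
  ∀ X : Finset (Fin n), n * p / 2 ≤ (X.card : ℝ) →
    99 / 100 * p * (X.card : ℝ) ^ 2 / 2 ≤ (((prs X).filter fun a => G.Adj a.1 a.2).card : ℝ)

def E2 {n : ℕ} (G : SimpleGraph (Fin n)) (p : ℝ) : Prop :=
  ∀ S T : Finset (Fin n), (T.card : ℝ) ≤ n / 1000 → 10 ^ 4 / p ^ 2 ≤ (S.card : ℝ) →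
    ∃ v ∈ S, (degIn G v T : ℝ) ≤ n * p / 100

def E3 {n : ℕ} (G : SimpleGraph (Fin n)) (p : ℝ) : Prop :=
  (((prs Finset.univ).filter fun a => G.Adj a.1 a.2).card : ℝ) ≤ 101 / 100 * p * n ^ 2 / 2

/-- Running assumptions on `n, p`. -/
structure Hyp (n : ℕ) (p : ℝ) : Prop where
  hn : 3 ≤ n
  h0 : 0 < p
  h1 : p ≤ 1
  hp : 10 ^ 10 * Real.log n ≤ n * p ^ 2

theorem Hyp.log {n : ℕ} {p : ℝ} (h : Hyp n p) : 1 ≤ Real.log n := by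
  rw [Real.le_log_iff_exp_le (by have := h.hn; positivity)]
  have : (3 : ℝ) ≤ n := by exact_mod_cast h.hn
  linarith [Real.exp_one_lt_d9]

theorem Hyp.np2 {n : ℕ} {p : ℝ} (h : Hyp n p) : 10 ^ 10 ≤ n * p ^ 2 := by
  nlinarith [h.hp, h.log]

theorem Hyp.np {n : ℕ} {p : ℝ} (h : Hyp n p) : 10 ^ 10 ≤ n * p := by
  have h1 := h.np2
  have h2 := h.h1
  have h3 := h.h0
  have : (n : ℝ) * p ^ 2 ≤ n * p := by
    apply mul_le_mul_of_nonneg_left _ (by positivity)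
    nlinarith
  linarith

theorem pE3 {n : ℕ} {p : ℝ} (h : Hyp n p) :
    Pr p (fun ω : Sym2 (Fin n) → Bool => ¬ E3 (gr ω) p) ≤ 80000 / n := by
  have hn : (3 : ℝ) ≤ n := by exact_mod_cast h.hn
  have h0 := h.h0
  have c := chernoff h.h0.le h.h1 (prs (Finset.univ : Finset (Fin n)))
    (fun a : Fin n × Fin n => s(a.1, a.2)) (prs_inj _) (fun _ => (1 / 200 : ℝ))
    (1 / 200 * (101 / 100 * p * n ^ 2 / 2))
  refine le_trans (Pr_mono h.h0.le h.h1 ?_) (c.trans ?_)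
  · intro ω hω
    unfold E3 at hω
    rw [prs_count]
    push Not at hω
    linarith
  · have hc := prs_card (Finset.univ : Finset (Fin n))
    rw [Finset.card_univ, Fintype.card_fin] at hc
    rw [Finset.sum_const, nsmul_eq_mul]
    have he := exp_le_quad (x := 1 / 200) (by rw [abs_of_pos] <;> norm_num)
    set M : ℝ := ((prs (Finset.univ : Finset (Fin n))).card : ℝ) with hM
    have hM0 : 0 ≤ M := by positivity
    have hM1 : M ≤ n ^ 2 / 2 := by nlinarith
    have h2 : M * (Real.exp (1 / 200) - 1) ≤ n ^ 2 / 2 * (1 / 200 + (1 / 200) ^ 2) := by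
      apply mul_le_mul hM1 (by linarith) _ (by positivity)
      linarith [Real.add_one_le_exp (1 / 200 : ℝ)]
    have h3 := mul_le_mul_of_nonneg_left h2 h0.le
    have h4 : (n : ℝ) ≤ p * n ^ 2 := by
      nlinarith [h.np]
    have h5 : p * (M * (Real.exp (1 / 200) - 1)) - 1 / 200 * (101 / 100 * p * n ^ 2 / 2)
        ≤ - (n / 80000) := by nlinarith
    refine (Real.exp_le_exp.mpr h5).trans ?_
    rw [Real.exp_neg, inv_le_comm₀ (Real.exp_pos _) (by positivity)]
    have := Real.add_one_le_exp ((n : ℝ) / 80000)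
    rw [inv_div]
    linarith

theorem pE1 {n : ℕ} {p : ℝ} (h : Hyp n p) :
    Pr p (fun ω : Sym2 (Fin n) → Bool => ¬ E1 (gr ω) p) ≤ 3 / n := by
  have hn : (3 : ℝ) ≤ n := by exact_mod_cast h.hn
  have hn0 : (0 : ℝ) < n := by linarith
  have h0 := h.h0
  have hlog := h.log
  have step : ∀ X ∈ (Finset.univ : Finset (Finset (Fin n))).filter
      (fun X => n * p / 2 ≤ (X.card : ℝ)),
      Pr p (fun ω : Sym2 (Fin n) → Bool =>
        ¬ (99 / 100 * p * (X.card : ℝ) ^ 2 / 2 ≤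
          (((prs X).filter fun a => (gr ω).Adj a.1 a.2).card : ℝ))) ≤
        (1 / n) * (1 / n : ℝ) ^ X.card := by
    intro X hX
    simp only [Finset.mem_filter, Finset.mem_univ, true_and] at hX
    set m : ℝ := (X.card : ℝ) with hm
    have c := chernoff h.h0.le h.h1 (prs X)
      (fun a : Fin n × Fin n => s(a.1, a.2)) (prs_inj _) (fun _ => (-(1 / 200) : ℝ))
      (-(1 / 200) * (99 / 100 * p * m ^ 2 / 2))
    refine le_trans (Pr_mono h.h0.le h.h1 ?_) (c.trans ?_)
    · intro ω hω
      rw [prs_count]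
      push Not at hω
      linarith
    · have hc := prs_card X
      rw [Finset.sum_const, nsmul_eq_mul]
      have he := exp_le_quad (x := -(1 / 200)) (by rw [abs_neg, abs_of_pos] <;> norm_num)
      set M : ℝ := ((prs X).card : ℝ) with hM
      have hm1 : 10 ^ 9 ≤ m := by linarith [h.np]
      have hM0 : 0 ≤ M := by positivity
      have hM2 : M = (m * m - m) / 2 := by linarith
      have h2 : M * (Real.exp (-(1 / 200)) - 1) ≤ M * (-(1 / 200) + (1 / 200) ^ 2) := by
        apply mul_le_mul_of_nonneg_left _ hM0
        linarith
      have h3 := mul_le_mul_of_nonneg_left h2 h0.le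
      have hpm : 10 ^ 9 * Real.log n ≤ p * m := by
        have := h.hp
        nlinarith
      have h5 : p * (M * (Real.exp (-(1 / 200)) - 1)) -
          (-(1 / 200) * (99 / 100 * p * m ^ 2 / 2)) ≤ - (p * m * m / 160000) := by
        have : p * (M * (-(1 / 200) + (1 / 200) ^ 2)) +
          (1 / 200) * (99 / 100 * p * m ^ 2 / 2) ≤ - (p * m * m / 160000) := by
          rw [hM2]
          have hpm0 : 0 ≤ p * m := by positivity
          nlinarith [mul_le_mul_of_nonneg_left hm1 hpm0]
        linarith
      have h6 : - (p * m * m / 160000) ≤ -(Real.log n * (1 + m)) := by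
        nlinarith [mul_le_mul_of_nonneg_right hpm (by linarith : (0 : ℝ) ≤ m)]
      refine (Real.exp_le_exp.mpr (h5.trans h6)).trans (le_of_eq ?_)
      rw [← pow_succ', one_div, inv_pow, Real.exp_neg]
      congr 1
      have : (1 + m) = ((X.card + 1 : ℕ) : ℝ) := by push_cast; ring
      rw [this, mul_comm, Real.exp_nat_mul, Real.exp_log hn0]
  have hU := Pr_union h.h0.le h.h1 ((Finset.univ : Finset (Finset (Fin n))).filter
      (fun X => n * p / 2 ≤ (X.card : ℝ))) (fun X (ω : Sym2 (Fin n) → Bool) =>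
        ¬ (99 / 100 * p * (X.card : ℝ) ^ 2 / 2 ≤
          (((prs X).filter fun a => (gr ω).Adj a.1 a.2).card : ℝ)))
  refine le_trans (Pr_mono h.h0.le h.h1 ?_) (hU.trans ?_)
  · intro ω hω
    unfold E1 at hω
    push Not at hω
    obtain ⟨X, h1, h2⟩ := hω
    exact ⟨X, by simp [h1], not_le.mpr h2⟩
  · refine (Finset.sum_le_sum step).trans ?_
    rw [← Finset.mul_sum]
    have h1 : ∑ X ∈ (Finset.univ : Finset (Finset (Fin n))).filter
      (fun X => n * p / 2 ≤ (X.card : ℝ)), (1 / n : ℝ) ^ X.card ≤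
      ∑ X : Finset (Fin n), (1 / n : ℝ) ^ X.card := by
      apply Finset.sum_le_sum_of_subset_of_nonneg (Finset.filter_subset _ _)
      intros; positivity
    have h2 := Fintype.sum_pow_mul_eq_add_pow (Fin n) (1 / n : ℝ) 1
    simp only [one_pow, mul_one, Fintype.card_fin] at h2
    rw [h2] at h1
    have h3 : (1 / (n : ℝ) + 1) ^ n ≤ Real.exp 1 := by
      calc _ ≤ (Real.exp (1 / (n : ℝ))) ^ n :=
            pow_le_pow_left₀ (by positivity) (Real.add_one_le_exp _) _
        _ = _ := by
          rw [← Real.exp_nat_mul]; congr 1; field_simp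
    have h4 : Real.exp 1 ≤ 3 := by linarith [Real.exp_one_lt_d9]
    calc _ ≤ 1 / (n : ℝ) * 3 := by
          apply mul_le_mul_of_nonneg_left _ (by positivity)
          linarith
      _ = _ := by ring

theorem pE2 {n : ℕ} {p : ℝ} (h : Hyp n p) :
    Pr p (fun ω : Sym2 (Fin n) → Bool => ¬ E2 (gr ω) p) ≤ 1 / n := by
  have hn : (3 : ℝ) ≤ n := by exact_mod_cast h.hn
  have hn0 : (0 : ℝ) < n := by linarith
  have h0 := h.h0
  have step : ∀ X ∈ (Finset.univ : Finset (Finset (Fin n) × Finset (Fin n))).filter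
      (fun X => (X.2.card : ℝ) ≤ n / 1000 ∧ 10 ^ 4 / p ^ 2 ≤ (X.1.card : ℝ)),
      Pr p (fun ω : Sym2 (Fin n) → Bool =>
        ∀ v ∈ X.1, n * p / 100 < (degIn (gr ω) v X.2 : ℝ)) ≤
        Real.exp (-30 * n) := by
    rintro ⟨S, T⟩ hX
    simp only [Finset.mem_filter, Finset.mem_univ, true_and] at hX
    obtain ⟨hT, hS⟩ := hX
    set F : Finset (Sym2 (Fin n)) := (S ×ˢ T).image (fun a => s(a.1, a.2)) with hF
    have c := chernoff h.h0.le h.h1 F id (fun _ _ _ _ h => h) (fun _ => (1 : ℝ))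
      (S.card * (n * p) / 200)
    refine le_trans (Pr_mono h.h0.le h.h1 ?_) (c.trans ?_)
    · intro ω hω
      have e1 : (S.card : ℝ) * (n * p / 100) ≤ ∑ v ∈ S, (degIn (gr ω) v T : ℝ) := by
        rw [← nsmul_eq_mul, ← Finset.sum_const]
        exact Finset.sum_le_sum fun v hv => (hω v hv).le
      have e2 : ∑ v ∈ S, degIn (gr ω) v T =
          ((S ×ˢ T).filter fun a => (gr ω).Adj a.1 a.2).card := by
        unfold degIn
        simp only [Finset.card_filter]
        rw [Finset.sum_product]
      have e3 := Finset.card_le_mul_card_image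
        (f := fun a : Fin n × Fin n => s(a.1, a.2))
        ((S ×ˢ T).filter fun a => (gr ω).Adj a.1 a.2) 2 (by
          intro e _
          induction e using Sym2.ind with
          | _ x y =>
            refine (Finset.card_le_card (t := {(x, y), (y, x)}) ?_).trans Finset.card_le_two
            rintro ⟨a, b⟩ hab
            simp only [Finset.mem_filter, Sym2.eq_iff] at hab
            simp only [Finset.mem_insert, Finset.mem_singleton, Prod.mk.injEq]
            exact hab.2)
      have e4 : (((S ×ˢ T).filter fun a => (gr ω).Adj a.1 a.2).image
          (fun a : Fin n × Fin n => s(a.1, a.2))).card ≤ (F.filter fun e => ω e = true).card := by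
        apply Finset.card_le_card
        intro e he
        simp only [Finset.mem_image, Finset.mem_filter] at he ⊢
        obtain ⟨a, ⟨ha, hadj⟩, rfl⟩ := he
        exact ⟨by rw [hF]; exact Finset.mem_image_of_mem _ ha, hadj.2⟩
      simp only [id]
      rw [Finset.sum_boole]
      have e5 : (∑ v ∈ S, (degIn (gr ω) v T : ℝ)) ≤
          2 * ((F.filter fun e => ω e = true).card : ℝ) := by
        rw [← Nat.cast_sum, e2]
        exact_mod_cast e3.trans (Nat.mul_le_mul_left 2 e4)
      linarith
    · rw [Finset.sum_const, nsmul_eq_mul]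
      apply Real.exp_le_exp.mpr
      have hFc : (F.card : ℝ) ≤ S.card * T.card := by
        have := Finset.card_image_le (s := S ×ˢ T) (f := fun a : Fin n × Fin n => s(a.1, a.2))
        rw [Finset.card_product] at this
        exact_mod_cast this
      have hF2 : (F.card : ℝ) ≤ S.card * (n / 1000) :=
        hFc.trans (mul_le_mul_of_nonneg_left hT (by positivity))
      have he : Real.exp 1 - 1 ≤ 2 := by linarith [Real.exp_one_lt_d9]
      have h2 : (F.card : ℝ) * (Real.exp 1 - 1) ≤ S.card * (n / 1000) * 2 := by
        apply mul_le_mul hF2 he _ (by positivity)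
        linarith [Real.add_one_le_exp (1 : ℝ)]
      have h3 := mul_le_mul_of_nonneg_left h2 h0.le
      have h4 : 10 ^ 4 ≤ (S.card : ℝ) * p := by
        rw [div_le_iff₀ (by positivity)] at hS
        have : (S.card : ℝ) * p ^ 2 ≤ S.card * p := by
          apply mul_le_mul_of_nonneg_left _ (by positivity)
          nlinarith [h.h1]
        linarith
      nlinarith [mul_le_mul_of_nonneg_right h4 hn0.le]
  have hU := Pr_union h.h0.le h.h1
    ((Finset.univ : Finset (Finset (Fin n) × Finset (Fin n))).filter
      (fun X => (X.2.card : ℝ) ≤ n / 1000 ∧ 10 ^ 4 / p ^ 2 ≤ (X.1.card : ℝ)))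
    (fun X (ω : Sym2 (Fin n) → Bool) =>
        ∀ v ∈ X.1, n * p / 100 < (degIn (gr ω) v X.2 : ℝ))
  refine le_trans (Pr_mono h.h0.le h.h1 ?_) (hU.trans ?_)
  · intro ω hω
    unfold E2 at hω
    push Not at hω
    obtain ⟨S, T, h1, h2, h3⟩ := hω
    exact ⟨(S, T), by simp [h1, h2], h3⟩
  · refine (Finset.sum_le_sum step).trans ?_
    rw [Finset.sum_const, nsmul_eq_mul]
    have h1 : (((Finset.univ : Finset (Finset (Fin n) × Finset (Fin n))).filter
      (fun X => (X.2.card : ℝ) ≤ n / 1000 ∧ 10 ^ 4 / p ^ 2 ≤ (X.1.card : ℝ))).card : ℝ) ≤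
      (2 : ℝ) ^ n * 2 ^ n := by
      have := Finset.card_filter_le (Finset.univ : Finset (Finset (Fin n) × Finset (Fin n)))
        (fun X => (X.2.card : ℝ) ≤ n / 1000 ∧ 10 ^ 4 / p ^ 2 ≤ (X.1.card : ℝ))
      rw [Finset.card_univ, Fintype.card_prod, Fintype.card_finset, Fintype.card_fin] at this
      exact_mod_cast this
    have h2 : (2 : ℝ) ^ n ≤ Real.exp n := by
      have : (2 : ℝ) ≤ Real.exp 1 := by linarith [Real.add_one_le_exp (1 : ℝ)]
      calc (2 : ℝ) ^ n ≤ (Real.exp 1) ^ n := pow_le_pow_left₀ (by norm_num) this _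
        _ = _ := by rw [← Real.exp_nat_mul, mul_one]
    calc _ ≤ (Real.exp n * Real.exp n) * Real.exp (-30 * n) := by
          apply mul_le_mul_of_nonneg_right _ (Real.exp_pos _).le
          exact h1.trans (mul_le_mul h2 h2 (by positivity) (Real.exp_pos _).le)
      _ = Real.exp (-(28 * n)) := by
          rw [← Real.exp_add, ← Real.exp_add]; congr 1; ring
      _ ≤ 1 / n := by
          rw [Real.exp_neg, one_div]
          apply inv_anti₀ hn0
          linarith [Real.add_one_le_exp (28 * (n : ℝ))]

def E4 {n : ℕ} (ω : Sym2 (Fin n) → Bool) (p : ℝ) : Prop :=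
  ∀ u w : Fin n, u ≠ w → cod ω (Finset.univ \ {u, w}) u w ≤ 6 * (n * p ^ 2)

def E5 {n : ℕ} (G : SimpleGraph (Fin n)) (p : ℝ) : Prop :=
  ∀ B : Finset (Fin n), 10 ^ 6 ≤ B.card * p ^ 2 →
    ∑ a ∈ (prs (Finset.univ \ B)).filter (fun a => G.Adj a.1 a.2),
      max 0 ((codegIn G a.1 a.2 B : ℝ) - 101 / 100 * (B.card * p ^ 2)) ≤
      1 / 20 * (B.card * p ^ 2) * (p * n ^ 2 / 2)

theorem pE4 {n : ℕ} {p : ℝ} (h : Hyp n p) :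
    Pr p (fun ω : Sym2 (Fin n) → Bool => ¬ E4 ω p) ≤ 1 / n := by
  have hn : (3 : ℝ) ≤ n := by exact_mod_cast h.hn
  have hn0 : (0 : ℝ) < n := by linarith
  have h0 := h.h0
  have step : ∀ x ∈ (Finset.univ : Finset (Fin n × Fin n)).filter (fun x => x.1 ≠ x.2),
      Pr p (fun ω : Sym2 (Fin n) → Bool =>
        6 * (n * p ^ 2) ≤ 1 * cod ω (Finset.univ \ {x.1, x.2}) x.1 x.2) ≤
        Real.exp (-3 * Real.log n) := by
    rintro ⟨u, w⟩ hx
    simp only [Finset.mem_filter, Finset.mem_univ, true_and] at hx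
    have m := cod_mgf (p := p) (Finset.univ \ {u, w}) u w (by simp) (by simp) hx 1 (by norm_num)
    refine (Pr_exp h.h0.le h.h1 _ _ _ m).trans ?_
    rw [← Real.exp_add]
    apply Real.exp_le_exp.mpr
    have hc : ((Finset.univ \ {u, w} : Finset (Fin n)).card : ℝ) ≤ n := by
      have := Finset.card_le_univ (Finset.univ \ {u, w} : Finset (Fin n))
      rw [Fintype.card_fin] at this
      exact_mod_cast this
    have h2 : ((Finset.univ \ {u, w} : Finset (Fin n)).card : ℝ) * p ^ 2 * (Real.exp 1 - 1)
        ≤ n * p ^ 2 * 2 := by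
      apply mul_le_mul (mul_le_mul_of_nonneg_right hc (by positivity)) _ _ (by positivity)
      · linarith [Real.exp_one_lt_d9]
      · linarith [Real.add_one_le_exp (1 : ℝ)]
    linarith [h.hp, h.log]
  have hU := Pr_union h.h0.le h.h1
    ((Finset.univ : Finset (Fin n × Fin n)).filter (fun x => x.1 ≠ x.2))
    (fun x (ω : Sym2 (Fin n) → Bool) =>
        6 * (n * p ^ 2) ≤ 1 * cod ω (Finset.univ \ {x.1, x.2}) x.1 x.2)
  refine le_trans (Pr_mono h.h0.le h.h1 ?_) (hU.trans ?_)
  · intro ω hω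
    unfold E4 at hω
    push Not at hω
    obtain ⟨u, w, h1, h2⟩ := hω
    exact ⟨(u, w), by simp [h1], by rw [one_mul]; exact h2.le⟩
  · refine (Finset.sum_le_sum step).trans ?_
    rw [Finset.sum_const, nsmul_eq_mul]
    have h1 : (((Finset.univ : Finset (Fin n × Fin n)).filter (fun x => x.1 ≠ x.2)).card : ℝ) ≤
      (n : ℝ) * n := by
      have := Finset.card_filter_le (Finset.univ : Finset (Fin n × Fin n)) (fun x => x.1 ≠ x.2)
      rw [Finset.card_univ, Fintype.card_prod, Fintype.card_fin] at this
      exact_mod_cast this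
    have h2 : Real.exp (-3 * Real.log n) = (1 / (n : ℝ)) ^ 3 := by
      rw [show (-3 : ℝ) * Real.log n = -((3 : ℕ) * Real.log n) by push_cast; ring,
        Real.exp_neg, Real.exp_nat_mul, Real.exp_log hn0, one_div, inv_pow]
    rw [h2]
    calc _ ≤ (n : ℝ) * n * (1 / (n : ℝ)) ^ 3 :=
          mul_le_mul_of_nonneg_right h1 (by positivity)
      _ = 1 / n := by field_simp

/-- Excess codegree. -/
def gg {n : ℕ} (p : ℝ) (ω : Sym2 (Fin n) → Bool) (B : Finset (Fin n)) (a : Fin n × Fin n) : ℝ :=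
  max 0 (cod ω B a.1 a.2 - 101 / 100 * (B.card * p ^ 2))

theorem gg_nonneg {n : ℕ} (p : ℝ) (ω : Sym2 (Fin n) → Bool) (B : Finset (Fin n))
    (a : Fin n × Fin n) : 0 ≤ gg p ω B a := le_max_left _ _

theorem gg_mgf {n : ℕ} {p : ℝ} (h0 : 0 ≤ p) (h1 : p ≤ 1) (B : Finset (Fin n)) (a : Fin n × Fin n)
    (hu : a.1 ∉ B) (hw : a.2 ∉ B) (huw : a.1 ≠ a.2) :
    Ex p (fun ω => Real.exp (1 / 100 * gg p ω B a)) ≤ 2 := by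
  set μ : ℝ := B.card * p ^ 2 with hμ
  have hμ0 : 0 ≤ μ := by positivity
  have e1 : Ex p (fun ω => Real.exp (1 / 100 * gg p ω B a)) ≤
      Ex p (fun ω => 1 + Real.exp (-(1 / 100 * (101 / 100 * μ))) *
        Real.exp (1 / 100 * cod ω B a.1 a.2)) := by
    apply Ex_mono h0 h1
    intro ω
    rw [← Real.exp_add]
    unfold gg
    rcases max_cases 0 (cod ω B a.1 a.2 - 101 / 100 * μ) with ⟨h, _⟩ | ⟨h, _⟩
    · rw [h, mul_zero, Real.exp_zero]
      linarith [Real.exp_pos (-(1 / 100 * (101 / 100 * μ)) + 1 / 100 * cod ω B a.1 a.2)]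
    · rw [h]
      rw [show 1 / 100 * (cod ω B a.1 a.2 - 101 / 100 * μ) =
        -(1 / 100 * (101 / 100 * μ)) + 1 / 100 * cod ω B a.1 a.2 by ring]
      linarith
  refine e1.trans ?_
  rw [Ex_add, Ex_const, Ex_smul]
  have m := cod_mgf (p := p) B a.1 a.2 hu hw huw (1 / 100) (by norm_num)
  have : Real.exp (-(1 / 100 * (101 / 100 * μ))) *
      Ex p (fun ω => Real.exp (1 / 100 * cod ω B a.1 a.2)) ≤ 1 := by
    refine (mul_le_mul_of_nonneg_left m (Real.exp_pos _).le).trans ?_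
    rw [← Real.exp_add, Real.exp_le_one_iff]
    have he := exp_le_quad (x := 1 / 100) (by rw [abs_of_pos] <;> norm_num)
    rw [← hμ]
    nlinarith
  linarith

theorem round1_class {n : ℕ} {p : ℝ} (h : Hyp n p) (B : Finset (Fin n))
    (hB : 10 ^ 6 ≤ B.card * p ^ 2) (c : ℕ) :
    Pr p (fun ω => 1 / 100 * (B.card * p ^ 2 * n / 320) ≤
      ∑ a ∈ (prs (Finset.univ \ B)).filter (fun a => a.1.val + a.2.val = c),
        1 / 100 * gg p ω B a) ≤ Real.exp (-(30 * n)) := by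
  set M := (prs (Finset.univ \ B)).filter (fun a => a.1.val + a.2.val = c) with hM
  have hmem : ∀ a ∈ M, a.1 ∉ B ∧ a.2 ∉ B ∧ a.1 < a.2 ∧ a.1.val + a.2.val = c := by
    intro a ha
    simp only [hM, prs, Finset.mem_filter, Finset.mem_product, Finset.mem_sdiff,
      Finset.mem_univ, true_and] at ha
    exact ⟨ha.1.1.1, ha.1.1.2, ha.1.2, ha.2⟩
  have hcard : M.card ≤ n := by
    have : M.card ≤ (Finset.univ : Finset (Fin n)).card := by
      apply Finset.card_le_card_of_injOn (fun a => a.1) (fun _ _ => Finset.mem_univ _)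
      intro a ha b hb hab
      have h1 := (hmem a ha).2.2.2
      have h2 := (hmem b hb).2.2.2
      simp only at hab
      rw [hab] at h1
      exact Prod.ext hab (Fin.ext (by omega))
    simpa using this
  have mgf : Ex p (fun ω => Real.exp (∑ a ∈ M, 1 / 100 * gg p ω B a)) ≤ 2 ^ n := by
    simp only [Real.exp_sum]
    rw [Ex_prod_indep p M (fun a => B.image (fun b => s(a.1, b)) ∪ B.image (fun b => s(a.2, b)))]
    · calc _ ≤ ∏ a ∈ M, (2 : ℝ) := by
            apply Finset.prod_le_prod
            · intro a _
              rw [← Ex_const (I := Sym2 (Fin n)) p 0]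
              exact Ex_mono h.h0.le h.h1 fun ω => (Real.exp_pos _).le
            · intro a ha
              have := hmem a ha
              exact gg_mgf h.h0.le h.h1 B a this.1 this.2.1 this.2.2.1.ne
        _ = 2 ^ M.card := by rw [Finset.prod_const]
        _ ≤ 2 ^ n := pow_le_pow_right₀ (by norm_num) hcard
    · intro a ha ω ω' hw
      simp only [gg]
      rw [cod_dep ω ω' B a.1 a.2]
      intro b hb
      exact ⟨hw _ (Finset.mem_union_left _ (Finset.mem_image_of_mem _ hb)),
        hw _ (Finset.mem_union_right _ (Finset.mem_image_of_mem _ hb))⟩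
    · intro a ha a' ha' hne
      obtain ⟨h1, h2, h3, h4⟩ := hmem a ha
      obtain ⟨h1', h2', h3', h4'⟩ := hmem a' ha'
      have key : ∀ x x' b b' : Fin n, x ∉ B → x' ∉ B → b ∈ B → b' ∈ B → s(x, b) = s(x', b') →
          x = x' := by
        intro x x' b b' hx hx' hb hb' he
        rw [Sym2.eq_iff] at he
        rcases he with he | he
        · exact he.1
        · exact absurd hb' (he.1 ▸ hx)
      have hne' : a.1 ≠ a'.1 ∧ a.1 ≠ a'.2 ∧ a.2 ≠ a'.1 ∧ a.2 ≠ a'.2 := by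
        have hlt : a.1.val < a.2.val := h3
        have hlt' : a'.1.val < a'.2.val := h3'
        refine ⟨?_, ?_, ?_, ?_⟩ <;> intro he <;> have hev := congrArg Fin.val he
        · exact hne (Prod.ext he (Fin.ext (by omega)))
        · omega
        · omega
        · exact hne (Prod.ext (Fin.ext (by omega)) he)
      rw [Finset.disjoint_left]
      intro e he he'
      simp only [Finset.mem_union, Finset.mem_image] at he he'
      rcases he with ⟨b, hb, rfl⟩ | ⟨b, hb, rfl⟩ <;> rcases he' with ⟨b', hb', he⟩ | ⟨b', hb', he⟩
      · exact hne'.1 (key _ _ _ _ h1 h1' hb hb' he.symm)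
      · exact hne'.2.1 (key _ _ _ _ h1 h2' hb hb' he.symm)
      · exact hne'.2.2.1 (key _ _ _ _ h2 h1' hb hb' he.symm)
      · exact hne'.2.2.2 (key _ _ _ _ h2 h2' hb hb' he.symm)
  refine (Pr_exp h.h0.le h.h1 _ _ _ mgf).trans ?_
  have h2 : (2 : ℝ) ^ n ≤ Real.exp n := by
    have : (2 : ℝ) ≤ Real.exp 1 := by linarith [Real.add_one_le_exp (1 : ℝ)]
    calc (2 : ℝ) ^ n ≤ (Real.exp 1) ^ n := pow_le_pow_left₀ (by norm_num) this _
      _ = _ := by rw [← Real.exp_nat_mul, mul_one]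
  refine (mul_le_mul_of_nonneg_right h2 (Real.exp_pos _).le).trans ?_
  rw [← Real.exp_add]
  apply Real.exp_le_exp.mpr
  have hn0 : (0 : ℝ) ≤ n := by positivity
  nlinarith [mul_le_mul_of_nonneg_right hB hn0]

theorem round1 {n : ℕ} {p : ℝ} (h : Hyp n p) (B : Finset (Fin n))
    (hB : 10 ^ 6 ≤ B.card * p ^ 2) :
    Pr p (fun ω => B.card * p ^ 2 * n ^ 2 / 160 ≤ ∑ a ∈ prs (Finset.univ \ B), gg p ω B a) ≤
      2 * n * Real.exp (-(30 * n)) := by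
  have hn : (3 : ℝ) ≤ n := by exact_mod_cast h.hn
  have hU := Pr_union h.h0.le h.h1 (Finset.range (2 * n)) (fun c (ω : Sym2 (Fin n) → Bool) =>
    1 / 100 * (B.card * p ^ 2 * n / 320) ≤
      ∑ a ∈ (prs (Finset.univ \ B)).filter (fun a => a.1.val + a.2.val = c),
        1 / 100 * gg p ω B a)
  refine le_trans (Pr_mono h.h0.le h.h1 ?_) (hU.trans ?_)
  · intro ω hω
    by_contra hcon
    push Not at hcon
    have e := Finset.sum_fiberwise_of_maps_to (s := prs (Finset.univ \ B))
      (t := Finset.range (2 * n)) (g := fun a => a.1.val + a.2.val)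
      (fun a _ => by rw [Finset.mem_range]; have := a.1.2; have := a.2.2; omega)
      (fun a => gg p ω B a)
    have hlt : ∑ c ∈ Finset.range (2 * n),
        ∑ a ∈ (prs (Finset.univ \ B)).filter (fun a => a.1.val + a.2.val = c), gg p ω B a <
        ∑ c ∈ Finset.range (2 * n), B.card * p ^ 2 * n / 320 := by
      apply Finset.sum_lt_sum_of_nonempty
      · rw [Finset.nonempty_range_iff]; have := h.hn; omega
      · intro c hc
        have := hcon c hc
        rw [← Finset.mul_sum] at this
        linarith
    rw [e, Finset.sum_const, Finset.card_range, nsmul_eq_mul] at hlt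
    push_cast at hlt
    nlinarith
  · refine (Finset.sum_le_sum fun c _ => round1_class h B hB c).trans ?_
    rw [Finset.sum_const, Finset.card_range, nsmul_eq_mul]
    push_cast
    exact le_rfl

theorem round2 {n : ℕ} {p : ℝ} (h : Hyp n p) (B : Finset (Fin n))
    (hB : 10 ^ 6 ≤ B.card * p ^ 2) :
    Pr p (fun ω => ∑ a ∈ prs (Finset.univ \ B), gg p ω B a ≤ B.card * p ^ 2 * n ^ 2 / 160 ∧
      B.card * p ^ 2 * n ^ 2 / 160 * (4 * p) ≤ ∑ a ∈ prs (Finset.univ \ B),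
        if ω s(a.1, a.2) = true then min (gg p ω B a) (6 * (n * p ^ 2)) else 0) ≤
      Real.exp (-(30 * n)) := by
  have hn : (3 : ℝ) ≤ n := by exact_mod_cast h.hn
  have hn0 : (0 : ℝ) < n := by linarith
  have h0 := h.h0
  set A : ℝ := B.card * p ^ 2 * n ^ 2 / 160 with hA
  set K : ℝ := 6 * (n * p ^ 2) with hK
  have hK0 : 0 < K := by positivity
  have hA0 : 0 ≤ A := by positivity
  set S : Finset (Sym2 (Fin n)) := Finset.univ.filter (fun e => ∃ b ∈ B, b ∈ e) with hS
  have hmem : ∀ a ∈ prs (Finset.univ \ B), a.1 ∉ B ∧ a.2 ∉ B := by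
    intro a ha
    simp only [prs, Finset.mem_filter, Finset.mem_product, Finset.mem_sdiff,
      Finset.mem_univ, true_and] at ha
    exact ha.1
  unfold Pr
  rw [← Ex_merge p S]
  rw [← Ex_const (I := Sym2 (Fin n)) p (Real.exp (-(30 * n)))]
  apply Ex_mono h.h0.le h.h1
  intro ω
  have hgg : ∀ ω' : Sym2 (Fin n) → Bool, ∀ a : Fin n × Fin n,
      gg p (fun i => if i ∈ S then ω i else ω' i) B a = gg p ω B a := by
    intro ω' a
    unfold gg
    rw [cod_dep _ ω B a.1 a.2]
    intro b hb
    have h1 : s(a.1, b) ∈ S := by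
      simp only [hS, Finset.mem_filter, Finset.mem_univ, true_and]
      exact ⟨b, hb, by simp⟩
    have h2 : s(a.2, b) ∈ S := by
      simp only [hS, Finset.mem_filter, Finset.mem_univ, true_and]
      exact ⟨b, hb, by simp⟩
    simp [h1, h2]
  have hout : ∀ a ∈ prs (Finset.univ \ B), s(a.1, a.2) ∉ S := by
    intro a ha hs
    simp only [hS, Finset.mem_filter, Finset.mem_univ, true_and, Sym2.mem_iff] at hs
    obtain ⟨b, hb, rfl | rfl⟩ := hs
    · exact (hmem a ha).1 hb
    · exact (hmem a ha).2 hb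
  by_cases hsum : ∑ a ∈ prs (Finset.univ \ B), gg p ω B a ≤ A
  · have c := chernoff h.h0.le h.h1 (prs (Finset.univ \ B))
      (fun a : Fin n × Fin n => s(a.1, a.2)) (prs_inj _)
      (fun a => K⁻¹ * min (gg p ω B a) K) (K⁻¹ * (A * (4 * p)))
    refine le_trans (Pr_mono (B := fun ω' => K⁻¹ * (A * (4 * p)) ≤
      ∑ a ∈ prs (Finset.univ \ B), if ω' s(a.1, a.2) = true then
        K⁻¹ * min (gg p ω B a) K else 0) h.h0.le h.h1 ?_) (c.trans ?_)
    · rintro ω' ⟨_, hω'⟩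
      have e : ∑ a ∈ prs (Finset.univ \ B), (if ω' s(a.1, a.2) = true then
        K⁻¹ * min (gg p ω B a) K else 0) = K⁻¹ * ∑ a ∈ prs (Finset.univ \ B),
          if (fun i => if i ∈ S then ω i else ω' i) s(a.1, a.2) = true then
          min (gg p (fun i => if i ∈ S then ω i else ω' i) B a) K else 0 := by
        rw [Finset.mul_sum]
        refine Finset.sum_congr rfl fun a ha => ?_
        rw [hgg]
        simp only [hout a ha, if_false]
        split_ifs <;> simp
      rw [e]
      exact mul_le_mul_of_nonneg_left hω' (by positivity)
    · apply Real.exp_le_exp.mpr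
      have h1 : ∑ a ∈ prs (Finset.univ \ B), (Real.exp (K⁻¹ * min (gg p ω B a) K) - 1) ≤
          2 * K⁻¹ * A := by
        calc _ ≤ ∑ a ∈ prs (Finset.univ \ B), 2 * K⁻¹ * gg p ω B a := by
              apply Finset.sum_le_sum
              intro a _
              have g0 := gg_nonneg p ω B a
              have m0 : 0 ≤ min (gg p ω B a) K := le_min g0 hK0.le
              have x0 : 0 ≤ K⁻¹ * min (gg p ω B a) K := by positivity
              have x1 : K⁻¹ * min (gg p ω B a) K ≤ 1 := by
                rw [inv_mul_le_iff₀ hK0, mul_one]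
                exact min_le_right _ _
              have x2 : K⁻¹ * min (gg p ω B a) K ≤ K⁻¹ * gg p ω B a :=
                mul_le_mul_of_nonneg_left (min_le_left _ _) (by positivity)
              have := exp_le_quad (x := K⁻¹ * min (gg p ω B a) K) (by rw [abs_of_nonneg x0]; exact x1)
              nlinarith
          _ = 2 * K⁻¹ * ∑ a ∈ prs (Finset.univ \ B), gg p ω B a := by rw [Finset.mul_sum]
          _ ≤ _ := mul_le_mul_of_nonneg_left hsum (by positivity)
      have h2 := mul_le_mul_of_nonneg_left h1 h0.le
      have h3 : 30 * n ≤ 2 * p * (K⁻¹ * A) := by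
        have : 2 * p * (K⁻¹ * A) = B.card * p ^ 2 * n / (480 * p) := by
          rw [hA, hK]; field_simp; ring
        rw [this, le_div_iff₀ (by positivity)]
        nlinarith [mul_le_mul_of_nonneg_right hB hn0.le, mul_le_mul_of_nonneg_left h.h1 hn0.le]
      linarith
  · have : ∀ ω' : Sym2 (Fin n) → Bool, ¬ (∑ a ∈ prs (Finset.univ \ B),
        gg p (fun i => if i ∈ S then ω i else ω' i) B a ≤ A) := by
      intro ω'
      rw [Finset.sum_congr rfl fun a _ => hgg ω' a]
      exact hsum
    simp only [this, false_and, if_false, Ex_const]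
    positivity

theorem pE5 {n : ℕ} {p : ℝ} (h : Hyp n p) :
    Pr p (fun ω : Sym2 (Fin n) → Bool => E4 ω p ∧ ¬ E5 (gr ω) p) ≤ 1 / n := by
  have hn : (3 : ℝ) ≤ n := by exact_mod_cast h.hn
  have hn0 : (0 : ℝ) < n := by linarith
  have h0 := h.h0
  have hU := Pr_union h.h0.le h.h1 ((Finset.univ : Finset (Finset (Fin n))).filter
      (fun B => 10 ^ 6 ≤ B.card * p ^ 2)) (fun B (ω : Sym2 (Fin n) → Bool) =>
      (B.card * p ^ 2 * n ^ 2 / 160 ≤ ∑ a ∈ prs (Finset.univ \ B), gg p ω B a) ∨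
      (∑ a ∈ prs (Finset.univ \ B), gg p ω B a ≤ B.card * p ^ 2 * n ^ 2 / 160 ∧
      B.card * p ^ 2 * n ^ 2 / 160 * (4 * p) ≤ ∑ a ∈ prs (Finset.univ \ B),
        if ω s(a.1, a.2) = true then min (gg p ω B a) (6 * (n * p ^ 2)) else 0))
  refine le_trans (Pr_mono h.h0.le h.h1 ?_) (hU.trans ?_)
  · rintro ω ⟨h4, hω⟩
    unfold E5 at hω
    push Not at hω
    obtain ⟨B, hB, hlt⟩ := hω
    refine ⟨B, by simpa using hB, ?_⟩
    rcases le_total (B.card * p ^ 2 * n ^ 2 / 160) (∑ a ∈ prs (Finset.univ \ B), gg p ω B a)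
      with hle | hle
    · exact Or.inl hle
    · refine Or.inr ⟨hle, ?_⟩
      have e : ∑ a ∈ (prs (Finset.univ \ B)).filter (fun a => (gr ω).Adj a.1 a.2),
          max 0 ((codegIn (gr ω) a.1 a.2 B : ℝ) - 101 / 100 * (B.card * p ^ 2)) =
          ∑ a ∈ prs (Finset.univ \ B),
        if ω s(a.1, a.2) = true then min (gg p ω B a) (6 * (n * p ^ 2)) else 0 := by
        rw [Finset.sum_filter]
        refine Finset.sum_congr rfl fun a ha => ?_
        simp only [prs, Finset.mem_filter, Finset.mem_product, Finset.mem_sdiff,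
          Finset.mem_univ, true_and] at ha
        obtain ⟨⟨ha1, ha2⟩, hlt⟩ := ha
        have hm : gg p ω B a ≤ 6 * (n * p ^ 2) := by
          unfold gg
          apply max_le (by positivity)
          have h1 := h4 a.1 a.2 hlt.ne
          have h2 : cod ω B a.1 a.2 ≤ cod ω (Finset.univ \ {a.1, a.2}) a.1 a.2 := by
            unfold cod
            apply Finset.sum_le_sum_of_subset_of_nonneg
            · intro b hb
              simp only [Finset.mem_sdiff, Finset.mem_univ, true_and, Finset.mem_insert,
                Finset.mem_singleton, not_or]
              exact ⟨fun e => ha1 (e ▸ hb), fun e => ha2 (e ▸ hb)⟩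
            · intros; split_ifs <;> norm_num
          have : 0 ≤ 101 / 100 * ((B.card : ℝ) * p ^ 2) := by positivity
          linarith
        rw [min_eq_left hm, cod_eq ω B a.1 a.2 ha1 ha2]
        simp [gr_adj, hlt.ne, gg]
      rw [← e]
      refine le_trans (le_of_eq ?_) hlt.le
      ring
  · have step : ∀ B ∈ (Finset.univ : Finset (Finset (Fin n))).filter
      (fun B => 10 ^ 6 ≤ B.card * p ^ 2), Pr p (fun ω : Sym2 (Fin n) → Bool =>
      (B.card * p ^ 2 * n ^ 2 / 160 ≤ ∑ a ∈ prs (Finset.univ \ B), gg p ω B a) ∨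
      (∑ a ∈ prs (Finset.univ \ B), gg p ω B a ≤ B.card * p ^ 2 * n ^ 2 / 160 ∧
      B.card * p ^ 2 * n ^ 2 / 160 * (4 * p) ≤ ∑ a ∈ prs (Finset.univ \ B),
        if ω s(a.1, a.2) = true then min (gg p ω B a) (6 * (n * p ^ 2)) else 0)) ≤
        Real.exp (-(28 * n)) := by
      intro B hB
      simp only [Finset.mem_filter, Finset.mem_univ, true_and] at hB
      refine (Pr_or h.h0.le h.h1 _ _).trans ?_
      refine (add_le_add (round1 h B hB) (round2 h B hB)).trans ?_
      have e1 : Real.exp (-(28 * n)) = Real.exp (2 * n) * Real.exp (-(30 * n)) := by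
        rw [← Real.exp_add]; congr 1; ring
      rw [e1]
      nlinarith [Real.add_one_le_exp (2 * (n : ℝ)), Real.exp_pos (-(30 * (n : ℝ)))]
    refine (Finset.sum_le_sum step).trans ?_
    rw [Finset.sum_const, nsmul_eq_mul]
    have h1 : (((Finset.univ : Finset (Finset (Fin n))).filter
      (fun B => 10 ^ 6 ≤ B.card * p ^ 2)).card : ℝ) ≤ (2 : ℝ) ^ n := by
      have := Finset.card_filter_le (Finset.univ : Finset (Finset (Fin n)))
        (fun B => 10 ^ 6 ≤ B.card * p ^ 2)
      rw [Finset.card_univ, Fintype.card_finset, Fintype.card_fin] at this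
      exact_mod_cast this
    have h2 : (2 : ℝ) ^ n ≤ Real.exp n := by
      have : (2 : ℝ) ≤ Real.exp 1 := by linarith [Real.add_one_le_exp (1 : ℝ)]
      calc (2 : ℝ) ^ n ≤ (Real.exp 1) ^ n := pow_le_pow_left₀ (by norm_num) this _
        _ = _ := by rw [← Real.exp_nat_mul, mul_one]
    calc _ ≤ Real.exp n * Real.exp (-(28 * n)) :=
          mul_le_mul_of_nonneg_right (h1.trans h2) (Real.exp_pos _).le
      _ = Real.exp (-(27 * n)) := by
          rw [← Real.exp_add]; congr 1; ring
      _ ≤ 1 / n := by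
          rw [Real.exp_neg, one_div]
          apply inv_anti₀ hn0
          linarith [Real.add_one_le_exp (27 * (n : ℝ))]

theorem handshake {n : ℕ} (G : SimpleGraph (Fin n)) :
    (∑ v, (degIn G v Finset.univ : ℝ)) =
      2 * (((prs Finset.univ).filter fun a => G.Adj a.1 a.2).card : ℝ) := by
  have e2 : ∑ v, degIn G v Finset.univ =
      ((Finset.univ ×ˢ Finset.univ).filter fun a : Fin n × Fin n => G.Adj a.1 a.2).card := by
    unfold degIn
    simp only [Finset.card_filter]
    rw [Finset.sum_product]
  have h1 : ((Finset.univ ×ˢ Finset.univ).filter fun a : Fin n × Fin n => G.Adj a.1 a.2) =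
      ((prs Finset.univ).filter fun a => G.Adj a.1 a.2) ∪
      Finset.univ.filter (fun a : Fin n × Fin n => a.2 < a.1 ∧ G.Adj a.1 a.2) := by
    ext ⟨a, b⟩
    simp only [prs, Finset.mem_union, Finset.mem_filter, Finset.mem_product, Finset.mem_univ,
      true_and]
    constructor
    · intro h
      rcases lt_or_gt_of_ne h.ne with h' | h'
      · exact Or.inl ⟨h', h⟩
      · exact Or.inr ⟨h', h⟩
    · rintro (h | h)
      · exact h.2
      · exact h.2
  have h2 : (Finset.univ.filter (fun a : Fin n × Fin n => a.2 < a.1 ∧ G.Adj a.1 a.2)).card =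
      ((prs Finset.univ).filter fun a => G.Adj a.1 a.2).card := by
    apply Finset.card_bij (fun a _ => (a.2, a.1))
    · rintro ⟨a, b⟩ h
      simp only [prs, Finset.mem_filter, Finset.mem_product, Finset.mem_univ, true_and] at h ⊢
      exact ⟨h.1, h.2.symm⟩
    · rintro ⟨a, b⟩ _ ⟨c, d⟩ _ h
      simp only [Prod.mk.injEq] at h ⊢
      exact ⟨h.2, h.1⟩
    · rintro ⟨a, b⟩ h
      simp only [prs, Finset.mem_filter, Finset.mem_product, Finset.mem_univ, true_and] at h
      exact ⟨(b, a), by simp [h.1, h.2.symm], rfl⟩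
  rw [h1, Finset.card_union_of_disjoint, h2] at e2
  · rw [← Nat.cast_sum, e2]; push_cast; ring
  · rw [Finset.disjoint_left]
    intro a ha hb
    simp only [prs, Finset.mem_filter, Finset.mem_univ, true_and] at ha hb
    exact lt_asymm ha.1.2 hb.1

theorem det_main {n : ℕ} {p : ℝ} (h : Hyp n p) (G : SimpleGraph (Fin n))
    (e1 : E1 G p) (e2 : E2 G p) (e3 : E3 G p) (e5 : E5 G p)
    (G' : SimpleGraph (Fin n)) (hG : G' ≤ G)
    (hdeg : ∀ v, (2 / 3 : ℝ) * n * p ≤ (degIn G' v Finset.univ : ℝ))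
    (T : Finset (Fin n)) (hT : (T.card : ℝ) ≤ 1 / 2000 * n) :
    ((((Finset.univ : Finset (Fin n)) \ T).filter fun v =>
      ¬ ∃ y z : Fin n, G'.Adj v y ∧ G'.Adj v z ∧ G'.Adj y z ∧
        y ∉ T ∧ z ∉ T).card : ℝ) ≤ 10 ^ 6 / p ^ 2 := by
  by_contra hcon
  push Not at hcon
  set Z := (((Finset.univ : Finset (Fin n)) \ T).filter fun v =>
      ∀ y z : Fin n, G'.Adj v y → G'.Adj v z → G'.Adj y z → y ∉ T → z ∈ T) with hZ
  have h0 := h.h0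
  have hn : (3 : ℝ) ≤ n := by exact_mod_cast h.hn
  have hn0 : (0 : ℝ) < n := by linarith
  have hp2 : 0 < p ^ 2 := by positivity
  have hk : ⌊10 ^ 6 / p ^ 2⌋₊ + 1 ≤ Z.card := by
    apply Nat.succ_le_of_lt
    exact (Nat.floor_lt (by positivity)).mpr hcon
  obtain ⟨B, hBZ, hBc⟩ := Finset.exists_subset_card_eq hk
  have hk1 : 10 ^ 6 / p ^ 2 ≤ (B.card : ℝ) := by
    rw [hBc]; push_cast; exact (Nat.lt_floor_add_one _).le
  have hk2 : (B.card : ℝ) ≤ 10 ^ 6 / p ^ 2 + 1 := by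
    rw [hBc]; push_cast
    linarith [Nat.floor_le (show (0 : ℝ) ≤ 10 ^ 6 / p ^ 2 by positivity)]
  set k : ℝ := (B.card : ℝ) with hkdef
  have hmu : 10 ^ 6 ≤ k * p ^ 2 := by
    rwa [div_le_iff₀ hp2] at hk1
  have hkn : k ≤ 1 / 2000 * n := by
    have a1 : k * p ^ 2 ≤ 10 ^ 6 + p ^ 2 := by
      have := mul_le_mul_of_nonneg_right hk2 hp2.le
      rwa [add_mul, one_mul, div_mul_cancel₀ _ hp2.ne'] at this
    have a2 : p ^ 2 ≤ 1 := pow_le_one₀ h0.le h.h1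
    have a3 := h.np2
    have a4 : k * p ^ 2 ≤ 1 / 2000 * n * p ^ 2 := by linarith
    exact le_of_mul_le_mul_right a4 hp2
  set T' := T ∪ B with hT'
  have hT'c : (T'.card : ℝ) ≤ n / 1000 := by
    have : (T'.card : ℝ) ≤ T.card + B.card := by exact_mod_cast Finset.card_union_le T B
    linarith
  set S := B.filter (fun v => n * p / 100 < (degIn G v T' : ℝ)) with hS
  have hSc : (S.card : ℝ) < 10 ^ 4 / p ^ 2 := by
    by_contra hge
    push Not at hge
    obtain ⟨v, hv, hle⟩ := e2 S T' hT'c hge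
    simp only [hS, Finset.mem_filter] at hv
    linarith [hv.2]
  have hSk : (S.card : ℝ) ≤ k / 100 := by
    have : (10 : ℝ) ^ 4 / p ^ 2 = 10 ^ 6 / p ^ 2 / 100 := by ring
    linarith
  set B1 := B \ S with hB1
  have hB1c : 99 / 100 * k ≤ (B1.card : ℝ) := by
    have : B1.card + S.card = B.card := Finset.card_sdiff_add_card_eq_card (Finset.filter_subset _ _)
    have : (B1.card : ℝ) + S.card = k := by rw [hkdef]; exact_mod_cast this
    linarith
  set N : Fin n → Finset (Fin n) := fun v => Finset.univ.filter (fun w => G'.Adj v w ∧ w ∉ T')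
    with hN
  have hNc : ∀ v ∈ B1, 197 / 300 * (n * p) ≤ ((N v).card : ℝ) := by
    intro v hv
    simp only [hB1, hS, Finset.mem_sdiff, Finset.mem_filter, not_and, not_lt] at hv
    have a1 := hv.2 hv.1
    have a2 : degIn G' v Finset.univ ≤ (N v).card + degIn G v T' := by
      unfold degIn
      refine (Finset.card_le_card (t := N v ∪ T'.filter fun w => G.Adj v w) ?_).trans
        (Finset.card_union_le _ _)
      intro w hw
      simp only [hN, Finset.mem_filter, Finset.mem_univ, true_and, Finset.mem_union] at hw ⊢
      by_cases hwT : w ∈ T'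
      · exact Or.inr ⟨hwT, hG hw⟩
      · exact Or.inl ⟨hw, hwT⟩
    have a3 : (degIn G' v Finset.univ : ℝ) ≤ (N v).card + degIn G v T' := by exact_mod_cast a2
    linarith [hdeg v]
  set Q : ℝ := p * n ^ 2 / 2 with hQ
  have hQ0 : 0 < Q := by positivity
  have hNe : ∀ v ∈ B1, 99 / 100 * (197 / 300) ^ 2 * (p ^ 2 * Q) ≤
      (((prs (N v)).filter fun a => G.Adj a.1 a.2).card : ℝ) := by
    intro v hv
    have a1 := hNc v hv
    have hnp : 0 ≤ n * p := by positivity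
    have a2 := e1 (N v) (by linarith)
    refine le_trans ?_ a2
    have a3 : (197 / 300 * (n * p)) ^ 2 ≤ ((N v).card : ℝ) ^ 2 :=
      pow_le_pow_left₀ (by positivity) a1 2
    have a4 := mul_le_mul_of_nonneg_left a3 h0.le
    rw [hQ]
    nlinarith
  set R := (prs (Finset.univ \ B)).filter (fun a => G.Adj a.1 a.2 ∧ ¬ G'.Adj a.1 a.2) with hR
  have hsub : ∀ v ∈ B1, ((prs (N v)).filter fun a => G.Adj a.1 a.2) ⊆
      R.filter (fun a => G.Adj a.1 v ∧ G.Adj a.2 v) := by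
    intro v hv a ha
    have hvZ : v ∈ Z := hBZ (Finset.mem_sdiff.mp hv).1
    simp only [hZ, Finset.mem_filter] at hvZ
    simp only [prs, hN, Finset.mem_filter, Finset.mem_product, Finset.mem_univ, true_and,
      hT', Finset.mem_union, not_or] at ha
    obtain ⟨⟨⟨⟨ha1, ha2, ha3⟩, ⟨hb1, hb2, hb3⟩⟩, hlt⟩, hadj⟩ := ha
    simp only [hR, prs, Finset.mem_filter, Finset.mem_product, Finset.mem_sdiff,
      Finset.mem_univ, true_and]
    refine ⟨⟨⟨⟨ha3, hb3⟩, hlt⟩, hadj, ?_⟩, (hG ha1).symm, (hG hb1).symm⟩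
    intro hg
    exact hb2 (hvZ.2 _ _ ha1 hb1 hg ha2)
  have hdc : ∑ v ∈ B, ((R.filter (fun a => G.Adj a.1 v ∧ G.Adj a.2 v)).card : ℝ) =
      ∑ a ∈ R, (codegIn G a.1 a.2 B : ℝ) := by
    unfold codegIn
    simp only [Finset.card_filter, Nat.cast_sum]
    rw [Finset.sum_comm]
  have low : 99 / 100 * k * (99 / 100 * (197 / 300) ^ 2 * (p ^ 2 * Q)) ≤
      ∑ a ∈ R, (codegIn G a.1 a.2 B : ℝ) := by
    rw [← hdc]
    calc _ ≤ (B1.card : ℝ) * (99 / 100 * (197 / 300) ^ 2 * (p ^ 2 * Q)) :=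
          mul_le_mul_of_nonneg_right hB1c (by positivity)
      _ = ∑ v ∈ B1, (99 / 100 * (197 / 300) ^ 2 * (p ^ 2 * Q)) := by
          rw [Finset.sum_const, nsmul_eq_mul]
      _ ≤ ∑ v ∈ B1, ((R.filter (fun a => G.Adj a.1 v ∧ G.Adj a.2 v)).card : ℝ) := by
          apply Finset.sum_le_sum
          intro v hv
          refine (hNe v hv).trans ?_
          exact_mod_cast Finset.card_le_card (hsub v hv)
      _ ≤ _ := by
          apply Finset.sum_le_sum_of_subset_of_nonneg Finset.sdiff_subset
          intros; positivity
  have up : ∑ a ∈ R, (codegIn G a.1 a.2 B : ℝ) ≤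
      R.card * (101 / 100 * (k * p ^ 2)) + 1 / 20 * (k * p ^ 2) * Q := by
    calc _ ≤ ∑ a ∈ R, (101 / 100 * (k * p ^ 2) +
            max 0 ((codegIn G a.1 a.2 B : ℝ) - 101 / 100 * (k * p ^ 2))) := by
          apply Finset.sum_le_sum
          intro a _
          linarith [le_max_right 0 ((codegIn G a.1 a.2 B : ℝ) - 101 / 100 * (k * p ^ 2))]
      _ = R.card * (101 / 100 * (k * p ^ 2)) + ∑ a ∈ R,
            max 0 ((codegIn G a.1 a.2 B : ℝ) - 101 / 100 * (k * p ^ 2)) := by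
          rw [Finset.sum_add_distrib, Finset.sum_const, nsmul_eq_mul]
      _ ≤ _ := by
          apply add_le_add le_rfl
          refine le_trans ?_ (e5 B hmu)
          apply Finset.sum_le_sum_of_subset_of_nonneg
          · intro a ha
            simp only [hR, Finset.mem_filter] at ha ⊢
            exact ⟨ha.1, ha.2.1⟩
          · intros; exact le_max_left _ _
  have hRc : (R.card : ℝ) ≤ (101 / 100 - 2 / 3) * Q := by
    have a1 : R.card + ((prs Finset.univ).filter fun a => G'.Adj a.1 a.2).card ≤
        ((prs Finset.univ).filter fun a => G.Adj a.1 a.2).card := by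
      rw [← Finset.card_union_of_disjoint]
      · apply Finset.card_le_card
        intro a ha
        simp only [hR, prs, Finset.mem_union, Finset.mem_filter, Finset.mem_product,
          Finset.mem_univ, true_and] at ha ⊢
        rcases ha with ha | ha
        · exact ⟨ha.1.2, ha.2.1⟩
        · exact ⟨ha.1, hG ha.2⟩
      · rw [Finset.disjoint_left]
        intro a ha hb
        simp only [hR, Finset.mem_filter] at ha hb
        exact ha.2.2 hb.2
    have a2 : (R.card : ℝ) + (((prs Finset.univ).filter fun a => G'.Adj a.1 a.2).card : ℝ) ≤
        (((prs Finset.univ).filter fun a => G.Adj a.1 a.2).card : ℝ) := by exact_mod_cast a1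
    have a3 := handshake G'
    have a4 : (n : ℝ) * ((2 / 3 : ℝ) * n * p) ≤ ∑ v, (degIn G' v Finset.univ : ℝ) := by
      have : ∑ v : Fin n, ((2 / 3 : ℝ) * n * p) = n * ((2 / 3 : ℝ) * n * p) := by
        rw [Finset.sum_const, Finset.card_univ, Fintype.card_fin, nsmul_eq_mul]
      rw [← this]
      exact Finset.sum_le_sum fun v _ => hdeg v
    have a5 := e3
    unfold E3 at a5
    rw [hQ]
    nlinarith
  have hmuQ : 0 < k * p ^ 2 * Q := by positivity
  have a6 : (R.card : ℝ) * (101 / 100 * (k * p ^ 2)) ≤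
      (101 / 100 - 2 / 3) * Q * (101 / 100 * (k * p ^ 2)) :=
    mul_le_mul_of_nonneg_right hRc (by positivity)
  nlinarith

theorem det_big {n : ℕ} {p : ℝ} (hn : 3 ≤ n) (hp : 1 ≤ p)
    (G' : SimpleGraph (Fin n))
    (hdeg : ∀ v, (2 / 3 : ℝ) * n * p ≤ (degIn G' v Finset.univ : ℝ))
    (T : Finset (Fin n)) (hT : (T.card : ℝ) ≤ 1 / 2000 * n) (v : Fin n) :
    ∃ y z : Fin n, G'.Adj v y ∧ G'.Adj v z ∧ G'.Adj y z ∧ y ∉ T ∧ z ∉ T := by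
  have hn' : (3 : ℝ) ≤ n := by exact_mod_cast hn
  have hd : ∀ v, (2 / 3 : ℝ) * n ≤ ((Finset.univ.filter fun w => G'.Adj v w).card : ℝ) := by
    intro v
    refine le_trans ?_ (hdeg v)
    nlinarith
  have h1 : ∃ y ∈ Finset.univ.filter (fun w => G'.Adj v w), y ∉ T := by
    apply Finset.exists_mem_notMem_of_card_lt_card
    have : (T.card : ℝ) < ((Finset.univ.filter fun w => G'.Adj v w).card : ℝ) := by
      linarith [hd v]
    exact_mod_cast this
  obtain ⟨y, hy, hyT⟩ := h1
  have h2 : ∃ z ∈ Finset.univ.filter (fun w => G'.Adj v w) ∩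
      Finset.univ.filter (fun w => G'.Adj y w), z ∉ T := by
    apply Finset.exists_mem_notMem_of_card_lt_card
    have e := Finset.card_union_add_card_inter (Finset.univ.filter (fun w => G'.Adj v w))
      (Finset.univ.filter (fun w => G'.Adj y w))
    have e' := Finset.card_le_univ (Finset.univ.filter (fun w => G'.Adj v w) ∪
      Finset.univ.filter (fun w => G'.Adj y w))
    rw [Fintype.card_fin] at e'
    have e2 : ((Finset.univ.filter (fun w => G'.Adj v w)).card : ℝ) +
      (Finset.univ.filter (fun w => G'.Adj y w)).card ≤ n +
      (Finset.univ.filter (fun w => G'.Adj v w) ∩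
        Finset.univ.filter (fun w => G'.Adj y w)).card := by
      exact_mod_cast (by omega)
    have : (T.card : ℝ) < ((Finset.univ.filter (fun w => G'.Adj v w) ∩
        Finset.univ.filter (fun w => G'.Adj y w)).card : ℝ) := by
      linarith [hd v, hd y]
    exact_mod_cast this
  obtain ⟨z, hz, hzT⟩ := h2
  simp only [Finset.mem_inter, Finset.mem_filter, Finset.mem_univ, true_and] at hy hz
  exact ⟨y, z, hy, hz.1, hz.2, hyT, hzT⟩

theorem Pr_compl {I : Type*} [Fintype I] [DecidableEq I] (p : ℝ) (A : (I → Bool) → Prop) :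
    Pr p A = 1 - Pr p (fun ω => ¬ A ω) := by
  have : Pr p A + Pr p (fun ω => ¬ A ω) = 1 := by
    unfold Pr
    rw [← Ex_add, ← Ex_const (I := I) p 1]
    congr 1
    funext ω
    by_cases h : A ω <;> simp [h, Ex_const]
  linarith

theorem Pr_nonneg {I : Type*} [Fintype I] [DecidableEq I] {p : ℝ} (h0 : 0 ≤ p) (h1 : p ≤ 1)
    (A : (I → Bool) → Prop) : 0 ≤ Pr p A := by
  rw [← Ex_const (I := I) p 0]
  apply Ex_mono h0 h1
  intro ω
  split_ifs <;> norm_num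

theorem Pr_true {I : Type*} [Fintype I] [DecidableEq I] (p : ℝ) (A : (I → Bool) → Prop)
    (h : ∀ ω, A ω) : Pr p A = 1 := by
  unfold Pr
  simp only [h, if_true]
  exact Ex_const p 1

theorem all_events {n : ℕ} {p : ℝ} (h : Hyp n p) :
    Pr p (fun ω : Sym2 (Fin n) → Bool => ¬ (E1 (gr ω) p ∧ E2 (gr ω) p ∧ E3 (gr ω) p ∧
      E5 (gr ω) p)) ≤ 80006 / n := by
  have h0 := h.h0.le
  have h1 := h.h1
  have s1 : Pr p (fun ω : Sym2 (Fin n) → Bool => ¬ (E1 (gr ω) p ∧ E2 (gr ω) p ∧ E3 (gr ω) p ∧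
      E5 (gr ω) p)) ≤ Pr p (fun ω : Sym2 (Fin n) → Bool => ¬ E1 (gr ω) p ∨ (¬ E2 (gr ω) p ∨
      (¬ E3 (gr ω) p ∨ (¬ E4 ω p ∨ (E4 ω p ∧ ¬ E5 (gr ω) p))))) := by
    apply Pr_mono h0 h1
    intro ω hω
    tauto
  have s2 := Pr_or h0 h1 (fun ω : Sym2 (Fin n) → Bool => ¬ E1 (gr ω) p) (fun ω => (¬ E2 (gr ω) p ∨
      (¬ E3 (gr ω) p ∨ (¬ E4 ω p ∨ (E4 ω p ∧ ¬ E5 (gr ω) p)))))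
  have s3 := Pr_or h0 h1 (fun ω : Sym2 (Fin n) → Bool => ¬ E2 (gr ω) p) (fun ω =>
      (¬ E3 (gr ω) p ∨ (¬ E4 ω p ∨ (E4 ω p ∧ ¬ E5 (gr ω) p))))
  have s4 := Pr_or h0 h1 (fun ω : Sym2 (Fin n) → Bool => ¬ E3 (gr ω) p) (fun ω =>
      (¬ E4 ω p ∨ (E4 ω p ∧ ¬ E5 (gr ω) p)))
  have s5 := Pr_or h0 h1 (fun ω : Sym2 (Fin n) → Bool => ¬ E4 ω p) (fun ω =>
      (E4 ω p ∧ ¬ E5 (gr ω) p))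
  have t1 := pE1 h
  have t2 := pE2 h
  have t3 := pE3 h
  have t4 := pE4 h
  have t5 := pE5 h
  have e : (80006 : ℝ) / n = 3 / n + (1 / n + (80000 / n + (1 / n + 1 / n))) := by ring
  rw [e]
  linarith


/-- **Lemma (leftover vertices lie in triangles).** There exist `C`, `D`, `ε > 0` such that if
`p ≥ C√(log n / n)`, then a.a.s. for every spanning subgraph `G' ⊆ G(n,p)` with minimum degree
at least `(2/3)np` and every `T` with `|T| ≤ εn`, all but at most `D·p⁻²` of the vertices
outside `T` are in a triangle of `G'` avoiding `T`. -/
theorem stmt_13 :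
    ∃ C D ε : ℝ, 0 < C ∧ 0 < D ∧ 0 < ε ∧
      ∀ p : ℕ → ℝ, (∀ n : ℕ, C * Real.sqrt (Real.log n / n) ≤ p n) →
        AAS p (fun n G =>
          ∀ G' : SimpleGraph (Fin n), G' ≤ G →
            (∀ v, (2 / 3 : ℝ) * n * p n ≤ (degIn G' v Finset.univ : ℝ)) →
            ∀ T : Finset (Fin n), (T.card : ℝ) ≤ ε * n →
              ((((Finset.univ : Finset (Fin n)) \ T).filter fun v =>
                  ¬ ∃ y z : Fin n, G'.Adj v y ∧ G'.Adj v z ∧ G'.Adj y z ∧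
                    y ∉ T ∧ z ∉ T).card : ℝ) ≤ D / (p n) ^ 2) := by
  refine ⟨10 ^ 5, 10 ^ 6, 1 / 2000, by norm_num, by norm_num, by norm_num, ?_⟩
  intro p hp
  unfold AAS
  have key : ∀ n : ℕ, 3 ≤ n → 1 - 80006 / (n : ℝ) ≤ gnpProb n (p n) {G |
          ∀ G' : SimpleGraph (Fin n), G' ≤ G →
            (∀ v, (2 / 3 : ℝ) * n * p n ≤ (degIn G' v Finset.univ : ℝ)) →
            ∀ T : Finset (Fin n), (T.card : ℝ) ≤ 1 / 2000 * n →
              ((((Finset.univ : Finset (Fin n)) \ T).filter fun v =>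
                  ¬ ∃ y z : Fin n, G'.Adj v y ∧ G'.Adj v z ∧ G'.Adj y z ∧
                    y ∉ T ∧ z ∉ T).card : ℝ) ≤ 10 ^ 6 / (p n) ^ 2} ∧
      gnpProb n (p n) {G |
          ∀ G' : SimpleGraph (Fin n), G' ≤ G →
            (∀ v, (2 / 3 : ℝ) * n * p n ≤ (degIn G' v Finset.univ : ℝ)) →
            ∀ T : Finset (Fin n), (T.card : ℝ) ≤ 1 / 2000 * n →
              ((((Finset.univ : Finset (Fin n)) \ T).filter fun v =>
                  ¬ ∃ y z : Fin n, G'.Adj v y ∧ G'.Adj v z ∧ G'.Adj y z ∧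
                    y ∉ T ∧ z ∉ T).card : ℝ) ≤ 10 ^ 6 / (p n) ^ 2} ≤ 1 := by
    intro n hn
    have hn' : (3 : ℝ) ≤ n := by exact_mod_cast hn
    have hn0 : (0 : ℝ) < n := by linarith
    rw [gnpProb_eq]
    rcases le_total 1 (p n) with hbig | hsmall
    · rw [Pr_true]
      · refine ⟨?_, le_rfl⟩
        have : 0 ≤ 80006 / (n : ℝ) := by positivity
        linarith
      · intro ω
        simp only [Set.mem_ofPred_eq]
        intro G' _ hdeg T hT
        rw [Finset.filter_false_of_mem]
        · simp only [Finset.card_empty, Nat.cast_zero]; positivity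
        · intro v _
          rw [not_not]
          exact det_big hn hbig G' hdeg T hT v
    · have hl : 1 ≤ Real.log n := by
        rw [Real.le_log_iff_exp_le hn0]
        linarith [Real.exp_one_lt_d9]
      have hsq : 0 < Real.sqrt (Real.log n / n) := Real.sqrt_pos.mpr (by positivity)
      have hpn := hp n
      have h0 : 0 < p n := lt_of_lt_of_le (by positivity) hpn
      have hH : Hyp n (p n) := by
        refine ⟨hn, h0, hsmall, ?_⟩
        have h2 := pow_le_pow_left₀ (by positivity) hpn 2
        rw [mul_pow, Real.sq_sqrt (by positivity)] at h2
        have h3 := mul_le_mul_of_nonneg_left h2 hn0.le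
        refine le_trans (le_of_eq ?_) h3
        field_simp
      refine ⟨?_, ?_⟩
      · rw [Pr_compl]
        have := all_events hH
        have m := Pr_mono (I := Sym2 (Fin n)) h0.le hsmall (A := fun ω => ¬ (gr ω ∈ {G |
          ∀ G' : SimpleGraph (Fin n), G' ≤ G →
            (∀ v, (2 / 3 : ℝ) * n * p n ≤ (degIn G' v Finset.univ : ℝ)) →
            ∀ T : Finset (Fin n), (T.card : ℝ) ≤ 1 / 2000 * n →
              ((((Finset.univ : Finset (Fin n)) \ T).filter fun v =>
                  ¬ ∃ y z : Fin n, G'.Adj v y ∧ G'.Adj v z ∧ G'.Adj y z ∧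
                    y ∉ T ∧ z ∉ T).card : ℝ) ≤ 10 ^ 6 / (p n) ^ 2}))
          (B := fun ω => ¬ (E1 (gr ω) (p n) ∧ E2 (gr ω) (p n) ∧ E3 (gr ω) (p n) ∧
            E5 (gr ω) (p n))) (by
            intro ω hω hE
            apply hω
            intro G' hG hdeg T hT
            exact det_main hH (gr ω) hE.1 hE.2.1 hE.2.2.1 hE.2.2.2 G' hG hdeg T hT)
        linarith
      · rw [Pr_compl]
        linarith [Pr_nonneg (I := Sym2 (Fin n)) h0.le hsmall (fun ω => ¬ (gr ω ∈ {G |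
          ∀ G' : SimpleGraph (Fin n), G' ≤ G →
            (∀ v, (2 / 3 : ℝ) * n * p n ≤ (degIn G' v Finset.univ : ℝ)) →
            ∀ T : Finset (Fin n), (T.card : ℝ) ≤ 1 / 2000 * n →
              ((((Finset.univ : Finset (Fin n)) \ T).filter fun v =>
                  ¬ ∃ y z : Fin n, G'.Adj v y ∧ G'.Adj v z ∧ G'.Adj y z ∧
                    y ∉ T ∧ z ∉ T).card : ℝ) ≤ 10 ^ 6 / (p n) ^ 2}))]
  have lim : Filter.Tendsto (fun n : ℕ => 1 - 80006 / (n : ℝ)) Filter.atTop (nhds 1) := by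
    have := tendsto_const_div_atTop_nhds_zero_nat (80006 : ℝ)
    simpa using this.const_sub 1
  refine tendsto_of_tendsto_of_tendsto_of_le_of_le' lim tendsto_const_nhds ?_ ?_
  · filter_upwards [Filter.eventually_ge_atTop 3] with n hn using (key n hn).1
  · filter_upwards [Filter.eventually_ge_atTop 3] with n hn using (key n hn).2
end
end

section
/- For every ε > 0 there exist a positive constant C(ε) and a positive constant c(ε) such that if p = p(n) satisfies C·n^{-1/2} ≤ p and p → 0 as n → ∞, then asymptotically almost surely G(n,p) contains a spanning subgraph of minimum degree at least (1 − ε)np in which at least c·p^{-2} vertices are not contained in any triangle. -/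
open Finset

open scoped Classical

noncomputable section

open RandomTriangle

namespace RT14

/-- All potential edges. -/
def ES (n : ℕ) : Finset (Sym2 (Fin n)) := Finset.univ.filter fun e => ¬ e.IsDiag

/-- The edge set of a graph as a finset. -/
def eset {n : ℕ} (G : SimpleGraph (Fin n)) : Finset (Sym2 (Fin n)) :=
  Finset.univ.filter fun e => e ∈ G.edgeSet

lemma mem_eset {n : ℕ} (G : SimpleGraph (Fin n)) (e) : e ∈ eset G ↔ e ∈ G.edgeSet := by
  simp [eset]

lemma mem_ES {n : ℕ} (e : Sym2 (Fin n)) : e ∈ ES n ↔ ¬ e.IsDiag := by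
  simp [ES]

lemma eset_sub {n : ℕ} (G : SimpleGraph (Fin n)) : eset G ⊆ ES n := by
  intro e he
  rw [mem_eset] at he
  rw [mem_ES]
  exact G.not_isDiag_of_mem_edgeSet he

lemma card_ES (n : ℕ) : (ES n).card = n.choose 2 := by
  have h := Sym2.card_subtype_not_diag (α := Fin n)
  rw [Fintype.card_subtype] at h
  simp only [Fintype.card_fin] at h
  rw [← h]; unfold ES; congr

/-- The weight of a graph. -/
def W {n : ℕ} (p : ℝ) (G : SimpleGraph (Fin n)) : ℝ :=
  p ^ (eset G).card * (1 - p) ^ (n.choose 2 - (eset G).card)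

lemma W_nonneg {n : ℕ} {p : ℝ} (h0 : 0 ≤ p) (h1 : p ≤ 1) (G : SimpleGraph (Fin n)) :
    0 ≤ W p G := by
  unfold W
  have : 0 ≤ 1 - p := by linarith
  positivity

/-- Expectation. -/
def E {n : ℕ} (p : ℝ) (f : SimpleGraph (Fin n) → ℝ) : ℝ := ∑ G, W p G * f G

lemma E_prod {n : ℕ} (p : ℝ) (a b : Sym2 (Fin n) → ℝ) :
    E p (fun G => ∏ e ∈ ES n, if e ∈ eset G then a e else b e) =
      ∏ e ∈ ES n, (p * a e + (1 - p) * b e) := by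
  rw [Finset.prod_add]
  unfold E
  have key : ∀ t : Finset (Sym2 (Fin n)), t ⊆ ES n →
      eset (SimpleGraph.fromEdgeSet (t : Set (Sym2 (Fin n)))) = t := by
    intro t ht
    ext e
    rw [mem_eset, SimpleGraph.edgeSet_fromEdgeSet]
    simp only [Set.mem_sdiff, Finset.mem_coe]
    constructor
    · exact fun h => h.1
    · intro h
      refine ⟨h, ?_⟩
      have := (mem_ES e).1 (ht h)
      simpa using this
  refine Finset.sum_bij' (fun G _ => eset G)
    (fun t _ => SimpleGraph.fromEdgeSet (t : Set (Sym2 (Fin n)))) ?_ ?_ ?_ ?_ ?_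
  · intro G _
    exact Finset.mem_powerset.2 (eset_sub G)
  · intro t _; exact Finset.mem_univ _
  · intro G _
    ext x y
    simp only [SimpleGraph.fromEdgeSet_adj, Finset.mem_coe, mem_eset, SimpleGraph.mem_edgeSet]
    exact ⟨fun h => h.1, fun h => ⟨h, h.ne⟩⟩
  · intro t ht
    exact key t (Finset.mem_powerset.1 ht)
  · intro G _
    rw [Finset.prod_mul_distrib, Finset.prod_mul_distrib, Finset.prod_const, Finset.prod_const,
      Finset.card_sdiff_of_subset (eset_sub G), card_ES]
    unfold W
    have h : (∏ e ∈ ES n, if e ∈ eset G then a e else b e) =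
        (∏ e ∈ eset G, a e) * ∏ e ∈ ES n \ eset G, b e := by
      rw [Finset.prod_ite]
      congr 1
      · congr 1
        ext e
        simp only [Finset.mem_filter]
        exact ⟨fun h => h.2, fun h => ⟨eset_sub G h, h⟩⟩
      · congr 1
        ext e
        simp
    show _ * (∏ e ∈ ES n, if e ∈ eset G then a e else b e) = _
    rw [h]; ring

lemma E_mono {n : ℕ} {p : ℝ} (h0 : 0 ≤ p) (h1 : p ≤ 1) {f g : SimpleGraph (Fin n) → ℝ}
    (h : ∀ G, f G ≤ g G) : E p f ≤ E p g :=
  Finset.sum_le_sum fun G _ => mul_le_mul_of_nonneg_left (h G) (W_nonneg h0 h1 G)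

lemma E_one {n : ℕ} (p : ℝ) : E p (fun _ : SimpleGraph (Fin n) => (1 : ℝ)) = 1 := by
  have := E_prod (n := n) p (fun _ => 1) (fun _ => 1)
  simpa using this

lemma E_sum {n : ℕ} {ι : Type*} (p : ℝ) (s : Finset ι) (f : ι → SimpleGraph (Fin n) → ℝ) :
    E p (fun G => ∑ i ∈ s, f i G) = ∑ i ∈ s, E p (f i) := by
  unfold E
  simp only [Finset.mul_sum]
  rw [Finset.sum_comm]

lemma E_mul_const {n : ℕ} (p : ℝ) (f : SimpleGraph (Fin n) → ℝ) (c : ℝ) :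
    E p (fun G => f G * c) = E p f * c := by
  unfold E
  rw [Finset.sum_mul]
  exact Finset.sum_congr rfl fun G _ => by ring

lemma gnpProb_eq {n : ℕ} (p : ℝ) (A : Set (SimpleGraph (Fin n))) :
    gnpProb n p A = E p (fun G => if G ∈ A then 1 else 0) := by
  unfold gnpProb E
  rw [Finset.sum_filter]
  refine Finset.sum_congr rfl fun G _ => ?_
  simp only [mul_ite, mul_one, mul_zero]
  rfl

lemma prob_le {n : ℕ} {p : ℝ} (h0 : 0 ≤ p) (h1 : p ≤ 1) (A : Set (SimpleGraph (Fin n)))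
    (f : SimpleGraph (Fin n) → ℝ) (hf : ∀ G, 0 ≤ f G) (hA : ∀ G ∈ A, 1 ≤ f G) :
    gnpProb n p A ≤ E p f := by
  rw [gnpProb_eq]
  refine E_mono h0 h1 fun G => ?_
  split_ifs with h
  · exact hA G h
  · exact hf G

lemma prob_le_one {n : ℕ} {p : ℝ} (h0 : 0 ≤ p) (h1 : p ≤ 1) (A : Set (SimpleGraph (Fin n))) :
    gnpProb n p A ≤ 1 := by
  have := prob_le h0 h1 A (fun _ => 1) (fun _ => zero_le_one) (fun _ _ => le_rfl)
  rwa [E_one] at this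

lemma prob_union {n : ℕ} {p : ℝ} (h0 : 0 ≤ p) (h1 : p ≤ 1) {ι : Type*} (s : Finset ι)
    (A : ι → Set (SimpleGraph (Fin n))) (B : Set (SimpleGraph (Fin n)))
    (hB : ∀ G ∈ B, ∃ i ∈ s, G ∈ A i) :
    gnpProb n p B ≤ ∑ i ∈ s, gnpProb n p (A i) := by
  have h : ∑ i ∈ s, gnpProb n p (A i) =
      E p (fun G => ∑ i ∈ s, if G ∈ A i then (1 : ℝ) else 0) := by
    rw [E_sum]
    exact Finset.sum_congr rfl fun i _ => gnpProb_eq p (A i)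
  rw [h]
  refine prob_le h0 h1 B _ (fun G => Finset.sum_nonneg fun i _ => by split_ifs <;> norm_num) ?_
  intro G hG
  obtain ⟨i, hi, hGi⟩ := hB G hG
  calc (1 : ℝ) = if G ∈ A i then (1 : ℝ) else 0 := by simp [hGi]
    _ ≤ _ := Finset.single_le_sum (f := fun i => if G ∈ A i then (1 : ℝ) else 0)
      (fun i _ => by split_ifs <;> norm_num) hi

lemma E_pow {n : ℕ} (p q : ℝ) (F : Finset (Sym2 (Fin n))) (hF : F ⊆ ES n) :
    E p (fun G => q ^ (eset G ∩ F).card) = (p * q + (1 - p)) ^ F.card := by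
  have h := E_prod (n := n) p (fun e => if e ∈ F then q else 1) (fun _ => 1)
  have h1 : ∀ G : SimpleGraph (Fin n), (∏ e ∈ ES n, if e ∈ eset G then (if e ∈ F then q else 1)
      else (1 : ℝ)) = q ^ (eset G ∩ F).card := by
    intro G
    have : ∀ e ∈ ES n, (if e ∈ eset G then (if e ∈ F then q else 1) else (1 : ℝ)) =
        if e ∈ eset G ∩ F then q else 1 := by
      intro e _
      by_cases h1 : e ∈ eset G <;> by_cases h2 : e ∈ F <;> simp [h1, h2]
    rw [Finset.prod_congr rfl this, Finset.prod_ite_mem, Finset.prod_const,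
      Finset.inter_eq_right.2 (Finset.inter_subset_right.trans hF)]
  simp only [h1] at h
  rw [h]
  have : ∀ e ∈ ES n, (p * (if e ∈ F then q else 1) + (1 - p) * 1) =
      if e ∈ F then (p * q + (1 - p)) else 1 := by
    intro e _
    split_ifs <;> ring
  rw [Finset.prod_congr rfl this, Finset.prod_ite_mem, Finset.prod_const,
      Finset.inter_eq_right.2 hF]

/-- Joint expectation of an edge indicator and a power. -/
lemma E_edge_pow {n : ℕ} (p : ℝ) (F : Finset (Sym2 (Fin n))) (hF : F ⊆ ES n)
    (e0 : Sym2 (Fin n)) (he0 : e0 ∈ F) :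
    E p (fun G => if e0 ∈ eset G then (2 : ℝ) ^ (eset G ∩ F).card else 0) =
      2 * p * (1 + p) ^ (F.card - 1) := by
  have h := E_prod (n := n) p (fun e => if e ∈ F then 2 else 1) (fun e => if e = e0 then 0 else 1)
  have h1 : ∀ G : SimpleGraph (Fin n), (∏ e ∈ ES n, if e ∈ eset G then (if e ∈ F then 2 else 1)
      else (if e = e0 then (0 : ℝ) else 1)) =
      if e0 ∈ eset G then (2 : ℝ) ^ (eset G ∩ F).card else 0 := by
    intro G
    split_ifs with hG
    · have : ∀ e ∈ ES n, (if e ∈ eset G then (if e ∈ F then 2 else 1)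
          else (if e = e0 then (0 : ℝ) else 1)) =
          if e ∈ eset G ∩ F then 2 else 1 := by
        intro e _
        by_cases h1 : e ∈ eset G
        · by_cases h2 : e ∈ F <;> simp [h1, h2]
        · have : e ≠ e0 := by rintro rfl; exact h1 hG
          simp [h1, this]
      rw [Finset.prod_congr rfl this, Finset.prod_ite_mem, Finset.prod_const,
        Finset.inter_eq_right.2 (Finset.inter_subset_right.trans hF)]
    · apply Finset.prod_eq_zero (hF he0)
      simp [hG]
  simp only [h1] at h
  rw [h, ← Finset.mul_prod_erase _ _ (hF he0)]
  have : ∀ e ∈ (ES n).erase e0, (p * (if e ∈ F then 2 else 1) + (1 - p) *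
      (if e = e0 then 0 else 1)) = if e ∈ F.erase e0 then (1 + p) else 1 := by
    intro e he
    have hne := Finset.ne_of_mem_erase he
    by_cases h2 : e ∈ F <;> simp [h2, hne] <;> ring
  rw [Finset.prod_congr rfl this, Finset.prod_ite_mem, Finset.prod_const,
      Finset.inter_eq_right.2 (Finset.erase_subset_erase _ hF), Finset.card_erase_of_mem he0]
  rw [if_pos he0, if_pos rfl]
  ring

lemma ind_eq {n : ℕ} (F T : Finset (Sym2 (Fin n))) (hF : F ⊆ ES n) (hT : T ⊆ F)
    (G : SimpleGraph (Fin n)) :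
    (∏ e ∈ ES n, if e ∈ eset G then (if e ∈ F \ T then (0 : ℝ) else 1) else
      (if e ∈ T then 0 else 1)) = if eset G ∩ F = T then 1 else 0 := by
  split_ifs with h
  · apply Finset.prod_eq_one
    intro e _
    have he : e ∈ T ↔ e ∈ eset G ∧ e ∈ F := by rw [← h, Finset.mem_inter]
    simp only [Finset.mem_sdiff]
    split_ifs <;> first | rfl | (exfalso; tauto)
  · by_contra hne
    apply h
    have hall := Finset.prod_ne_zero_iff.1 hne
    ext e
    rw [Finset.mem_inter]
    by_cases heF : e ∈ F
    · have := hall e (hF heF)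
      by_cases h1 : e ∈ eset G <;> by_cases h2 : e ∈ T <;> simp [h1, h2, heF] at this ⊢
    · have : e ∉ T := fun h => heF (hT h)
      tauto

/-- Independence. -/
lemma E_ind_pow {n : ℕ} (p : ℝ) (F T B : Finset (Sym2 (Fin n))) (hF : F ⊆ ES n) (hT : T ⊆ F)
    (hB : B ⊆ ES n) (hFB : Disjoint F B) :
    E p (fun G => (if eset G ∩ F = T then 1 else 0) * (2 : ℝ) ^ (eset G ∩ B).card) =
      E p (fun G => if eset G ∩ F = T then 1 else 0) * (1 + p) ^ B.card := by
  have h2 : ∀ G : SimpleGraph (Fin n), (∏ e ∈ ES n, if e ∈ eset G then (if e ∈ B then 2 else 1)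
      else (1 : ℝ)) = 2 ^ (eset G ∩ B).card := by
    intro G
    have : ∀ e ∈ ES n, (if e ∈ eset G then (if e ∈ B then 2 else 1) else (1 : ℝ)) =
        if e ∈ eset G ∩ B then 2 else 1 := by
      intro e _
      by_cases h1 : e ∈ eset G <;> by_cases h2 : e ∈ B <;> simp [h1, h2]
    rw [Finset.prod_congr rfl this, Finset.prod_ite_mem, Finset.prod_const,
      Finset.inter_eq_right.2 (Finset.inter_subset_right.trans hB)]
  have e1 : (1 + p) ^ B.card = E p (fun G : SimpleGraph (Fin n) => (2 : ℝ) ^ (eset G ∩ B).card) := by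
    rw [E_pow p 2 B hB]; congr 1; ring
  rw [e1]
  simp only [← ind_eq F T hF hT, ← h2, ← Finset.prod_mul_distrib]
  have h3 := E_prod (n := n) p
    (fun e => (if e ∈ F \ T then (0 : ℝ) else 1) * (if e ∈ B then 2 else 1))
    (fun e => (if e ∈ T then (0 : ℝ) else 1) * 1)
  rw [E_prod p (fun e => if e ∈ F \ T then (0 : ℝ) else 1) (fun e => if e ∈ T then (0 : ℝ) else 1),
    E_prod p (fun e => if e ∈ B then 2 else 1) (fun _ => (1 : ℝ)), ← Finset.prod_mul_distrib]
  refine Eq.trans ?_ (h3.trans ?_)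
  · congr 1
    funext G
    refine Finset.prod_congr rfl fun e _ => ?_
    split_ifs <;> simp
  · refine Finset.prod_congr rfl fun e _ => ?_
    by_cases hb : e ∈ B
    · have hf : e ∉ F := fun h => Finset.disjoint_left.1 hFB h hb
      have ht : e ∉ T := fun h => hf (hT h)
      simp [hb, hf, ht]
    · simp [hb]

lemma mk_inj {n : ℕ} (w : Fin n) : Function.Injective (fun x => s(w, x)) := by
  intro x y h
  simp only [Sym2.eq_iff] at h
  rcases h with h | h
  · exact h.2
  · exact h.2.trans h.1

/-- star at `w` to `X` -/
def star {n : ℕ} (w : Fin n) (X : Finset (Fin n)) : Finset (Sym2 (Fin n)) :=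
  (X.erase w).image fun x => s(w, x)

lemma star_sub {n : ℕ} (w : Fin n) (X : Finset (Fin n)) : star w X ⊆ ES n := by
  intro e he
  simp only [star, Finset.mem_image, Finset.mem_erase] at he
  obtain ⟨x, ⟨hx, _⟩, rfl⟩ := he
  rw [mem_ES, Sym2.mk_isDiag_iff]
  exact fun h => hx h.symm

lemma star_card {n : ℕ} (w : Fin n) (X : Finset (Fin n)) : (star w X).card = (X.erase w).card := by
  exact Finset.card_image_of_injective _ (mk_inj w)

lemma inter_star {n : ℕ} (G : SimpleGraph (Fin n)) (w : Fin n) (X : Finset (Fin n)) :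
    eset G ∩ star w X = (X.filter fun x => G.Adj w x).image fun x => s(w, x) := by
  ext e
  simp only [star, Finset.mem_inter, Finset.mem_image, Finset.mem_erase, mem_eset,
    Finset.mem_filter]
  constructor
  · rintro ⟨h, x, ⟨_, hx⟩, rfl⟩
    exact ⟨x, ⟨hx, h⟩, rfl⟩
  · rintro ⟨x, ⟨hx, h⟩, rfl⟩
    exact ⟨h, x, ⟨h.ne', hx⟩, rfl⟩

lemma degIn_eq {n : ℕ} (G : SimpleGraph (Fin n)) (w : Fin n) (X : Finset (Fin n)) :
    (eset G ∩ star w X).card = degIn G w X := by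
  rw [inter_star]
  unfold degIn
  exact Finset.card_image_of_injective _ (mk_inj w)

lemma one_le_two_pow_exp (k : ℕ) (M : ℝ) (h : M ≤ k) :
    1 ≤ (2 : ℝ) ^ k * Real.exp (-(M / 2)) := by
  have h1 : Real.exp (1 / 2 : ℝ) ≤ 2 := by
    have : (1 / 2 : ℝ) ≤ Real.log 2 := by linarith [Real.log_two_gt_d9]
    calc Real.exp (1 / 2 : ℝ) ≤ Real.exp (Real.log 2) := Real.exp_le_exp.2 this
      _ = 2 := Real.exp_log (by norm_num)
  have h2 : Real.exp (M / 2) ≤ 2 ^ k := by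
    calc Real.exp (M / 2) ≤ Real.exp (k * (1 / 2)) := Real.exp_le_exp.2 (by linarith)
      _ = Real.exp (1 / 2) ^ k := by rw [Real.exp_nat_mul]
      _ ≤ 2 ^ k := pow_le_pow_left₀ (Real.exp_pos _).le h1 k
  rw [Real.exp_neg]
  rw [← div_eq_mul_inv, one_le_div (Real.exp_pos _)]
  exact h2

lemma one_add_pow_le (p : ℝ) (h0 : 0 ≤ p) (k : ℕ) (x : ℝ) (h : p * k ≤ x) :
    (1 + p) ^ k ≤ Real.exp x := by
  calc (1 + p) ^ k ≤ Real.exp p ^ k :=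
        pow_le_pow_left₀ (by linarith) (by linarith [Real.add_one_le_exp p]) k
    _ = Real.exp (k * p) := by rw [Real.exp_nat_mul]
    _ ≤ Real.exp x := Real.exp_le_exp.2 (by linarith)

/-- Upper tail. -/
lemma upper_tail {n : ℕ} {p : ℝ} (h0 : 0 ≤ p) (h1 : p ≤ 1) (w : Fin n) (X : Finset (Fin n))
    (M : ℝ) :
    gnpProb n p {G | M ≤ (degIn G w X : ℝ)} ≤ Real.exp (p * X.card - M / 2) := by
  refine (prob_le h0 h1 _ (fun G => (2 : ℝ) ^ (eset G ∩ star w X).card * Real.exp (-(M / 2)))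
    (fun G => by positivity) ?_).trans ?_
  · intro G hG
    apply one_le_two_pow_exp
    rw [degIn_eq]
    exact hG
  · rw [E_mul_const, E_pow p 2 _ (star_sub w X), sub_eq_add_neg (p * _), Real.exp_add]
    apply mul_le_mul_of_nonneg_right _ (Real.exp_pos _).le
    have : p * 2 + (1 - p) = 1 + p := by ring
    rw [this]
    apply one_add_pow_le p h0
    apply mul_le_mul_of_nonneg_left _ h0
    rw [star_card]
    exact_mod_cast Finset.card_erase_le

/-- Lower tail. -/
lemma lower_tail {n : ℕ} {p : ℝ} (h0 : 0 ≤ p) (h1 : p ≤ 1) (w : Fin n) (η : ℝ) (hη : 0 < η) :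
    gnpProb n p {G | (degIn G w Finset.univ : ℝ) ≤ (1 - η) * n * p} ≤
      Real.exp (p * η - η ^ 2 / 2 * (n * p)) := by
  refine (prob_le h0 h1 _ (fun G => (Real.exp (-η)) ^ (eset G ∩ star w Finset.univ).card *
    Real.exp (η * ((1 - η) * n * p)))
    (fun G => by positivity) ?_).trans ?_
  · intro G hG
    rw [← Real.exp_nat_mul, ← Real.exp_add]
    apply Real.one_le_exp
    rw [degIn_eq]
    have : (degIn G w Finset.univ : ℝ) ≤ (1 - η) * n * p := hG
    nlinarith
  · rw [E_mul_const, E_pow p _ _ (star_sub w _), star_card]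
    have hn : ((Finset.univ.erase w).card : ℝ) = n - 1 := by
      rw [Finset.card_erase_of_mem (Finset.mem_univ _), Finset.card_univ, Fintype.card_fin,
        Nat.cast_sub (by have := w.pos; omega)]
      simp
    have hq : Real.exp (-η) ≤ 1 - η + η ^ 2 / 2 := by
      have h2 := Real.quadratic_le_exp_of_nonneg hη.le
      rw [Real.exp_neg, inv_le_comm₀ (Real.exp_pos _) (by nlinarith [sq_nonneg (η - 1)])]
      refine le_trans ?_ h2
      rw [inv_le_iff_one_le_mul₀ (by nlinarith [sq_nonneg (η - 1)])]
      nlinarith [sq_nonneg (η ^ 2)]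
    have hq2 : p * Real.exp (-η) + (1 - p) ≤ Real.exp (p * (-η + η ^ 2 / 2)) := by
      refine le_trans ?_ (Real.add_one_le_exp _)
      nlinarith
    have hq3 : 0 ≤ p * Real.exp (-η) + (1 - p) := by
      have := Real.exp_pos (-η)
      have := mul_nonneg h0 this.le
      linarith
    calc _ ≤ Real.exp (p * (-η + η ^ 2 / 2)) ^ (Finset.univ.erase w).card *
          Real.exp (η * ((1 - η) * n * p)) :=
          mul_le_mul_of_nonneg_right (pow_le_pow_left₀ hq3 hq2 _) (Real.exp_pos _).le
      _ = Real.exp ((n - 1) * (p * (-η + η ^ 2 / 2)) + η * ((1 - η) * n * p)) := by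
          rw [← Real.exp_nat_mul, hn, Real.exp_add]
      _ ≤ _ := by
          apply Real.exp_le_exp.2
          nlinarith [mul_nonneg h0 (sq_nonneg η)]

/-- The total number of edges from `S` to heavy vertices. -/
lemma bad_bound {n : ℕ} {p : ℝ} (h0 : 0 ≤ p) (h1 : p ≤ 1) (S : Finset (Fin n))
    (K R : ℝ) (hR : 0 < R) :
    gnpProb n p {G | R ≤ ((∑ v ∈ S, (Finset.univ.filter fun w =>
      G.Adj v w ∧ K ≤ (degIn G w S : ℝ)).card : ℕ) : ℝ)} ≤
      S.card * n * (2 * p * Real.exp (p * S.card - K / 2)) / R := by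
  refine (prob_le h0 h1 _ (fun G => (∑ v ∈ S, ∑ w : Fin n, (if s(w, v) ∈ eset G then
    (2 : ℝ) ^ (eset G ∩ star w S).card else 0)) * (Real.exp (-(K / 2)) / R)) ?_ ?_).trans ?_
  · intro G
    refine mul_nonneg (Finset.sum_nonneg fun v _ => Finset.sum_nonneg fun w _ => ?_)
      (by positivity)
    split_ifs <;> positivity
  · intro G hG
    have hG' : R ≤ ((∑ v ∈ S, (Finset.univ.filter fun w =>
      G.Adj v w ∧ K ≤ (degIn G w S : ℝ)).card : ℕ) : ℝ) := hG
    rw [mul_div_assoc', one_le_div hR]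
    refine hG'.trans ?_
    push_cast
    rw [Finset.sum_mul]
    refine Finset.sum_le_sum fun v _ => ?_
    rw [Finset.card_filter, Finset.sum_mul]
    push_cast
    refine Finset.sum_le_sum fun w _ => ?_
    split_ifs with hA hB hB
    · apply one_le_two_pow_exp
      rw [degIn_eq]; exact hA.2
    · exact absurd ((mem_eset G _).2 (G.mem_edgeSet.2 hA.1.symm)) hB
    · positivity
    · simp
  · rw [E_mul_const, E_sum]
    have key : ∀ v ∈ S, E p (fun G : SimpleGraph (Fin n) => ∑ w : Fin n,
        (if s(w, v) ∈ eset G then (2 : ℝ) ^ (eset G ∩ star w S).card else 0)) ≤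
        n * (2 * p * Real.exp (p * S.card)) := by
      intro v hv
      rw [E_sum]
      refine (Finset.sum_le_card_nsmul _ _ (2 * p * Real.exp (p * S.card)) ?_).trans ?_
      · intro w _
        by_cases hvw : v = w
        · subst hvw
          have : ∀ G : SimpleGraph (Fin n), s(v, v) ∉ eset G := by
            intro G h
            rw [mem_eset, SimpleGraph.mem_edgeSet] at h
            exact G.loopless.irrefl v h
          simp only [this, if_false]
          unfold E
          simp only [mul_zero, Finset.sum_const_zero]
          positivity
        · rw [E_edge_pow p _ (star_sub w S) s(w, v)
            (Finset.mem_image.2 ⟨v, Finset.mem_erase.2 ⟨hvw, hv⟩, rfl⟩)]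
          refine mul_le_mul_of_nonneg_left ?_ (by positivity)
          apply one_add_pow_le p h0
          apply mul_le_mul_of_nonneg_left _ h0
          rw [star_card]
          exact_mod_cast (Nat.sub_le _ _).trans Finset.card_erase_le
      · simp
    have h2 := Finset.sum_le_card_nsmul _ _ _ key
    refine (mul_le_mul_of_nonneg_right h2 (by positivity)).trans ?_
    rw [sub_eq_add_neg (p * _), Real.exp_add, nsmul_eq_mul]
    apply le_of_eq
    ring

/-- Edges between the parts of `N` inside and outside `S`. -/
def Cross {n : ℕ} (N S : Finset (Fin n)) : Finset (Sym2 (Fin n)) :=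
  ((N ∩ S) ×ˢ (N \ S)).image fun q => s(q.1, q.2)

lemma cross_sub {n : ℕ} (N S : Finset (Fin n)) : Cross N S ⊆ ES n := by
  intro e he
  simp only [Cross, Finset.mem_image, Finset.mem_product, Finset.mem_inter,
    Finset.mem_sdiff] at he
  obtain ⟨⟨v, x⟩, ⟨⟨_, hv⟩, _, hx⟩, rfl⟩ := he
  rw [mem_ES, Sym2.mk_isDiag_iff]
  intro h
  exact hx (h ▸ hv)

lemma star_cross_disj {n : ℕ} (N S : Finset (Fin n)) (w : Fin n) (hw : w ∉ N) :
    Disjoint (star w Finset.univ) (Cross N S) := by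
  rw [Finset.disjoint_left]
  intro e he he'
  simp only [Cross, Finset.mem_image, Finset.mem_product, Finset.mem_inter,
    Finset.mem_sdiff] at he'
  obtain ⟨⟨v, x⟩, ⟨⟨hvN, hv⟩, hxN, hx⟩, rfl⟩ := he'
  simp only [star, Finset.mem_image] at he
  obtain ⟨y, _, hy⟩ := he
  rw [Sym2.eq_iff] at hy
  rcases hy with h | h
  · exact hw (h.1 ▸ hvN)
  · exact hw (h.1 ▸ hxN)

/-- Number of triangles at `w` with one further vertex in `S` and one outside. -/
def triCount {n : ℕ} (G : SimpleGraph (Fin n)) (w : Fin n) (S : Finset (Fin n)) : ℕ :=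
  ((S ×ˢ Sᶜ).filter fun q : Fin n × Fin n =>
    G.Adj w q.1 ∧ G.Adj w q.2 ∧ G.Adj q.1 q.2).card

lemma triCount_le {n : ℕ} (G : SimpleGraph (Fin n)) (w : Fin n) (S N : Finset (Fin n))
    (hN : ∀ x, x ∈ N ↔ G.Adj w x) : triCount G w S ≤ (eset G ∩ Cross N S).card := by
  unfold triCount
  refine Finset.card_le_card_of_injOn (fun q => s(q.1, q.2)) ?_ ?_
  · intro q hq
    simp only [Finset.coe_filter, Set.mem_ofPred_eq, Finset.mem_product, Finset.mem_compl] at hq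
    simp only [Finset.mem_coe, Finset.mem_inter, mem_eset, SimpleGraph.mem_edgeSet]
    refine ⟨hq.2.2.2, Finset.mem_image.2 ⟨q, ?_, rfl⟩⟩
    simp only [Finset.mem_product, Finset.mem_inter, Finset.mem_sdiff, hN]
    tauto
  · rintro ⟨a, b⟩ hq ⟨c, d⟩ hr h
    simp only [Finset.coe_filter, Set.mem_ofPred_eq, Finset.mem_product, Finset.mem_compl] at hq hr
    simp only [Sym2.eq_iff] at h
    rcases h with h | h
    · ext1 <;> simp [h.1, h.2]
    · exact absurd (h.1 ▸ hq.1.1) hr.1.2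

lemma star_inj {n : ℕ} (w : Fin n) (N N' : Finset (Fin n)) (h : w ∉ N) (h' : w ∉ N')
    (he : star w N = star w N') : N = N' := by
  unfold star at he
  rw [Finset.erase_eq_of_notMem h, Finset.erase_eq_of_notMem h'] at he
  exact Finset.image_injective (mk_inj w) he

lemma tri_bound {n : ℕ} {p : ℝ} (h0 : 0 ≤ p) (h1 : p ≤ 1) (w : Fin n) (S : Finset (Fin n))
    (K L M : ℝ) (hK : 0 ≤ K) :
    gnpProb n p {G | (degIn G w S : ℝ) ≤ K ∧ (degIn G w Finset.univ : ℝ) ≤ L ∧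
      M ≤ (triCount G w S : ℝ)} ≤ Real.exp (p * (K * L) - M / 2) := by
  set good : Finset (Finset (Fin n)) := Finset.univ.filter fun N =>
    w ∉ N ∧ ((N ∩ S).card : ℝ) ≤ K ∧ (N.card : ℝ) ≤ L with hgood
  refine (prob_le h0 h1 _ (fun G => (∑ N ∈ good,
    (if eset G ∩ star w Finset.univ = star w N then 1 else 0) *
      (2 : ℝ) ^ (eset G ∩ Cross N S).card) * Real.exp (-(M / 2))) ?_ ?_).trans ?_
  · intro G
    refine mul_nonneg (Finset.sum_nonneg fun N _ => ?_) (by positivity)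
    split_ifs <;> positivity
  · rintro G ⟨hG1, hG2, hG3⟩
    set N : Finset (Fin n) := Finset.univ.filter fun x => G.Adj w x with hNdef
    have hN : ∀ x, x ∈ N ↔ G.Adj w x := by intro x; simp [hNdef]
    have hwN : w ∉ N := by rw [hN]; exact G.loopless.irrefl w
    have hNS : N ∩ S = S.filter fun x => G.Adj w x := by
      ext x; simp only [Finset.mem_inter, hN, Finset.mem_filter]; tauto
    have hNg : N ∈ good := by
      rw [hgood, Finset.mem_filter]
      refine ⟨Finset.mem_univ _, hwN, ?_, ?_⟩
      · rw [hNS]; exact hG1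
      · exact hG2
    have hst : eset G ∩ star w Finset.univ = star w N := by
      rw [inter_star, star, Finset.erase_eq_of_notMem hwN]
    have hle : (2 : ℝ) ^ (eset G ∩ Cross N S).card ≤ ∑ N ∈ good,
        (if eset G ∩ star w Finset.univ = star w N then 1 else 0) *
        (2 : ℝ) ^ (eset G ∩ Cross N S).card := by
      refine le_trans (le_of_eq ?_) (Finset.single_le_sum (f := fun N =>
        (if eset G ∩ star w Finset.univ = star w N then 1 else 0) *
        (2 : ℝ) ^ (eset G ∩ Cross N S).card) ?_ hNg)
      · simp only [if_pos hst, one_mul]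
      · intro i _
        split_ifs <;> positivity
    refine le_trans ?_ (mul_le_mul_of_nonneg_right hle (Real.exp_pos _).le)
    apply one_le_two_pow_exp
    refine hG3.trans ?_
    exact_mod_cast triCount_le G w S N hN
  · rw [E_mul_const, E_sum, sub_eq_add_neg (p * _), Real.exp_add]
    refine mul_le_mul_of_nonneg_right ?_ (Real.exp_pos _).le
    have hnn : ∀ N, 0 ≤ E p (fun G : SimpleGraph (Fin n) =>
        if eset G ∩ star w Finset.univ = star w N then (1 : ℝ) else 0) := by
      intro N
      refine Finset.sum_nonneg fun G _ => mul_nonneg (W_nonneg h0 h1 G) ?_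
      dsimp only
      split_ifs <;> norm_num
    calc _ ≤ ∑ N ∈ good, E p (fun G : SimpleGraph (Fin n) =>
          if eset G ∩ star w Finset.univ = star w N then (1 : ℝ) else 0) *
            Real.exp (p * (K * L)) := by
          refine Finset.sum_le_sum fun N hN => ?_
          rw [hgood, Finset.mem_filter] at hN
          obtain ⟨-, hw, hNK, hNL⟩ := hN
          rw [E_ind_pow p _ _ _ (star_sub w _) ?_ (cross_sub N S) (star_cross_disj N S w hw)]
          · refine mul_le_mul_of_nonneg_left ?_ (hnn N)
            apply one_add_pow_le p h0
            refine mul_le_mul_of_nonneg_left ?_ h0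
            have hc : (Cross N S).card ≤ (N ∩ S).card * N.card := by
              refine Finset.card_image_le.trans ?_
              rw [Finset.card_product]
              exact Nat.mul_le_mul_left _ (Finset.card_le_card Finset.sdiff_subset)
            calc ((Cross N S).card : ℝ) ≤ (N ∩ S).card * N.card := by exact_mod_cast hc
              _ ≤ K * L := mul_le_mul hNK hNL (by positivity) hK
          · exact Finset.image_subset_image (Finset.erase_subset_erase _ (Finset.subset_univ _))
      _ = E p (fun G : SimpleGraph (Fin n) => ∑ N ∈ good,
          if eset G ∩ star w Finset.univ = star w N then (1 : ℝ) else 0) *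
            Real.exp (p * (K * L)) := by rw [E_sum, Finset.sum_mul]
      _ ≤ 1 * Real.exp (p * (K * L)) := by
          refine mul_le_mul_of_nonneg_right ?_ (Real.exp_pos _).le
          refine (E_mono h0 h1 (g := fun _ => 1) fun G => ?_).trans (E_one p).le
          rw [Finset.sum_boole]
          have : (good.filter fun N => eset G ∩ star w Finset.univ = star w N).card ≤ 1 := by
            rw [Finset.card_le_one]
            intro N hN N' hN'
            rw [hgood, Finset.mem_filter, Finset.mem_filter] at hN hN'
            exact star_inj w N N' hN.1.2.1 hN'.1.2.1 (hN.2.symm.trans hN'.2)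
          exact_mod_cast this
      _ = _ := one_mul _

/-- Deterministic part. -/
lemma deterministic {n : ℕ} (G : SimpleGraph (Fin n)) (S : Finset (Fin n)) (K A D : ℝ)
    (hA : 0 ≤ A)
    (h1 : ∀ w, D ≤ (degIn G w Finset.univ : ℝ))
    (h2 : ∀ w, (degIn G w S : ℝ) ≤ A)
    (h3 : ∀ w, (degIn G w S : ℝ) ≤ K → (triCount G w S : ℝ) ≤ A)
    (h4 : ∀ v ∈ S, ((Finset.univ.filter fun w =>
      G.Adj v w ∧ K ≤ (degIn G w S : ℝ)).card : ℝ) ≤ A) :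
    ∃ G' : SimpleGraph (Fin n), G' ≤ G ∧
      (∀ v, D - 3 * A ≤ (degIn G' v Finset.univ : ℝ)) ∧
      (∀ v ∈ S, ¬ ∃ y z : Fin n, G'.Adj v y ∧ G'.Adj v z ∧ G'.Adj y z) := by
  set bad : Fin n → Prop := fun w => K ≤ (degIn G w S : ℝ) with hbad
  let G' : SimpleGraph (Fin n) :=
    { Adj := fun x y => G.Adj x y ∧ ¬ (x ∈ S ∧ bad y) ∧ ¬ (y ∈ S ∧ bad x) ∧
        ¬ (¬ bad x ∧ ¬ bad y ∧ ∃ v ∈ S, G.Adj v x ∧ G.Adj v y)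
      symm := by
        constructor
        rintro x y ⟨ha, hb, hc, hd⟩
        refine ⟨ha.symm, hc, hb, ?_⟩
        rintro ⟨h1, h2, v, hv, h3, h4⟩
        exact hd ⟨h2, h1, v, hv, h4, h3⟩
      loopless := ⟨fun x h => G.loopless.irrefl x h.1⟩ }
  refine ⟨G', fun x y h => h.1, ?_, ?_⟩
  · intro w
    set P1 := S.filter fun x => G.Adj w x with hP1
    set P2 : Finset (Fin n) := if w ∈ S then
      (Finset.univ.filter fun x => G.Adj w x ∧ K ≤ (degIn G x S : ℝ)) else ∅ with hP2
    set P3 : Finset (Fin n) := if bad w then ∅ else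
      ((S ×ˢ Sᶜ).filter fun q : Fin n × Fin n =>
        G.Adj w q.1 ∧ G.Adj w q.2 ∧ G.Adj q.1 q.2).image Prod.snd with hP3
    have c1 : (P1.card : ℝ) ≤ A := h2 w
    have c2 : (P2.card : ℝ) ≤ A := by
      rw [hP2]; split_ifs with h
      · exact h4 w h
      · simpa using hA
    have c3 : (P3.card : ℝ) ≤ A := by
      rw [hP3]; split_ifs with h
      · simpa using hA
      · refine le_trans ?_ (h3 w (not_le.1 h).le)
        exact_mod_cast Finset.card_image_le
    have hsub : (Finset.univ.filter fun x => G.Adj w x) ⊆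
        (Finset.univ.filter fun x => G'.Adj w x) ∪ (P1 ∪ (P2 ∪ P3)) := by
      intro x hx
      have hx : G.Adj w x := by simpa using hx
      simp only [Finset.mem_union, Finset.mem_filter, Finset.mem_univ, true_and]
      by_cases hG' : G'.Adj w x
      · exact Or.inl hG'
      right
      by_cases hxS : x ∈ S
      · left; rw [hP1, Finset.mem_filter]; exact ⟨hxS, hx⟩
      right
      by_cases hwb : w ∈ S ∧ bad x
      · left; rw [hP2, if_pos hwb.1, Finset.mem_filter]; exact ⟨Finset.mem_univ _, hx, hwb.2⟩
      right
      have : ¬ bad w ∧ ¬ bad x ∧ ∃ v ∈ S, G.Adj v w ∧ G.Adj v x := by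
        by_contra hcon
        exact hG' ⟨hx, hwb, fun h => hxS h.1, hcon⟩
      obtain ⟨hbw, hbx, v, hv, hvw, hvx⟩ := this
      rw [hP3, if_neg hbw, Finset.mem_image]
      refine ⟨(v, x), ?_, rfl⟩
      simp only [Finset.mem_filter, Finset.mem_product, Finset.mem_compl]
      exact ⟨⟨hv, hxS⟩, hvw.symm, hx, hvx⟩
    have hcard := (Finset.card_le_card hsub).trans ((Finset.card_union_le _ _).trans
      (Nat.add_le_add_left ((Finset.card_union_le _ _).trans
        (Nat.add_le_add_left (Finset.card_union_le _ _) _)) _))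
    have hcard2 : degIn G w Finset.univ ≤ degIn G' w Finset.univ +
        (P1.card + (P2.card + P3.card)) := by
      unfold degIn
      refine le_trans (le_of_eq ?_) (hcard.trans (le_of_eq ?_)) <;> congr!
    have hcard' : (degIn G w Finset.univ : ℝ) ≤ degIn G' w Finset.univ +
        (P1.card + (P2.card + P3.card)) := by
      exact_mod_cast hcard2
    linarith [h1 w]
  · rintro v hv ⟨y, z, hy, hz, hyz⟩
    exact hyz.2.2.2 ⟨fun h => hy.2.1 ⟨hv, h⟩, fun h => hz.2.1 ⟨hv, h⟩, v, hv, hy.1, hz.1⟩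

lemma prob_two {n : ℕ} {p : ℝ} (h0 : 0 ≤ p) (h1 : p ≤ 1) (A B C : Set (SimpleGraph (Fin n)))
    (h : ∀ G ∈ C, G ∈ A ∨ G ∈ B) : gnpProb n p C ≤ gnpProb n p A + gnpProb n p B := by
  have := prob_union h0 h1 (Finset.univ : Finset Bool) (fun b => if b then A else B) C (by
    intro G hG
    rcases h G hG with h | h
    · exact ⟨true, Finset.mem_univ _, by simpa using h⟩
    · exact ⟨false, Finset.mem_univ _, by simpa using h⟩)
  simpa using this

lemma prob_univ {n : ℕ} (p : ℝ) : gnpProb n p Set.univ = 1 := by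
  rw [gnpProb_eq]
  simp only [Set.mem_univ, if_true]
  exact E_one p

lemma prob_all {n : ℕ} {p : ℝ} (h0 : 0 ≤ p) (h1 : p ≤ 1) (A : Fin n → Set (SimpleGraph (Fin n)))
    (b : ℝ) (h : ∀ w, gnpProb n p (A w) ≤ b) :
    gnpProb n p {G | ∃ w, G ∈ A w} ≤ n * b := by
  refine (prob_union h0 h1 Finset.univ A _ ?_).trans ?_
  · rintro G ⟨w, hw⟩
    exact ⟨w, Finset.mem_univ _, hw⟩
  · refine (Finset.sum_le_card_nsmul _ _ b fun w _ => h w).trans ?_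
    simp

/-- The target property. -/
def Good (η c p : ℝ) (n : ℕ) (G : SimpleGraph (Fin n)) : Prop :=
  ∃ G' : SimpleGraph (Fin n), G' ≤ G ∧
    (∀ v, (1 - 4 * η) * n * p ≤ (degIn G' v Finset.univ : ℝ)) ∧
    c / p ^ 2 ≤ ((Finset.univ.filter fun v : Fin n =>
      ¬ ∃ y z : Fin n, G'.Adj v y ∧ G'.Adj v z ∧ G'.Adj y z).card : ℝ)

lemma main_bound (n : ℕ) (p η c : ℝ) (hη : 0 < η) (hη1 : η ≤ 1) (hc : c = η / 100)
    (hp : 0 < p) (hp1 : p ≤ 1) (hpc : p ^ 2 ≤ c) (hnp : 1 ≤ n * p ^ 2) :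
    1 - (4 * (n * Real.exp (1 - η ^ 2 / 8 * Real.sqrt n)) +
      2 / η * (2 * c / p ^ 2 * Real.exp (-(c / p)))) ≤ gnpProb n p {G | Good η c p n G} := by
  have hcpos : 0 < c := by rw [hc]; positivity
  have hp2 : 0 < p ^ 2 := by positivity
  have hnpos : (0 : ℝ) < n := by
    rcases Nat.eq_zero_or_pos n with h | h
    · subst h; norm_num at hnp
    · exact_mod_cast h
  set s := ⌈c / p ^ 2⌉₊ with hs
  have hs1 : c / p ^ 2 ≤ s := Nat.le_ceil _
  have hs2 : (s : ℝ) ≤ 2 * c / p ^ 2 := by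
    have h1 : (s : ℝ) < c / p ^ 2 + 1 := Nat.ceil_lt_add_one (by positivity)
    have h2 : 1 ≤ c / p ^ 2 := by rwa [one_le_div hp2]
    have h3 : 2 * c / p ^ 2 = c / p ^ 2 + c / p ^ 2 := by ring
    linarith
  have hsp : (s : ℝ) * p ^ 2 ≤ 2 * c := by rwa [le_div_iff₀ hp2] at hs2
  have hsn : s ≤ n := by
    have : (s : ℝ) ≤ n := by
      have h1 : (s : ℝ) * p ^ 2 ≤ n * p ^ 2 := by nlinarith
      exact le_of_mul_le_mul_right h1 hp2
    exact_mod_cast this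
  obtain ⟨S, -, hS⟩ := Finset.exists_subset_card_eq (s := (Finset.univ : Finset (Fin n))) (n := s)
    (by simpa using hsn)
  set x : ℝ := n * p with hx
  have hxpos : 0 < x := by positivity
  have hpx : 1 ≤ x * p := by rw [hx]; nlinarith
  have hps : p * s ≤ 2 * c * x := by
    have : p * s * 1 ≤ p * s * (x * p) := mul_le_mul_of_nonneg_left hpx (by positivity)
    nlinarith
  have hsx : Real.sqrt n ≤ x := by
    apply Real.sqrt_le_iff.2 ⟨hxpos.le, ?_⟩
    rw [hx]; nlinarith
  have hη2 : η ^ 2 ≤ η := by nlinarith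
  have hgoal : ∀ y : ℝ, y ≤ 1 - η ^ 2 / 8 * x →
      Real.exp y ≤ Real.exp (1 - η ^ 2 / 8 * Real.sqrt n) := by
    intro y hy
    apply Real.exp_le_exp.2
    have : η ^ 2 / 8 * Real.sqrt n ≤ η ^ 2 / 8 * x := mul_le_mul_of_nonneg_left hsx (by positivity)
    linarith
  have hη2x : η ^ 2 * x ≤ η * x := mul_le_mul_of_nonneg_right hη2 hxpos.le
  have hηx : 0 < η * x := by positivity
  have hη2x' : 0 < η ^ 2 * x := by positivity
  have hxx : η * x ≤ 1 * x := mul_le_mul_of_nonneg_right hη1 hxpos.le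
  have hcx : c * x = η * x / 100 := by rw [hc]; ring
  set K : ℝ := 4 * (p * s) with hK
  set B := Real.exp (1 - η ^ 2 / 8 * Real.sqrt n) with hB
  have b0 := prob_all hp.le hp1 (fun w => {G | (degIn G w Finset.univ : ℝ) ≤ (1 - η) * n * p}) B
    (fun w => (lower_tail hp.le hp1 w η hη).trans (hgoal _ (by
      have : p * η ≤ 1 := by nlinarith
      rw [← hx]; nlinarith)))
  have b1 := prob_all hp.le hp1 (fun w => {G | η * x ≤ (degIn G w S : ℝ)}) B
    (fun w => (upper_tail hp.le hp1 w S (η * x)).trans (hgoal _ (by rw [hS]; nlinarith)))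
  have b2 := prob_all hp.le hp1 (fun w => {G | 4 * x ≤ (degIn G w Finset.univ : ℝ)}) B
    (fun w => (upper_tail hp.le hp1 w _ (4 * x)).trans (hgoal _ (by
      have : p * (Finset.univ : Finset (Fin n)).card = x := by
        rw [Finset.card_univ, Fintype.card_fin, hx]; ring
      rw [this]; nlinarith)))
  have b3 := prob_all hp.le hp1 (fun w => {G | (degIn G w S : ℝ) ≤ K ∧
      (degIn G w Finset.univ : ℝ) ≤ 4 * x ∧ η * x ≤ (triCount G w S : ℝ)}) B
    (fun w => (tri_bound hp.le hp1 w S K (4 * x) (η * x) (by positivity)).trans (hgoal _ (by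
      have h1 : p * (K * (4 * x)) = 16 * (s * p ^ 2) * x := by rw [hK]; ring
      have h2 : 16 * (s * p ^ 2) * x ≤ 16 * (2 * c) * x := by gcongr
      rw [h1]; nlinarith)))
  have b4 := bad_bound hp.le hp1 S K (η * x) hηx
  have b4' : S.card * n * (2 * p * Real.exp (p * S.card - K / 2)) / (η * x) ≤
      2 / η * (2 * c / p ^ 2 * Real.exp (-(c / p))) := by
    rw [hS]
    have e1 : s * n * (2 * p * Real.exp (p * s - K / 2)) / (η * x) =
        2 / η * (s * Real.exp (-(p * s))) := by
      have : p * s - K / 2 = -(p * s) := by rw [hK]; ring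
      rw [this, hx]
      field_simp
    rw [e1]
    have h3 : c / p ≤ p * s := by
      calc c / p = p * (c / p ^ 2) := by field_simp
        _ ≤ _ := mul_le_mul_of_nonneg_left hs1 hp.le
    gcongr
  set A0 := {G : SimpleGraph (Fin n) | ∃ w, G ∈ {G : SimpleGraph (Fin n) |
    (degIn G w Finset.univ : ℝ) ≤ (1 - η) * n * p}} with hA0
  set A1 := {G : SimpleGraph (Fin n) | ∃ w, G ∈ {G : SimpleGraph (Fin n) |
    η * x ≤ (degIn G w S : ℝ)}} with hA1
  set A2 := {G : SimpleGraph (Fin n) | ∃ w, G ∈ {G : SimpleGraph (Fin n) |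
    4 * x ≤ (degIn G w Finset.univ : ℝ)}} with hA2
  set A3 := {G : SimpleGraph (Fin n) | ∃ w, G ∈ {G : SimpleGraph (Fin n) |
    (degIn G w S : ℝ) ≤ K ∧
      (degIn G w Finset.univ : ℝ) ≤ 4 * x ∧ η * x ≤ (triCount G w S : ℝ)}} with hA3
  set A4 := {G : SimpleGraph (Fin n) | η * x ≤ ((∑ v ∈ S, (Finset.univ.filter fun w =>
      G.Adj v w ∧ K ≤ (degIn G w S : ℝ)).card : ℕ) : ℝ)} with hA4
  have u1 := prob_two hp.le hp1 {G | Good η c p n G} (A0 ∪ (A1 ∪ (A2 ∪ (A3 ∪ A4)))) Set.univ (by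
    intro G _
    by_contra hcon
    push Not at hcon
    obtain ⟨hg, hbad⟩ := hcon
    simp only [Set.mem_union, not_or] at hbad
    obtain ⟨n0, n1, n2, n3, n4⟩ := hbad
    have n0 : ∀ w, (1 - η) * n * p < (degIn G w Finset.univ : ℝ) :=
      fun w => not_le.1 fun h => n0 ⟨w, h⟩
    have n1 : ∀ w, (degIn G w S : ℝ) < η * x := fun w => not_le.1 fun h => n1 ⟨w, h⟩
    have n2 : ∀ w, (degIn G w Finset.univ : ℝ) < 4 * x := fun w => not_le.1 fun h => n2 ⟨w, h⟩
    have n3 : ∀ w, (degIn G w S : ℝ) ≤ K → (triCount G w S : ℝ) < η * x :=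
      fun w hw => not_le.1 fun h => n3 ⟨w, hw, (n2 w).le, h⟩
    have n4 : ((∑ v ∈ S, (Finset.univ.filter fun w =>
      G.Adj v w ∧ K ≤ (degIn G w S : ℝ)).card : ℕ) : ℝ) < η * x := not_le.1 n4
    obtain ⟨G', hle, hdeg, htri⟩ := deterministic G S K (η * x) ((1 - η) * n * p) hηx.le
      (fun w => (n0 w).le) (fun w => (n1 w).le) (fun w hw => (n3 w hw).le) (by
        intro v hv
        refine le_trans ?_ n4.le
        exact_mod_cast Finset.single_le_sum (f := fun v => (Finset.univ.filter fun w =>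
          G.Adj v w ∧ K ≤ (degIn G w S : ℝ)).card) (fun _ _ => Nat.zero_le _) hv)
    apply hg
    refine ⟨G', hle, ?_, ?_⟩
    · intro v
      refine le_trans (le_of_eq ?_) (hdeg v)
      rw [hx]; ring
    · refine hs1.trans ?_
      rw [← hS]
      have : S ⊆ Finset.univ.filter fun v : Fin n =>
          ¬ ∃ y z : Fin n, G'.Adj v y ∧ G'.Adj v z ∧ G'.Adj y z := by
        intro v hv
        rw [Finset.mem_filter]
        exact ⟨Finset.mem_univ _, htri v hv⟩
      exact_mod_cast Finset.card_le_card this)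
  have u2 := prob_two hp.le hp1 A0 (A1 ∪ (A2 ∪ (A3 ∪ A4))) (A0 ∪ (A1 ∪ (A2 ∪ (A3 ∪ A4)))) (fun G h => h)
  have u3 := prob_two hp.le hp1 A1 (A2 ∪ (A3 ∪ A4)) (A1 ∪ (A2 ∪ (A3 ∪ A4))) (fun G h => h)
  have u4 := prob_two hp.le hp1 A2 (A3 ∪ A4) (A2 ∪ (A3 ∪ A4)) (fun G h => h)
  have u5 := prob_two hp.le hp1 A3 A4 (A3 ∪ A4) (fun G h => h)
  rw [prob_univ] at u1
  linarith

end RT14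

/-- **Proposition (removing triangles from `Ω(p⁻²)` vertices).** For every `ε > 0` there are
`C, c > 0` such that if `C·n^{-1/2} ≤ p → 0`, then a.a.s. `G(n,p)` contains a spanning
subgraph of minimum degree at least `(1-ε)np` in which at least `c·p⁻²` vertices lie in no
triangle. -/
theorem stmt_14 (ε : ℝ) (hε : 0 < ε) :
    ∃ C c : ℝ, 0 < C ∧ 0 < c ∧
      ∀ p : ℕ → ℝ, (∀ n : ℕ, C / Real.sqrt n ≤ p n) →
        Filter.Tendsto p Filter.atTop (nhds 0) →
        AAS p (fun n G =>
          ∃ G' : SimpleGraph (Fin n), G' ≤ G ∧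
            (∀ v, (1 - ε) * n * p n ≤ (degIn G' v Finset.univ : ℝ)) ∧
            c / (p n) ^ 2 ≤ ((Finset.univ.filter fun v : Fin n =>
              ¬ ∃ y z : Fin n, G'.Adj v y ∧ G'.Adj v z ∧ G'.Adj y z).card : ℝ)) := by
  set η : ℝ := min (ε / 4) 1 with hηdef
  have hη : 0 < η := lt_min (by linarith) one_pos
  have hη1 : η ≤ 1 := min_le_right _ _
  have hηε : 4 * η ≤ ε := by
    have : η ≤ ε / 4 := min_le_left _ _
    linarith
  set c : ℝ := η / 100 with hc
  have hcpos : 0 < c := by positivity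
  refine ⟨1, c, one_pos, hcpos, ?_⟩
  intro p hp hlim
  unfold AAS
  have hev : ∀ᶠ n : ℕ in Filter.atTop, 0 < p n ∧ p n ≤ 1 ∧ (p n) ^ 2 ≤ c ∧
      1 ≤ (n : ℝ) * (p n) ^ 2 := by
    have hlim2 : Filter.Tendsto (fun n => p n ^ 2) Filter.atTop (nhds 0) := by
      simpa using hlim.pow 2
    filter_upwards [Filter.eventually_gt_atTop 0, hlim.eventually_le_const one_pos,
      hlim2.eventually_le_const hcpos] with n hn h1 h2
    have hn' : (0 : ℝ) < n := by exact_mod_cast hn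
    have hs : 0 < Real.sqrt n := Real.sqrt_pos.2 hn'
    have h3 := hp n
    refine ⟨lt_of_lt_of_le (by positivity) h3, h1, h2, ?_⟩
    rw [div_le_iff₀ hs] at h3
    have h4 := Real.sq_sqrt hn'.le
    nlinarith
  have hlow : Filter.Tendsto (fun n : ℕ => 1 - (4 * (n * Real.exp (1 - η ^ 2 / 8 * Real.sqrt n)) +
      2 / η * (2 * c / p n ^ 2 * Real.exp (-(c / p n))))) Filter.atTop (nhds 1) := by
    have hdec := Real.tendsto_pow_mul_exp_neg_atTop_nhds_zero 2
    have t1 : Filter.Tendsto (fun n : ℕ => η ^ 2 / 8 * Real.sqrt n) Filter.atTop Filter.atTop :=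
      (Real.tendsto_sqrt_atTop.comp tendsto_natCast_atTop_atTop).const_mul_atTop (by positivity)
    have t2 : Filter.Tendsto (fun n : ℕ => c / p n) Filter.atTop Filter.atTop := by
      have h0 : Filter.Tendsto p Filter.atTop (nhdsWithin 0 (Set.Ioi 0)) :=
        tendsto_nhdsWithin_iff.2 ⟨hlim, hev.mono fun n h => h.1⟩
      simpa [div_eq_mul_inv] using (tendsto_inv_nhdsGT_zero.comp h0).const_mul_atTop hcpos
    have l1 := (hdec.comp t1).const_mul (4 * Real.exp 1 * (8 / η ^ 2) ^ 2)
    have l2 := (hdec.comp t2).const_mul (2 / η * (2 / c))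
    have l3 := (l1.add l2).const_sub 1
    simp only [mul_zero, add_zero, sub_zero] at l3
    refine l3.congr' ?_
    filter_upwards [hev] with n hn
    have hpn := hn.1.ne'
    simp only [Function.comp]
    have h4 := Real.sq_sqrt (Nat.cast_nonneg n : (0 : ℝ) ≤ n)
    have e1 : 4 * Real.exp 1 * (8 / η ^ 2) ^ 2 * ((η ^ 2 / 8 * Real.sqrt n) ^ 2 *
        Real.exp (-(η ^ 2 / 8 * Real.sqrt n))) =
        4 * (n * Real.exp (1 - η ^ 2 / 8 * Real.sqrt n)) := by
      rw [sub_eq_add_neg, Real.exp_add, mul_pow, h4]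
      field_simp
    have e2 : 2 / η * (2 / c) * ((c / p n) ^ 2 * Real.exp (-(c / p n))) =
        2 / η * (2 * c / p n ^ 2 * Real.exp (-(c / p n))) := by
      have hc0 : c ≠ 0 := hcpos.ne'
      generalize Real.exp (-(c / p n)) = y
      clear_value c
      field_simp
    rw [e1, e2]
  refine tendsto_of_tendsto_of_tendsto_of_le_of_le' hlow tendsto_const_nhds ?_ ?_
  · filter_upwards [hev] with n hn
    obtain ⟨h1, h2, h3, h4⟩ := hn
    refine (RT14.main_bound n (p n) η c hη hη1 hc h1 h2 h3 h4).trans ?_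
    rw [RT14.gnpProb_eq, RT14.gnpProb_eq]
    refine RT14.E_mono h1.le h2 fun G => ?_
    split_ifs with ha hb
    · exact le_rfl
    · exfalso
      apply hb
      obtain ⟨G', hle, hdeg, hcard⟩ := ha
      refine ⟨G', hle, fun v => le_trans ?_ (hdeg v), hcard⟩
      have : (1 - ε) ≤ 1 - 4 * η := by linarith
      gcongr
    · norm_num
    · exact le_rfl
  · filter_upwards [hev] with n hn
    exact RT14.prob_le_one hn.1.le hn.2.1 _
end
end
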